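/- Let T > 0 and let u̲ ≤ ū be functions on [0,T] × ℝ, each continuous, differentiable in t, and twice differentiable in x, such that ∂_t u̲ ≤ (1/2) u̲ ∂_x² u̲ and ∂_t ū ≥ (1/2) ū ∂_x² ū pointwise (classical sub- and supersolutions of ∂_t u = (1/2) u ∂_x² u), with inf_{[0,T]×ℝ} u̲ > 0. Suppose u₀ : ℝ → ℝ is continuously differentiable and satisfies u̲(0,·) ≤ u₀ ≤ ū(0,·). Then there exists a classical solution u of ∂_t u = (1/2) u ∂_x² u on [0,T] × ℝ with u(0,·) = u₀ (i.e., u is continuous on [0,T] × ℝ, and on (0,T] × ℝ the derivatives ∂_t u and ∂_x² u exist, are continuous, and satisfy the equation pointwise) such that u̲ ≤ u ≤ ū on [0,T] × ℝ. -/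

import Mathlib

open Set

noncomputable section

/-- A first-touching-time argument for a finite family of functions of time. -/
lemma finite_max_principle {ι : Type*} {S : Set ι} (hS : S.Finite) (w : ι → ℝ → ℝ) {a b : ℝ}
    (hc : ∀ i ∈ S, ContinuousOn (w i) (Icc a b)) (h0 : ∀ i ∈ S, w i a < 0)
    (hstep : ∀ t ∈ Ioc a b, ∀ i ∈ S, (∀ j ∈ S, w j t ≤ 0) → w i t = 0 →
      ∃ d < 0, HasDerivWithinAt (w i) d (Icc a b) t) :
    ∀ t ∈ Icc a b, ∀ i ∈ S, w i t < 0 := by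
  by_contra! hcon
  obtain ⟨t', ht', i', hi', hw'⟩ := hcon
  have hclosed : IsClosed (⋃ i ∈ S, Icc a b ∩ w i ⁻¹' Ici 0) :=
    hS.isClosed_biUnion fun i hi => (hc i hi).preimage_isClosed_of_isClosed isClosed_Icc isClosed_Ici
  have hcomp : IsCompact (⋃ i ∈ S, Icc a b ∩ w i ⁻¹' Ici 0) :=
    isCompact_Icc.of_isClosed_subset hclosed (iUnion₂_subset fun i _ => inter_subset_left)
  obtain ⟨t, htA, hmin⟩ := hcomp.exists_isLeast ⟨t', mem_iUnion₂.2 ⟨i', hi', ht', hw'⟩⟩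
  obtain ⟨i, hi, ht, hwi⟩ := mem_iUnion₂.1 htA
  have hneg : ∀ s ∈ Ico a t, ∀ j ∈ S, w j s < 0 := by
    intro s hs j hj
    by_contra! h
    exact absurd (hmin (mem_iUnion₂.2 ⟨j, hj, ⟨hs.1, hs.2.le.trans ht.2⟩, h⟩)) (not_le.2 hs.2)
  have hat : a < t := by
    rcases ht.1.lt_or_eq with h | h
    · exact h
    · subst h
      exact absurd (h0 i hi) (not_lt.2 hwi)
  have hsub : Ico a t ⊆ Icc a b := fun s hs => ⟨hs.1, hs.2.le.trans ht.2⟩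
  have hne : (nhdsWithin t (Ico a t)).NeBot := by
    rw [← mem_closure_iff_nhdsWithin_neBot, closure_Ico hat.ne]
    exact ⟨hat.le, le_rfl⟩
  have hle : ∀ j ∈ S, w j t ≤ 0 := fun j hj =>
    le_of_tendsto ((hc j hj t ht).mono hsub)
      (eventually_nhdsWithin_of_forall fun s hs => (hneg s hs j hj).le)
  have hw0 : w i t = 0 := le_antisymm (hle i hi) hwi
  obtain ⟨d, hd, hder⟩ := hstep t ⟨hat, ht.2⟩ i hi hle hw0
  have hsl := (hasDerivWithinAt_iff_tendsto_slope.1 (hder.mono hsub))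
  have hdiff : Ico a t \ {t} = Ico a t := by
    ext s; simp only [mem_sdiff, mem_Ico, mem_singleton_iff]
    exact ⟨fun h => h.1, fun h => ⟨h, h.2.ne⟩⟩
  rw [hdiff] at hsl
  have : 0 ≤ d := by
    refine ge_of_tendsto hsl (eventually_nhdsWithin_of_forall fun s hs => ?_)
    rw [slope_def_field, hw0]
    exact div_nonneg_of_nonpos (by linarith [hneg s hs i hi]) (by linarith [hs.2])
  linarith

lemma exists_barrier_constants {l B Γ Z R τ : ℝ} (hl : 0 < l) (hB : 0 ≤ B) (hΓ : 0 ≤ Γ)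
    (hZ : 0 ≤ Z) (hR : 0 < R) (hτ : 0 < τ) :
    ∃ M N K δ : ℝ, 0 ≤ M ∧ 8 * Z ≤ M * R ^ 2 ∧ 2 * Z ≤ M * τ ∧ 0 < δ ∧ N * δ ≤ K / 2 ∧
      8 * Z ≤ K * δ ∧ 0 ≤ K ∧ M ≤ N ∧
      2 * (B * (K + 2 * M * R)) + 2 * Γ + M < 2 * (l * (N - M)) := by
  set M := 8 * Z / R ^ 2 + 2 * Z / τ with hM
  have hM0 : 0 ≤ M := by positivity
  set c := (4 * B * M * R + 2 * Γ + M + 1) / (2 * l) with hc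
  have hc0 : 0 ≤ c := by positivity
  set δ := l / (4 * B + l) with hδ
  have hδ0 : 0 < δ := by positivity
  have hδ1 : δ ≤ 1 := by rw [hδ, div_le_one (by positivity)]; linarith
  set K := 4 * (M + c) + 8 * Z / δ with hK
  have hK0 : 0 ≤ K := by positivity
  have hδB : B / l * δ ≤ 1 / 4 := by
    have : B / l * δ = B / (4 * B + l) := by rw [hδ]; field_simp
    rw [this, div_le_iff₀ (by positivity)]; linarith
  refine ⟨M, B * K / l + (M + c), K, δ, hM0, ?_, ?_, hδ0, ?_, ?_, hK0, ?_, ?_⟩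
  · have : M * R ^ 2 = 8 * Z + 2 * Z / τ * R ^ 2 := by rw [hM]; field_simp
    rw [this]; have : 0 ≤ 2 * Z / τ * R ^ 2 := by positivity
    linarith
  · have : M * τ = 8 * Z / R ^ 2 * τ + 2 * Z := by rw [hM]; field_simp
    rw [this]; have : 0 ≤ 8 * Z / R ^ 2 * τ := by positivity
    linarith
  · have e : (B * K / l + (M + c)) * δ = B / l * δ * K + (M + c) * δ := by ring
    have h1 : B / l * δ * K ≤ 1 / 4 * K := by gcongr
    have h2 : (M + c) * δ ≤ M + c := mul_le_of_le_one_right (by positivity) hδ1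
    have h3 : 0 ≤ 8 * Z / δ := by positivity
    rw [e]; linarith
  · have : K * δ = 4 * (M + c) * δ + 8 * Z := by rw [hK]; field_simp
    rw [this]; have : 0 ≤ 4 * (M + c) * δ := by positivity
    linarith
  · have : 0 ≤ B * K / l := by positivity
    linarith
  · have : 2 * (l * (B * K / l + (M + c) - M)) = 2 * B * K + (4 * B * M * R + 2 * Γ + M + 1) := by
      rw [hc]; field_simp; ring
    rw [this]; linarith

lemma finite_int_near (i₀ : ℤ) {h R : ℝ} (hh : 0 < h) :
    {i : ℤ | |(i : ℝ) - i₀| * h ≤ R}.Finite := by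
  refine (Set.finite_Icc (i₀ - ⌈R / h⌉) (i₀ + ⌈R / h⌉)).subset fun i hi => ?_
  have h1 : |(i : ℝ) - i₀| ≤ ⌈R / h⌉ := ((le_div_iff₀ hh).2 hi).trans (Int.le_ceil _)
  rw [abs_le] at h1
  constructor
  · have : ((i₀ - ⌈R / h⌉ : ℤ) : ℝ) ≤ i := by push_cast; linarith
    exact_mod_cast this
  · have : (i : ℝ) ≤ ((i₀ + ⌈R / h⌉ : ℤ) : ℝ) := by push_cast; linarith
    exact_mod_cast this

lemma doubling_step {l B Γ R M N K h x y a₁ b₁ g₁ a₂ b₂ g₂ p q r s : ℝ}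
    (hB : 0 ≤ B) (hM : 0 ≤ M) (hMN : M ≤ N)
    (hmain : 2 * (B * (K + 2 * M * R)) + 2 * Γ + M < 2 * (l * (N - M)))
    (hx : |x| ≤ R) (hy : |y| ≤ R) (hxy : 0 ≤ N * (x - y)) (hG : N * (x - y) ≤ K / 2)
    (ha₁ : 0 ≤ a₁) (hb₁ : 0 ≤ b₁) (s1 : l ≤ (a₁ + b₁) * h ^ 2) (d1 : |(a₁ - b₁) * h| ≤ B)
    (hg₁ : |g₁| ≤ Γ)
    (ha₂ : 0 ≤ a₂) (hb₂ : 0 ≤ b₂) (s2 : l ≤ (a₂ + b₂) * h ^ 2) (d2 : |(a₂ - b₂) * h| ≤ B)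
    (hg₂ : |g₂| ≤ Γ)
    (e1 : p ≤ h * (K - 2 * (N * (x - y)) + 2 * M * x) + h ^ 2 * (M - N))
    (e2 : q ≤ -h * (K - 2 * (N * (x - y)) + 2 * M * x) + h ^ 2 * (M - N))
    (e3 : -r ≤ h * (-(K - 2 * (N * (x - y))) + 2 * M * y) + h ^ 2 * (M - N))
    (e4 : -s ≤ -h * (-(K - 2 * (N * (x - y))) + 2 * M * y) + h ^ 2 * (M - N)) :
    (a₁ * p + b₁ * q + g₁) - (a₂ * r + b₂ * s + g₂) + M < 0 := by
  obtain ⟨G, hGdef⟩ : ∃ G, G = K - 2 * (N * (x - y)) := ⟨_, rfl⟩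
  rw [← hGdef] at e1 e2 e3 e4
  have hG0 : 0 ≤ G := by linarith
  have hGK : G ≤ K := by linarith
  clear hGdef hG hxy
  have f1 := mul_le_mul_of_nonneg_left e1 ha₁
  have f2 := mul_le_mul_of_nonneg_left e2 hb₁
  have f3 := mul_le_mul_of_nonneg_left e3 ha₂
  have f4 := mul_le_mul_of_nonneg_left e4 hb₂
  have k1 : (a₁ - b₁) * h * (G + 2 * M * x) ≤ B * (K + 2 * M * R) := by
    refine (le_abs_self _).trans ?_
    rw [abs_mul]
    refine mul_le_mul d1 ?_ (abs_nonneg _) hB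
    have : M * |x| ≤ M * R := mul_le_mul_of_nonneg_left hx hM
    have h7 := abs_add_le G (2 * M * x)
    rw [abs_of_nonneg hG0, abs_mul, abs_of_nonneg (by positivity : 0 ≤ 2 * M)] at h7
    linarith
  have k2 : (a₂ - b₂) * h * (-G + 2 * M * y) ≤ B * (K + 2 * M * R) := by
    refine (le_abs_self _).trans ?_
    rw [abs_mul]
    refine mul_le_mul d2 ?_ (abs_nonneg _) hB
    have : M * |y| ≤ M * R := mul_le_mul_of_nonneg_left hy hM
    have h7 := abs_add_le (-G) (2 * M * y)
    rw [abs_neg, abs_of_nonneg hG0, abs_mul, abs_of_nonneg (by positivity : 0 ≤ 2 * M)] at h7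
    linarith
  have k3 := mul_le_mul_of_nonneg_right s1 (by linarith : 0 ≤ N - M)
  have k4 := mul_le_mul_of_nonneg_right s2 (by linarith : 0 ≤ N - M)
  have g1' := (abs_le.1 hg₁).2
  have g2' := (abs_le.1 hg₂).1
  linarith

/-- The discrete interior Lipschitz estimate, one-sided, by doubling the space variable. -/
lemma doubling_estimate {l B Γ Z R τ M N K δ h : ℝ}
    (hB : 0 ≤ B) (hR : 0 < R) (hM : 0 ≤ M) (hMR : 8 * Z ≤ M * R ^ 2) (hMτ : 2 * Z ≤ M * τ)
    (hNδ : N * δ ≤ K / 2) (hKδ : 8 * Z ≤ K * δ) (hK : 0 ≤ K) (hMN : M ≤ N)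
    (hmain : 2 * (B * (K + 2 * M * R)) + 2 * Γ + M < 2 * (l * (N - M)))
    (hh : 0 < h) (hhδ : h ≤ δ / 2) (hhR : h ≤ R / 2)
    {z α β γ : ℤ → ℝ → ℝ} {i₀ : ℤ} {t₁ : ℝ} (hτ : 0 < τ)
    (hz : ∀ i : ℤ, |(i : ℝ) - i₀| * h ≤ R → ∀ t ∈ Icc t₁ (t₁ + τ), |z i t| ≤ Z)
    (hode : ∀ i : ℤ, |(i : ℝ) - i₀| * h ≤ R → ∀ t ∈ Icc t₁ (t₁ + τ),
      HasDerivWithinAt (z i) (α i t * (z (i + 1) t - z i t) + β i t * (z (i - 1) t - z i t) + γ i t)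
        (Icc t₁ (t₁ + τ)) t ∧ 0 ≤ α i t ∧ 0 ≤ β i t ∧ l ≤ (α i t + β i t) * h ^ 2 ∧
        |(α i t - β i t) * h| ≤ B ∧ |γ i t| ≤ Γ) :
    z (i₀ + 1) (t₁ + τ) - z i₀ (t₁ + τ) ≤ (K + 1) * h := by
  let X : ℤ → ℝ := fun i => ((i : ℝ) - i₀) * h
  have hX : ∀ i : ℤ, |(i : ℝ) - i₀| * h = |X i| := fun i => by
    simp only [X, abs_mul, abs_of_pos hh]
  simp only [hX] at hz hode
  have hXs : ∀ i : ℤ, X (i + 1) = X i + h := fun i => by simp only [X]; push_cast; ring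
  have hXp : ∀ i : ℤ, X (i - 1) = X i - h := fun i => by simp only [X]; push_cast; ring
  let Ψ : ℤ × ℤ → ℝ → ℝ := fun p t => K * (X p.1 - X p.2) - N * (X p.1 - X p.2) ^ 2
    + M * (X p.1 ^ 2 + X p.2 ^ 2 + (t₁ + τ - t)) + h
  let S : Set (ℤ × ℤ) := {p | |X p.1| ≤ R ∧ |X p.2| ≤ R ∧ 0 ≤ X p.1 - X p.2 ∧ X p.1 - X p.2 ≤ δ}
  let w : ℤ × ℤ → ℝ → ℝ := fun p t => z p.1 t - z p.2 t - Ψ p t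
  have hSfin : S.Finite := by
    have h1 := finite_int_near i₀ hh (R := R)
    simp only [hX] at h1
    exact (h1.prod h1).subset fun p hp => ⟨hp.1, hp.2.1⟩
  have hpar : ∀ p ∈ S, (X p.1 - X p.2) * (K / 2) ≤
      K * (X p.1 - X p.2) - N * (X p.1 - X p.2) ^ 2 := by
    intro p hp
    have h1 := hp.2.2.1
    have h2 := hp.2.2.2
    have hN : 0 ≤ N := hM.trans hMN
    have : N * (X p.1 - X p.2) ≤ K / 2 := (mul_le_mul_of_nonneg_left h2 hN).trans hNδ
    nlinarith
  have hzz : ∀ p ∈ S, ∀ t ∈ Icc t₁ (t₁ + τ), z p.1 t - z p.2 t ≤ 2 * Z := by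
    intro p hp t ht
    have h1 := abs_le.1 (hz p.1 hp.1 t ht)
    have h2 := abs_le.1 (hz p.2 hp.2.1 t ht)
    linarith
  have hbdry : ∀ p ∈ S, ∀ t ∈ Icc t₁ (t₁ + τ),
      (X p.1 - X p.2 < h / 2 ∨ R / 2 ≤ |X p.1| ∨ R / 2 ≤ |X p.2| ∨ δ / 2 ≤ X p.1 - X p.2) →
      w p t < 0 := by
    intro p hp t ht hcase
    have h1 := hpar p hp
    have h2 := hzz p hp t ht
    have h3 : 0 ≤ M * (t₁ + τ - t) := mul_nonneg hM (by linarith [ht.2])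
    have h4 : 0 ≤ M * X p.1 ^ 2 := by positivity
    have h5 : 0 ≤ M * X p.2 ^ 2 := by positivity
    have h6 : 0 ≤ (X p.1 - X p.2) * (K / 2) := mul_nonneg hp.2.2.1 (by linarith)
    simp only [w, Ψ]
    have hR2 : ∀ y : ℝ, R / 2 ≤ |y| → 2 * Z ≤ M * y ^ 2 := by
      intro y hy
      have : (R / 2) ^ 2 ≤ y ^ 2 := by
        rw [← sq_abs y]; gcongr
      nlinarith
    rcases hcase with hc | hc | hc | hc
    · have heq : p.1 = p.2 := by
        have h7 : ((p.1 : ℝ) - p.2) * h < h / 2 := by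
          have : X p.1 - X p.2 = ((p.1 : ℝ) - p.2) * h := by simp only [X]; ring
          linarith
        have h8 : 0 ≤ ((p.1 : ℝ) - p.2) * h := by
          have : X p.1 - X p.2 = ((p.1 : ℝ) - p.2) * h := by simp only [X]; ring
          linarith [hp.2.2.1]
        have h9 : (p.1 : ℝ) - p.2 < 1 := by nlinarith
        have h10 : 0 ≤ (p.1 : ℝ) - p.2 := nonneg_of_mul_nonneg_left h8 hh
        have h11 : p.1 < p.2 + 1 := by exact_mod_cast (by linarith : (p.1 : ℝ) < p.2 + 1)
        have h12 : p.2 ≤ p.1 := by exact_mod_cast (by linarith : (p.2 : ℝ) ≤ p.1)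
        omega
      rw [heq] at h4 ⊢
      nlinarith
    · have := hR2 _ hc; linarith
    · have := hR2 _ hc; linarith
    · have : δ / 2 * (K / 2) ≤ (X p.1 - X p.2) * (K / 2) := by gcongr
      linarith
  have hder : ∀ p ∈ S, ∀ t ∈ Icc t₁ (t₁ + τ), HasDerivWithinAt (w p)
      ((α p.1 t * (z (p.1 + 1) t - z p.1 t) + β p.1 t * (z (p.1 - 1) t - z p.1 t) + γ p.1 t)
      - (α p.2 t * (z (p.2 + 1) t - z p.2 t) + β p.2 t * (z (p.2 - 1) t - z p.2 t) + γ p.2 t)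
      + M) (Icc t₁ (t₁ + τ)) t := by
    intro p hp t ht
    have h1 := (hode p.1 hp.1 t ht).1
    have h2 := (hode p.2 hp.2.1 t ht).1
    have h3 : HasDerivWithinAt (Ψ p) (-M) (Icc t₁ (t₁ + τ)) t := by
      have h4 : HasDerivWithinAt (fun s : ℝ => t₁ + τ - s) (-1) (Icc t₁ (t₁ + τ)) t := by
        simpa using (hasDerivWithinAt_id t _).const_sub (t₁ + τ)
      have h5 := ((((h4.const_add (X p.1 ^ 2 + X p.2 ^ 2)).const_mul M).const_add
        (K * (X p.1 - X p.2) - N * (X p.1 - X p.2) ^ 2)).add_const h)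
      rwa [mul_neg_one] at h5
    have h6 := (h1.sub h2).sub h3
    rw [sub_neg_eq_add] at h6
    exact h6
  have hmp := finite_max_principle hSfin w (a := t₁) (b := t₁ + τ)
    (fun p hp t ht => (hder p hp t ht).continuousWithinAt) ?_ ?_
  · have hmem : ((i₀ + 1, i₀) : ℤ × ℤ) ∈ S := by
      have e1 : X (i₀ + 1) = h := by simp [X]
      have e2 : X i₀ = 0 := by simp [X]
      refine ⟨?_, ?_, ?_, ?_⟩ <;> simp only [e1, e2]
      · rw [abs_of_pos hh]; linarith
      · simpa using hR.le
      · linarith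
      · linarith
    have := hmp (t₁ + τ) ⟨by linarith, le_rfl⟩ _ hmem
    have e1 : X (i₀ + 1) = h := by simp [X]
    have e2 : X i₀ = 0 := by simp [X]
    simp only [w, Ψ, e1, e2] at this
    nlinarith [mul_nonneg (sub_nonneg.2 hMN) (sq_nonneg h)]
  · intro p hp
    have h1 := hpar p hp
    have h2 := hzz p hp t₁ ⟨le_rfl, by linarith⟩
    have h4 : 0 ≤ M * X p.1 ^ 2 := by positivity
    have h5 : 0 ≤ M * X p.2 ^ 2 := by positivity
    have h6 : 0 ≤ (X p.1 - X p.2) * (K / 2) := mul_nonneg hp.2.2.1 (by linarith)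
    simp only [w, Ψ]
    linarith
  · intro t ht p hp hle hw0
    have htI : t ∈ Icc t₁ (t₁ + τ) := ⟨ht.1.le, ht.2⟩
    refine ⟨_, ?_, hder p hp t htI⟩
    by_cases hcase : X p.1 - X p.2 < h / 2 ∨ R / 2 ≤ |X p.1| ∨ R / 2 ≤ |X p.2| ∨ δ / 2 ≤ X p.1 - X p.2
    · exact absurd hw0 (hbdry p hp t htI hcase).ne
    push Not at hcase
    obtain ⟨c1, c2, c3, c4⟩ := hcase
    have c1' : h ≤ X p.1 - X p.2 := by
      have e : X p.1 - X p.2 = ((p.1 : ℝ) - p.2) * h := by simp only [X]; ring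
      rw [e] at c1 ⊢
      have h9 : 0 < (p.1 : ℝ) - p.2 := by
        by_contra! hneg
        nlinarith
      have h11 : p.2 + 1 ≤ p.1 := by
        have : p.2 < p.1 := by exact_mod_cast (by linarith : (p.2 : ℝ) < p.1)
        omega
      have h12 : (p.2 : ℝ) + 1 ≤ p.1 := by exact_mod_cast h11
      nlinarith
    rw [abs_lt] at c2 c3
    have m1 : ((p.1 + 1, p.2) : ℤ × ℤ) ∈ S := by
      refine ⟨?_, hp.2.1, ?_, ?_⟩ <;> simp only [hXs]
      · rw [abs_le]; constructor <;> linarith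
      · linarith
      · linarith
    have m2 : ((p.1 - 1, p.2) : ℤ × ℤ) ∈ S := by
      refine ⟨?_, hp.2.1, ?_, ?_⟩ <;> simp only [hXp]
      · rw [abs_le]; constructor <;> linarith
      · linarith
      · linarith
    have m3 : ((p.1, p.2 + 1) : ℤ × ℤ) ∈ S := by
      refine ⟨hp.1, ?_, ?_, ?_⟩ <;> simp only [hXs]
      · rw [abs_le]; constructor <;> linarith
      · linarith
      · linarith
    have m4 : ((p.1, p.2 - 1) : ℤ × ℤ) ∈ S := by
      refine ⟨hp.1, ?_, ?_, ?_⟩ <;> simp only [hXp]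
      · rw [abs_le]; constructor <;> linarith
      · linarith
      · linarith
    have l1 := hle _ m1
    have l2 := hle _ m2
    have l3 := hle _ m3
    have l4 := hle _ m4
    simp only [w, Ψ, hXs, hXp] at l1 l2 l3 l4 hw0
    obtain ⟨-, a1, b1, s1, d1, g1⟩ := hode p.1 hp.1 t htI
    obtain ⟨-, a2, b2, s2, d2, g2⟩ := hode p.2 hp.2.1 t htI
    have hN : 0 ≤ N := hM.trans hMN
    have hG0 : N * (X p.1 - X p.2) ≤ K / 2 := (mul_le_mul_of_nonneg_left hp.2.2.2 hN).trans hNδ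
    exact doubling_step hB hM hMN hmain hp.1 hp.2.1 (mul_nonneg hN hp.2.2.1) hG0 a1 b1 s1 d1 g1
      a2 b2 s2 d2 g2 (by linarith) (by linarith) (by linarith) (by linarith)

/-- Interior Lipschitz estimate for monotone semi-discrete equations with bounded drift. -/
lemma discrete_lipschitz {l B Γ Z R τ : ℝ} (hl : 0 < l) (hB : 0 ≤ B) (hΓ : 0 ≤ Γ)
    (hZ : 0 ≤ Z) (hR : 0 < R) (hτ : 0 < τ) :
    ∃ K h₀ : ℝ, 0 ≤ K ∧ 0 < h₀ ∧ ∀ h : ℝ, 0 < h → h ≤ h₀ →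
    ∀ (z α β γ : ℤ → ℝ → ℝ) (i₀ : ℤ) (t₂ : ℝ),
    (∀ i : ℤ, |(i : ℝ) - i₀| * h ≤ R → ∀ t ∈ Icc (t₂ - τ) t₂, |z i t| ≤ Z ∧
      HasDerivWithinAt (z i) (α i t * (z (i + 1) t - z i t) + β i t * (z (i - 1) t - z i t) + γ i t)
        (Icc (t₂ - τ) t₂) t ∧ 0 ≤ α i t ∧ 0 ≤ β i t ∧ l ≤ (α i t + β i t) * h ^ 2 ∧
        |(α i t - β i t) * h| ≤ B ∧ |γ i t| ≤ Γ) →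
    |z (i₀ + 1) t₂ - z i₀ t₂| ≤ K * h := by
  obtain ⟨M, N, K, δ, hM, hMR, hMτ, hδ, hNδ, hKδ, hK, hMN, hmain⟩ :=
    exists_barrier_constants hl hB hΓ hZ hR hτ
  refine ⟨K + 1, min (δ / 2) (R / 2), by linarith, by positivity, ?_⟩
  intro h hh hh0 z α β γ i₀ t₂ H
  have h1 := hh0.trans (min_le_left _ _)
  have h2 := hh0.trans (min_le_right _ _)
  obtain ⟨t₁, rfl⟩ : ∃ t₁, t₂ = t₁ + τ := ⟨t₂ - τ, by ring⟩
  rw [add_sub_cancel_right] at H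
  rw [abs_le]
  constructor
  · have := doubling_estimate (z := fun i t => -z i t) (α := α) (β := β) (γ := fun i t => -γ i t)
      hB hR hM hMR hMτ hNδ hKδ hK hMN hmain hh h1 h2 hτ
      (fun i hi t ht => by rw [abs_neg]; exact (H i hi t ht).1)
      (fun i hi t ht => by
        obtain ⟨-, a, b⟩ := H i hi t ht
        refine ⟨?_, by simpa only [abs_neg] using b⟩
        exact a.neg.congr_deriv (by ring))
    linarith
  · exact doubling_estimate hB hR hM hMR hMτ hNδ hKδ hK hMN hmain hh h1 h2 hτ
      (fun i hi t ht => (H i hi t ht).1) (fun i hi t ht => (H i hi t ht).2)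

/-- The function `u` solves the semi-discrete equation with mesh size `h` at the grid index `i`. -/
def SolvesAt (T h : ℝ) (u : ℤ → ℝ → ℝ) (i : ℤ) : Prop :=
  ∀ t ∈ Icc 0 T, HasDerivWithinAt (u i)
    (1 / 2 * u i t * ((u (i + 1) t + u (i - 1) t - 2 * u i t) / h ^ 2)) (Icc 0 T) t

/-- Forward difference quotient. -/
def gridD1 (h : ℝ) (u : ℤ → ℝ → ℝ) (i : ℤ) (t : ℝ) : ℝ := (u (i + 1) t - u i t) / h

/-- Centred second difference quotient. -/
def gridD2 (h : ℝ) (u : ℤ → ℝ → ℝ) (i : ℤ) (t : ℝ) : ℝ :=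
  (gridD1 h u i t - gridD1 h u (i - 1) t) / h

lemma SolvesAt.hasDerivWithinAt_gridD1 {T h : ℝ} (hh : 0 < h) {u : ℤ → ℝ → ℝ} {i : ℤ}
    (h0 : SolvesAt T h u i) (h1 : SolvesAt T h u (i + 1)) {t : ℝ} (ht : t ∈ Icc 0 T) :
    HasDerivWithinAt (gridD1 h u i)
      (u (i + 1) t / (2 * h ^ 2) * (gridD1 h u (i + 1) t - gridD1 h u i t)
        + u i t / (2 * h ^ 2) * (gridD1 h u (i - 1) t - gridD1 h u i t) + 0) (Icc 0 T) t := by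
  refine (((h1 t ht).sub (h0 t ht)).div_const h).congr_deriv ?_
  simp only [gridD1, add_sub_cancel_right, sub_add_cancel]
  field_simp
  ring

lemma SolvesAt.hasDerivWithinAt_gridD2 {T h : ℝ} (hh : 0 < h) {u : ℤ → ℝ → ℝ} {i : ℤ}
    (h0 : SolvesAt T h u (i - 1)) (h1 : SolvesAt T h u i) (h2 : SolvesAt T h u (i + 1)) {t : ℝ}
    (ht : t ∈ Icc 0 T) :
    HasDerivWithinAt (gridD2 h u i)
      (u (i + 1) t / (2 * h ^ 2) * (gridD2 h u (i + 1) t - gridD2 h u i t)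
        + u (i - 1) t / (2 * h ^ 2) * (gridD2 h u (i - 1) t - gridD2 h u i t)
        + 1 / 2 * gridD2 h u i t ^ 2) (Icc 0 T) t := by
  have h0' : SolvesAt T h u (i - 1 + 1) := by rwa [sub_add_cancel]
  refine (((h1.hasDerivWithinAt_gridD1 hh h2 ht).sub
    (h0.hasDerivWithinAt_gridD1 hh h0' ht)).div_const h).congr_deriv ?_
  simp only [gridD2, gridD1, add_sub_cancel_right, sub_add_cancel]
  field_simp
  ring

lemma grid_dist_le {i j : ℤ} {h x₀ a b : ℝ} (hh : 0 < h) (h1 : |(i : ℝ) - j| * h ≤ a)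
    (h2 : |(j : ℝ) * h - x₀| ≤ b) : |(i : ℝ) * h - x₀| ≤ a + b := by
  have h3 : (i : ℝ) * h - x₀ = ((i : ℝ) - j) * h + ((j : ℝ) * h - x₀) := by ring
  rw [h3]
  refine (abs_add_le _ _).trans ?_
  rw [abs_mul, abs_of_pos hh]
  linarith

lemma grid_dist_succ {i : ℤ} {h x₀ b : ℝ} (hh : 0 < h) (h2 : |(i : ℝ) * h - x₀| ≤ b) :
    |((i + 1 : ℤ) : ℝ) * h - x₀| ≤ b + h := by
  rw [abs_le] at h2 ⊢
  push_cast
  constructor <;> linarith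

lemma grid_dist_pred {i : ℤ} {h x₀ b : ℝ} (hh : 0 < h) (h2 : |(i : ℝ) * h - x₀| ≤ b) :
    |((i - 1 : ℤ) : ℝ) * h - x₀| ≤ b + h := by
  rw [abs_le] at h2 ⊢
  push_cast
  constructor <;> linarith

lemma abs_gridD1_le {h C : ℝ} (hh : 0 < h) {u : ℤ → ℝ → ℝ} {i : ℤ} {t : ℝ}
    (H : |u (i + 1) t - u i t| ≤ C * h) : |gridD1 h u i t| ≤ C := by
  rw [gridD1, abs_div, abs_of_pos hh, div_le_iff₀ hh]
  exact H

/-- Interior estimates for the first three difference quotients of semi-discrete solutions. -/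
lemma discrete_regularity {ε M R τ : ℝ} (hε : 0 < ε) (hM : 0 ≤ M) (hR : 0 < R) (hτ : 0 < τ) :
    ∃ C h₀ : ℝ, 0 ≤ C ∧ 0 < h₀ ∧ ∀ h : ℝ, 0 < h → h ≤ h₀ → ∀ (u : ℤ → ℝ → ℝ) (x₀ T : ℝ),
    (∀ i : ℤ, |(i : ℝ) * h - x₀| ≤ R →
      SolvesAt T h u i ∧ ∀ t ∈ Icc 0 T, ε ≤ u i t ∧ u i t ≤ M) →
    ∀ i : ℤ, |(i : ℝ) * h - x₀| ≤ R / 4 → ∀ t ∈ Icc τ T,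
      |gridD1 h u i t| ≤ C ∧ |gridD2 h u i t| ≤ C ∧
        |gridD2 h u (i + 1) t - gridD2 h u i t| ≤ C * h := by
  obtain ⟨C₁, a₁, hC₁, ha₁, H₁⟩ := discrete_lipschitz (l := ε) (B := 0) (Γ := 0) (Z := M)
    (R := R / 8) (τ := τ / 4) hε le_rfl le_rfl hM (by positivity) (by positivity)
  obtain ⟨C₂, a₂, hC₂, ha₂, H₂⟩ := discrete_lipschitz (l := ε) (B := C₁) (Γ := 0) (Z := C₁)
    (R := R / 16) (τ := τ / 4) hε hC₁ le_rfl hC₁ (by positivity) (by positivity)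
  obtain ⟨C₃, a₃, hC₃, ha₃, H₃⟩ := discrete_lipschitz (l := ε) (B := C₁) (Γ := 1 / 2 * C₂ ^ 2)
    (Z := C₂) (R := R / 16) (τ := τ / 4) hε hC₁ (by positivity) hC₂ (by positivity) (by positivity)
  refine ⟨C₁ + C₂ + C₃, min (min a₁ a₂) (min a₃ (R / 16)), by positivity, by positivity, ?_⟩
  intro h hh hh0 u x₀ T H
  have b1 : h ≤ a₁ := hh0.trans ((min_le_left _ _).trans (min_le_left _ _))
  have b2 : h ≤ a₂ := hh0.trans ((min_le_left _ _).trans (min_le_right _ _))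
  have b3 : h ≤ a₃ := hh0.trans ((min_le_right _ _).trans (min_le_left _ _))
  have b4 : h ≤ R / 16 := hh0.trans ((min_le_right _ _).trans (min_le_right _ _))
  have hsub : ∀ {s t : ℝ}, τ / 4 ≤ t → t ≤ T → s ∈ Icc (t - τ / 4) t → s ∈ Icc 0 T :=
    fun h1 h2 hs => ⟨by linarith [hs.1], hs.2.trans h2⟩
  have hsub' : ∀ {t : ℝ}, τ / 4 ≤ t → t ≤ T → Icc (t - τ / 4) t ⊆ Icc 0 T :=
    fun h1 h2 s hs => hsub h1 h2 hs
  have pos : ∀ i : ℤ, |(i : ℝ) * h - x₀| ≤ R → ∀ t ∈ Icc 0 T, 0 ≤ u i t / (2 * h ^ 2) :=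
    fun i hi t ht => div_nonneg (hε.le.trans ((H i hi).2 t ht).1) (by positivity)
  have ell : ∀ i j : ℤ, |(i : ℝ) * h - x₀| ≤ R → |(j : ℝ) * h - x₀| ≤ R → ∀ t ∈ Icc 0 T,
      ε ≤ (u i t / (2 * h ^ 2) + u j t / (2 * h ^ 2)) * h ^ 2 := by
    intro i j hi hj t ht
    have e : (u i t / (2 * h ^ 2) + u j t / (2 * h ^ 2)) * h ^ 2 = (u i t + u j t) / 2 := by
      field_simp
    rw [e]
    linarith [((H i hi).2 t ht).1, ((H j hj).2 t ht).1]
  have P₁ : ∀ i : ℤ, |(i : ℝ) * h - x₀| ≤ 3 * R / 4 → ∀ t, τ / 4 ≤ t → t ≤ T →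
      |gridD1 h u i t| ≤ C₁ := by
    intro i hi t h1 h2
    refine abs_gridD1_le hh (H₁ h hh b1 u (fun i t => u i t / (2 * h ^ 2))
      (fun i t => u i t / (2 * h ^ 2)) (fun _ _ => 0) i t ?_)
    intro j hj s hs
    have hjR : |(j : ℝ) * h - x₀| ≤ R := (grid_dist_le hh hj hi).trans (by linarith)
    have hsI := hsub h1 h2 hs
    obtain ⟨A, B⟩ := H j hjR
    refine ⟨?_, ?_, pos j hjR s hsI, pos j hjR s hsI, ell j j hjR hjR s hsI, by simp, by simp⟩
    · rw [abs_of_nonneg (hε.le.trans (B s hsI).1)]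
      exact (B s hsI).2
    · refine ((A s hsI).mono (hsub' h1 h2)).congr_deriv ?_
      field_simp
      ring
  have P₂ : ∀ i : ℤ, |(i : ℝ) * h - x₀| ≤ R / 2 → ∀ t, τ / 2 ≤ t → t ≤ T →
      |gridD2 h u i t| ≤ C₂ := by
    intro i hi t h1 h2
    have key := H₂ h hh b2 (gridD1 h u) (fun i t => u (i + 1) t / (2 * h ^ 2))
      (fun i t => u i t / (2 * h ^ 2)) (fun _ _ => 0) (i - 1) t ?_
    · rw [sub_add_cancel] at key
      rw [gridD2, abs_div, abs_of_pos hh, div_le_iff₀ hh]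
      exact key
    intro j hj s hs
    have hj' : |(j : ℝ) * h - x₀| ≤ 3 * R / 4 :=
      (grid_dist_le hh hj (grid_dist_pred hh hi)).trans (by linarith)
    have hjR : |(j : ℝ) * h - x₀| ≤ R := hj'.trans (by linarith)
    have hjR' : |((j + 1 : ℤ) : ℝ) * h - x₀| ≤ R := (grid_dist_succ hh hj').trans (by linarith)
    have h1' : τ / 4 ≤ t := by linarith
    have hsI := hsub h1' h2 hs
    have hp := P₁ j hj' s (by linarith [hs.1]) (hs.2.trans h2)
    refine ⟨hp, ?_, pos _ hjR' s hsI, pos _ hjR s hsI, ell _ _ hjR' hjR s hsI, ?_, by simp⟩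
    · exact ((H j hjR).1.hasDerivWithinAt_gridD1 hh (H _ hjR').1 hsI).mono (hsub' h1' h2)
    · have e : (u (j + 1) s / (2 * h ^ 2) - u j s / (2 * h ^ 2)) * h = gridD1 h u j s / 2 := by
        rw [gridD1]; field_simp
      rw [e, abs_div, abs_two]
      linarith
  have P₃ : ∀ i : ℤ, |(i : ℝ) * h - x₀| ≤ R / 4 → ∀ t, τ ≤ t → t ≤ T →
      |gridD2 h u (i + 1) t - gridD2 h u i t| ≤ C₃ * h := by
    intro i hi t h1 h2
    refine H₃ h hh b3 (gridD2 h u) (fun i t => u (i + 1) t / (2 * h ^ 2))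
      (fun i t => u (i - 1) t / (2 * h ^ 2)) (fun i t => 1 / 2 * gridD2 h u i t ^ 2) i t ?_
    intro j hj s hs
    have hj' : |(j : ℝ) * h - x₀| ≤ R / 2 := (grid_dist_le hh hj hi).trans (by linarith)
    have hj1 := grid_dist_succ hh hj'
    have hj2 := grid_dist_pred hh hj'
    have h1' : τ / 4 ≤ t := by linarith
    have hsI := hsub h1' h2 hs
    have hq := P₂ j hj' s (by linarith [hs.1]) (hs.2.trans h2)
    have hp := P₁ j (hj'.trans (by linarith)) s (by linarith [hs.1]) (hs.2.trans h2)
    have hp' := P₁ (j - 1) (hj2.trans (by linarith)) s (by linarith [hs.1]) (hs.2.trans h2)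
    have r0 : |(j : ℝ) * h - x₀| ≤ R := hj'.trans (by linarith)
    have r1 : |((j + 1 : ℤ) : ℝ) * h - x₀| ≤ R := hj1.trans (by linarith)
    have r2 : |((j - 1 : ℤ) : ℝ) * h - x₀| ≤ R := hj2.trans (by linarith)
    refine ⟨hq, ?_, pos _ r1 s hsI, pos _ r2 s hsI, ell _ _ r1 r2 s hsI, ?_, ?_⟩
    · exact (SolvesAt.hasDerivWithinAt_gridD2 hh (H _ r2).1 (H _ r0).1 (H _ r1).1 hsI).mono
        (hsub' h1' h2)
    · have e : (u (j + 1) s / (2 * h ^ 2) - u (j - 1) s / (2 * h ^ 2)) * h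
          = (gridD1 h u j s + gridD1 h u (j - 1) s) / 2 := by
        rw [gridD1, gridD1, sub_add_cancel]; field_simp; ring
      rw [e, abs_div, abs_two]
      linarith [abs_add_le (gridD1 h u j s) (gridD1 h u (j - 1) s)]
    · rw [abs_of_nonneg (by positivity), ← sq_abs]
      gcongr
  intro i hi t ht
  refine ⟨?_, ?_, ?_⟩
  · linarith [P₁ i (hi.trans (by linarith)) t (by linarith [ht.1]) ht.2]
  · linarith [P₂ i (hi.trans (by linarith)) t (by linarith [ht.1]) ht.2]
  · refine (P₃ i hi t ht.1 ht.2).trans ?_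
    gcongr
    linarith

lemma finite_int_near_real (x₀ : ℝ) {h ρ : ℝ} (hh : 0 < h) :
    {i : ℤ | |(i : ℝ) * h - x₀| ≤ ρ}.Finite := by
  refine (Set.finite_Icc ⌊(x₀ - ρ) / h⌋ ⌈(x₀ + ρ) / h⌉).subset fun i hi => ?_
  rw [mem_ofPred_eq, abs_le] at hi
  obtain ⟨h1, h2⟩ := hi
  constructor
  · have : (x₀ - ρ) / h ≤ i := by rw [div_le_iff₀ hh]; linarith
    exact_mod_cast (Int.floor_le _).trans this
  · have : (i : ℝ) ≤ (x₀ + ρ) / h := by rw [le_div_iff₀ hh]; linarith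
    exact_mod_cast this.trans (Int.le_ceil _)

/-- Upper barrier at the initial time. -/
lemma initial_barrier {T h Λ Z ρ x₀ A κ c : ℝ} {z a : ℤ → ℝ → ℝ} (hh : 0 < h) (hhρ : h ≤ ρ / 2)
    (hA : |A| ≤ Z) (hκ : 0 ≤ κ) (hκρ : 8 * Z ≤ κ * ρ ^ 2) (hc : 2 * κ * Λ < c)
    (H : ∀ i : ℤ, |(i : ℝ) * h - x₀| ≤ ρ → ∀ t ∈ Icc 0 T, |z i t| ≤ Z ∧ 0 ≤ a i t ∧ a i t ≤ Λ ∧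
      HasDerivWithinAt (z i) (a i t * ((z (i + 1) t + z (i - 1) t - 2 * z i t) / h ^ 2))
        (Icc 0 T) t)
    (H0 : ∀ i : ℤ, |(i : ℝ) * h - x₀| ≤ ρ → z i 0 ≤ A + κ * (i * h - x₀) ^ 2) :
    ∀ i : ℤ, |(i : ℝ) * h - x₀| ≤ ρ → ∀ t ∈ Icc 0 T,
      z i t ≤ A + κ * (i * h - x₀) ^ 2 + c * t := by
  intro i hi t ht
  refine le_of_forall_pos_le_add fun μ hμ => ?_
  let w : ℤ → ℝ → ℝ := fun i t => z i t - (A + κ * (i * h - x₀) ^ 2 + c * t + μ)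
  have hder : ∀ i : ℤ, |(i : ℝ) * h - x₀| ≤ ρ → ∀ t ∈ Icc 0 T, HasDerivWithinAt (w i)
      (a i t * ((z (i + 1) t + z (i - 1) t - 2 * z i t) / h ^ 2) - c) (Icc 0 T) t := by
    intro i hi t ht
    have h1 : HasDerivWithinAt (fun s => A + κ * (i * h - x₀) ^ 2 + c * s + μ) c (Icc 0 T) t := by
      have := (((hasDerivWithinAt_id t (Icc 0 T)).const_mul c).const_add
        (A + κ * (i * h - x₀) ^ 2)).add_const μ
      rwa [mul_one] at this
    exact (H i hi t ht).2.2.2.sub h1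
  have hT : (0 : ℝ) ≤ T := ht.1.trans ht.2
  have := finite_max_principle (finite_int_near_real x₀ hh (ρ := ρ)) w (a := 0) (b := T)
    (fun i hi t ht => (hder i hi t ht).continuousWithinAt) ?_ ?_ t ht i hi
  · simp only [w] at this
    linarith
  · intro i hi
    have := H0 i hi
    simp only [w]
    linarith
  · intro t ht i hi hle hw0
    have htI : t ∈ Icc 0 T := ⟨ht.1.le, ht.2⟩
    refine ⟨_, ?_, hder i hi t htI⟩
    obtain ⟨hz, ha, haΛ, -⟩ := H i hi t htI
    have hc0 : 0 ≤ c := by nlinarith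
    by_cases hb : ρ / 2 ≤ |(i : ℝ) * h - x₀|
    · exfalso
      have h1 : (ρ / 2) ^ 2 ≤ (i * h - x₀) ^ 2 := by
        rw [← sq_abs ((i : ℝ) * h - x₀)]
        have : 0 ≤ ρ / 2 := hh.le.trans hhρ
        gcongr
      have h2 := mul_le_mul_of_nonneg_left h1 hκ
      have h3 := mul_nonneg hc0 ht.1.le
      simp only [w] at hw0
      linarith [(abs_le.1 hz).2, (abs_le.1 hA).1]
    · push Not at hb
      have l1 := hle (i + 1) ((grid_dist_succ hh hb.le).trans (by linarith))
      have l2 := hle (i - 1) ((grid_dist_pred hh hb.le).trans (by linarith))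
      simp only [w] at l1 l2 hw0
      push_cast at l1 l2
      have h3 : (z (i + 1) t + z (i - 1) t - 2 * z i t) / h ^ 2 ≤ 2 * κ := by
        rw [div_le_iff₀ (by positivity)]
        linarith
      have h4 := mul_le_mul_of_nonneg_left h3 ha
      have h5 : a i t * (2 * κ) ≤ Λ * (2 * κ) := by gcongr
      linarith

/-- Upper barrier at a lateral boundary point. -/
lemma lateral_barrier {l L Z ρ : ℝ} (hl : 0 < l) (hL : 0 ≤ L) (hZ : 0 ≤ Z) (hρ : 0 < ρ) :
    ∃ K : ℝ, 0 ≤ K ∧ ∀ (h t₀ A : ℝ) (z a : ℤ → ℝ → ℝ), 0 < h → h ≤ ρ / 2 → 0 ≤ t₀ →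
    (∀ j : ℤ, 0 ≤ j → (j : ℝ) * h ≤ ρ → ContinuousOn (z j) (Icc 0 t₀) ∧
      ∀ t ∈ Icc 0 t₀, |z j t| ≤ Z) →
    (∀ j : ℤ, 0 < j → (j : ℝ) * h < ρ → ∀ t ∈ Icc 0 t₀, l ≤ a j t ∧
      HasDerivWithinAt (z j) (a j t * ((z (j + 1) t + z (j - 1) t - 2 * z j t) / h ^ 2))
        (Icc 0 t₀) t) →
    (∀ t ∈ Icc 0 t₀, z 0 t ≤ A + L * (t₀ - t)) →
    (∀ j : ℤ, 0 ≤ j → (j : ℝ) * h ≤ ρ → z j 0 ≤ A + L * t₀ + L * (j * h)) →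
    ∀ j : ℤ, 0 ≤ j → (j : ℝ) * h ≤ ρ → z j t₀ ≤ A + K * (j * h) := by
  set N := (L + 1) / (2 * l) with hN
  have hN0 : 0 ≤ N := by positivity
  set K := 2 * N * ρ + 2 * L + 8 * Z / ρ with hK
  have hK0 : 0 ≤ K := by positivity
  have hKρ : 8 * Z ≤ K * ρ := by
    have : K * ρ = (2 * N * ρ + 2 * L) * ρ + 8 * Z := by rw [hK]; field_simp
    rw [this]
    have : 0 ≤ (2 * N * ρ + 2 * L) * ρ := by positivity
    linarith
  have hKN : N * ρ ≤ K / 2 := by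
    have : 0 ≤ 8 * Z / ρ := by positivity
    linarith
  have hKL : L ≤ K / 2 := by
    have : 0 ≤ 8 * Z / ρ := by positivity
    have : 0 ≤ N * ρ := by positivity
    linarith
  refine ⟨K, hK0, ?_⟩
  intro h t₀ A z a hh hhρ ht₀ Hz Hode Hl Hi j hj hjρ
  refine le_of_forall_pos_le_add fun μ hμ => ?_
  have hpar : ∀ j : ℤ, 0 ≤ j → (j : ℝ) * h ≤ ρ →
      K / 2 * (j * h) ≤ K * (j * h) - N * (j * h) ^ 2 := by
    intro j hj hjρ
    have hj' : (0 : ℝ) ≤ j * h := mul_nonneg (by exact_mod_cast hj) hh.le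
    have : N * (j * h) ≤ K / 2 := (mul_le_mul_of_nonneg_left hjρ hN0).trans hKN
    nlinarith
  let w : ℤ → ℝ → ℝ := fun j t =>
    z j t - (A + (K * (j * h) - N * (j * h) ^ 2) + L * (t₀ - t) + μ)
  have hbar : ∀ (j : ℤ) (t : ℝ) (s : Set ℝ), HasDerivWithinAt
      (fun t => A + (K * (j * h) - N * (j * h) ^ 2) + L * (t₀ - t) + μ) (-L) s t := by
    intro j t s
    have := ((((hasDerivWithinAt_id t s).const_sub t₀).const_mul L).const_add
        (A + (K * (j * h) - N * (j * h) ^ 2))).add_const μ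
    rwa [mul_neg_one] at this
  have hS : {j : ℤ | 0 ≤ j ∧ (j : ℝ) * h ≤ ρ}.Finite := by
    refine (finite_int_near_real 0 hh (ρ := ρ)).subset fun j hj => ?_
    have hj' : (0 : ℝ) ≤ j * h := mul_nonneg (by exact_mod_cast hj.1) hh.le
    change |(j : ℝ) * h - 0| ≤ ρ
    rw [sub_zero, abs_of_nonneg hj']
    exact hj.2
  have hA : -Z ≤ A := by
    have h1 := Hl t₀ ⟨ht₀, le_rfl⟩
    have h2 := (Hz 0 le_rfl (by simpa using hρ.le)).2 t₀ ⟨ht₀, le_rfl⟩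
    linarith [(abs_le.1 h2).1]
  have := finite_max_principle hS w (a := 0) (b := t₀)
    (fun j hj => (Hz j hj.1 hj.2).1.sub fun t ht => (hbar j t _).continuousWithinAt) ?_ ?_
    t₀ ⟨ht₀, le_rfl⟩ j ⟨hj, hjρ⟩
  · simp only [w] at this
    have h1 : 0 ≤ N * (j * h) ^ 2 := by positivity
    linarith
  · rintro j ⟨hj, hjρ⟩
    have h1 := Hi j hj hjρ
    have h2 := hpar j hj hjρ
    have hj' : (0 : ℝ) ≤ j * h := mul_nonneg (by exact_mod_cast hj) hh.le
    have h3 := mul_le_mul_of_nonneg_right hKL hj'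
    simp only [w]
    linarith
  · rintro t ht j ⟨hj, hjρ⟩ hle hw0
    have htI : t ∈ Icc 0 t₀ := ⟨ht.1.le, ht.2⟩
    have hj' : (0 : ℝ) ≤ j * h := mul_nonneg (by exact_mod_cast hj) hh.le
    have hLt : 0 ≤ L * (t₀ - t) := mul_nonneg hL (by linarith [ht.2])
    rcases hj.eq_or_lt with rfl | hjpos
    · exfalso
      have h1 := Hl t htI
      simp only [w] at hw0
      simp only [Int.cast_zero, zero_mul] at hw0
      nlinarith
    by_cases hb : ρ / 2 ≤ j * h
    · exfalso
      have h2 := hpar j hj hjρ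
      have h3 : K / 2 * (ρ / 2) ≤ K / 2 * (j * h) := by gcongr
      have h4 := (abs_le.1 ((Hz j hj hjρ).2 t htI)).2
      simp only [w] at hw0
      linarith
    · push Not at hb
      obtain ⟨hla, hd⟩ := Hode j hjpos (by linarith) t htI
      refine ⟨_, ?_, hd.sub (hbar j t _)⟩
      have l1 := hle (j + 1) ⟨by omega, by push_cast; linarith⟩
      have l2 := hle (j - 1) ⟨by omega, by push_cast; linarith⟩
      simp only [w] at l1 l2 hw0
      push_cast at l1 l2
      have h3 : (z (j + 1) t + z (j - 1) t - 2 * z j t) / h ^ 2 ≤ -(2 * N) := by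
        rw [div_le_iff₀ (by positivity)]
        linarith
      have h4 := mul_le_mul_of_nonneg_left h3 (hl.le.trans hla)
      have h5 : l * (2 * N) ≤ a j t * (2 * N) := by gcongr
      have h6 : l * (2 * N) = L + 1 := by rw [hN]; field_simp
      linarith

lemma abs_clamp_sub_le (a b x y : ℝ) : |max a (min b x) - max a (min b y)| ≤ |x - y| := by
  refine (abs_max_sub_max_le_max _ _ _ _).trans ?_
  simp only [sub_self, abs_zero]
  refine max_le (abs_nonneg _) ((abs_min_sub_min_le_max _ _ _ _).trans ?_)
  simp

/-- The semi-discrete vector field with all values clamped to `[a, b]`. -/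
def clampField (h a b : ℝ) (u : ℤ → ℝ) (i : ℤ) : ℝ :=
  1 / 2 * max a (min b (u i)) * ((max a (min b (u (i + 1))) + max a (min b (u (i - 1)))
    - 2 * max a (min b (u i))) / h ^ 2)

lemma abs_clampField_le {h a b : ℝ} (hh : 0 < h) (ha : 0 ≤ a) (hab : a ≤ b) (u : ℤ → ℝ) (i : ℤ) :
    |clampField h a b u i| ≤ 2 * b ^ 2 / h ^ 2 := by
  have hc : ∀ x, 0 ≤ max a (min b x) ∧ max a (min b x) ≤ b := fun x =>
    ⟨ha.trans (le_max_left _ _), max_le hab (min_le_left _ _)⟩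
  obtain ⟨h1, h2⟩ := hc (u i)
  obtain ⟨h3, h4⟩ := hc (u (i + 1))
  obtain ⟨h5, h6⟩ := hc (u (i - 1))
  unfold clampField
  generalize max a (min b (u i)) = p at *
  generalize max a (min b (u (i + 1))) = q at *
  generalize max a (min b (u (i - 1))) = r at *
  rw [← mul_div_assoc, abs_div, abs_of_pos (by positivity : 0 < h ^ 2)]
  refine div_le_div_of_nonneg_right ?_ (by positivity)
  rw [abs_mul, abs_of_nonneg (by positivity : 0 ≤ 1 / 2 * p)]
  have h7 : |q + r - 2 * p| ≤ 2 * b := abs_le.2 ⟨by linarith, by linarith⟩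
  have hb : 0 ≤ b := ha.trans hab
  calc 1 / 2 * p * |q + r - 2 * p| ≤ 1 / 2 * b * (2 * b) := by gcongr
    _ ≤ 2 * b ^ 2 := by nlinarith [sq_nonneg b]

lemma abs_clampField_sub_le {h a b d : ℝ} (hh : 0 < h) (ha : 0 ≤ a) (hab : a ≤ b) {u v : ℤ → ℝ}
    (hd : ∀ i, |u i - v i| ≤ d) (i : ℤ) :
    |clampField h a b u i - clampField h a b v i| ≤ 4 * b / h ^ 2 * d := by
  have hc : ∀ x, 0 ≤ max a (min b x) ∧ max a (min b x) ≤ b := fun x =>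
    ⟨ha.trans (le_max_left _ _), max_le hab (min_le_left _ _)⟩
  obtain ⟨h1, h2⟩ := hc (u i)
  obtain ⟨h3, h4⟩ := hc (u (i + 1))
  obtain ⟨h5, h6⟩ := hc (u (i - 1))
  obtain ⟨g1, g2⟩ := hc (v i)
  have e1 := (abs_clamp_sub_le a b (u i) (v i)).trans (hd i)
  have e2 := (abs_clamp_sub_le a b (u (i + 1)) (v (i + 1))).trans (hd _)
  have e3 := (abs_clamp_sub_le a b (u (i - 1)) (v (i - 1))).trans (hd _)
  unfold clampField
  generalize max a (min b (u i)) = p at *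
  generalize max a (min b (u (i + 1))) = q at *
  generalize max a (min b (u (i - 1))) = r at *
  generalize max a (min b (v i)) = p' at *
  generalize max a (min b (v (i + 1))) = q' at *
  generalize max a (min b (v (i - 1))) = r' at *
  have h7 : |q + r - 2 * p| ≤ 2 * b := abs_le.2 ⟨by linarith, by linarith⟩
  have h8 : |(q + r - 2 * p) - (q' + r' - 2 * p')| ≤ 4 * d := by
    rw [abs_le] at *
    constructor <;> linarith
  have hd0 : 0 ≤ d := (abs_nonneg _).trans e1
  have e : 1 / 2 * p * ((q + r - 2 * p) / h ^ 2) - 1 / 2 * p' * ((q' + r' - 2 * p') / h ^ 2)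
      = (1 / 2 * (p - p') * (q + r - 2 * p)
        + 1 / 2 * p' * ((q + r - 2 * p) - (q' + r' - 2 * p'))) / h ^ 2 := by
    field_simp
    ring
  rw [e, abs_div, abs_of_pos (by positivity : 0 < h ^ 2), div_mul_eq_mul_div (4 * b)]
  refine div_le_div_of_nonneg_right ?_ (by positivity)
  refine (abs_add_le _ _).trans ?_
  have e0 : |(1 / 2 : ℝ)| = 1 / 2 := abs_of_pos (by norm_num)
  simp only [abs_mul, abs_of_nonneg g1, e0]
  have hb : 0 ≤ b := ha.trans hab
  calc 1 / 2 * |p - p'| * |q + r - 2 * p| + 1 / 2 * p' * |(q + r - 2 * p) - (q' + r' - 2 * p')|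
      ≤ 1 / 2 * d * (2 * b) + 1 / 2 * b * (4 * d) := by gcongr
    _ ≤ 4 * b * d := by nlinarith [mul_nonneg hb hd0]

lemma exists_clamped_grid_solution {T h a b : ℝ} (hT : 0 < T) (hh : 0 < h) (ha : 0 < a)
    (hab : a ≤ b) (S : Finset ℤ) {g : ℤ → ℝ → ℝ} (hg : ∀ i, ContinuousOn (g i) (Icc 0 T)) :
    ∃ u : ℤ → ℝ → ℝ, (∀ i ∈ S, ∀ t ∈ Icc 0 T,
        HasDerivWithinAt (u i) (clampField h a b (fun j => u j t) i) (Icc 0 T) t) ∧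
      (∀ i ∉ S, ∀ t, u i t = g i t) ∧ ∀ i, u i 0 = g i 0 := by
  classical
  let ex : ℝ → (S → ℝ) → ℤ → ℝ := fun t v i => if hi : i ∈ S then v ⟨i, hi⟩ else g i t
  let f : ℝ → (S → ℝ) → (S → ℝ) := fun t v i => clampField h a b (ex t v) i
  have hb : 0 < b := ha.trans_le hab
  let L : NNReal := ⟨2 * b ^ 2 / h ^ 2, by positivity⟩
  let K : NNReal := ⟨4 * b / h ^ 2, by positivity⟩
  let A : NNReal := L * ⟨T, hT.le⟩
  have hPL : IsPicardLindelof f (tmin := 0) (tmax := T) ⟨0, ⟨le_rfl, hT.le⟩⟩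
      (fun i : S => g i 0) A 0 L K := by
    refine ⟨fun t ht => LipschitzOnWith.of_dist_le_mul fun v _ w _ => ?_, fun v _ => ?_,
      fun t ht v _ => ?_, ?_⟩
    · refine (dist_pi_le_iff (by positivity)).2 fun i => ?_
      refine abs_clampField_sub_le hh ha.le hab (fun j => ?_) i
      by_cases hj : j ∈ S
      · simpa [ex, hj, Real.dist_eq] using dist_le_pi_dist v w ⟨j, hj⟩
      · simp [ex, hj]
    · refine continuousOn_pi.2 fun i => ?_
      have he : ∀ j, ContinuousOn (fun t => max a (min b (ex t v j))) (Icc 0 T) := by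
        intro j
        by_cases hj : j ∈ S
        · simpa [ex, hj] using continuousOn_const
        · simp only [ex, hj, dite_false]
          exact continuousOn_const.sup (continuousOn_const.inf (hg j))
      exact (continuousOn_const.mul (he i)).mul
        ((((he (i + 1)).add (he (i - 1))).sub (continuousOn_const.mul (he i))).div_const _)
    · exact (pi_norm_le_iff_of_nonneg (by positivity)).2 fun i =>
        abs_clampField_le hh ha.le hab _ i
    · simp only [sub_zero, A, sub_self, NNReal.coe_zero, max_eq_left hT.le]
      exact le_rfl
  obtain ⟨α, hα0, hα⟩ := hPL.exists_eq_forall_mem_Icc_hasDerivWithinAt₀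
  refine ⟨fun i t => ex t (α t) i, fun i hi t ht => ?_, fun i hi t => by simp [ex, hi],
    fun i => ?_⟩
  · have h1 := hasDerivWithinAt_pi.1 (hα t ht) ⟨i, hi⟩
    simpa [ex, hi, f] using h1
  · by_cases hi : i ∈ S
    · simp [ex, hi, hα0]
    · simp [ex, hi]

/-- Existence for the semi-discrete Dirichlet problem, with the maximum principle. -/
lemma exists_grid_solution {T h a b : ℝ} (hT : 0 < T) (hh : 0 < h) (ha : 0 < a)
    (hab : a ≤ b) (N : ℤ) {g : ℤ → ℝ → ℝ} (hg : ∀ i, ContinuousOn (g i) (Icc 0 T))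
    (hgb : ∀ i, ∀ t ∈ Icc 0 T, a ≤ g i t ∧ g i t ≤ b) :
    ∃ u : ℤ → ℝ → ℝ, (∀ i, |i| < N → SolvesAt T h u i) ∧
      (∀ i, N ≤ |i| → ∀ t, u i t = g i t) ∧ (∀ i, u i 0 = g i 0) ∧
      ∀ i, ∀ t ∈ Icc 0 T, a ≤ u i t ∧ u i t ≤ b := by
  obtain ⟨u, hu1, hu2, hu3⟩ := exists_clamped_grid_solution hT hh ha hab (Finset.Ioo (-N) N) hg
  have hmem : ∀ i, i ∈ Finset.Ioo (-N) N ↔ |i| < N := fun i => by rw [Finset.mem_Ioo, abs_lt]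
  have h0T : (0 : ℝ) ∈ Icc 0 T := ⟨le_rfl, hT.le⟩
  have hc : ∀ x, a ≤ max a (min b x) ∧ max a (min b x) ≤ b := fun x =>
    ⟨le_max_left _ _, max_le hab (min_le_left _ _)⟩
  have hb1 : ∀ κ > 0, ∀ t ∈ Icc 0 T, ∀ i ∈ Finset.Ioo (-N) N, u i t - (b + κ * (1 + t)) < 0 := by
    intro κ hκ
    have hder : ∀ i ∈ Finset.Ioo (-N) N, ∀ t ∈ Icc 0 T,
        HasDerivWithinAt (fun t => u i t - (b + κ * (1 + t)))
          (clampField h a b (fun j => u j t) i - κ) (Icc 0 T) t := by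
      intro i hi t ht
      refine ((hu1 i hi t ht).sub
        ((((hasDerivWithinAt_id t _).const_add 1).const_mul κ).const_add b)).congr_deriv ?_
      simp
    refine finite_max_principle (Finset.finite_toSet _) (fun i t => u i t - (b + κ * (1 + t)))
      (fun i hi t ht => (hder i hi t ht).continuousWithinAt) (fun i hi => ?_)
      fun t ht i hi _ hw => ⟨_, ?_, hder i hi t ⟨ht.1.le, ht.2⟩⟩
    · have := (hgb i 0 h0T).2
      rw [hu3]
      linarith
    · have h1 : b ≤ u i t := by nlinarith [mul_pos hκ (by linarith [ht.1] : 0 < 1 + t)]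
      have h2 : max a (min b (u i t)) = b := by rw [min_eq_left h1, max_eq_right hab]
      have h3 : clampField h a b (fun j => u j t) i ≤ 0 := by
        unfold clampField
        rw [h2]
        refine mul_nonpos_of_nonneg_of_nonpos (by linarith) ?_
        refine div_nonpos_of_nonpos_of_nonneg ?_ (by positivity)
        linarith [(hc (u (i + 1) t)).2, (hc (u (i - 1) t)).2]
      linarith
  have hb2 : ∀ κ > 0, ∀ t ∈ Icc 0 T, ∀ i ∈ Finset.Ioo (-N) N, (a - κ * (1 + t)) - u i t < 0 := by
    intro κ hκ
    have hder : ∀ i ∈ Finset.Ioo (-N) N, ∀ t ∈ Icc 0 T,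
        HasDerivWithinAt (fun t => (a - κ * (1 + t)) - u i t)
          (-κ - clampField h a b (fun j => u j t) i) (Icc 0 T) t := by
      intro i hi t ht
      refine (((((hasDerivWithinAt_id t _).const_add 1).const_mul κ).const_sub a).sub
        (hu1 i hi t ht)).congr_deriv ?_
      simp
    refine finite_max_principle (Finset.finite_toSet _) (fun i t => (a - κ * (1 + t)) - u i t)
      (fun i hi t ht => (hder i hi t ht).continuousWithinAt) (fun i hi => ?_)
      fun t ht i hi _ hw => ⟨_, ?_, hder i hi t ⟨ht.1.le, ht.2⟩⟩
    · have := (hgb i 0 h0T).1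
      rw [hu3]
      linarith
    · have h1 : u i t ≤ a := by nlinarith [mul_pos hκ (by linarith [ht.1] : 0 < 1 + t)]
      have h2 : max a (min b (u i t)) = a := by
        rw [max_eq_left ((min_le_right _ _).trans h1)]
      have h3 : 0 ≤ clampField h a b (fun j => u j t) i := by
        unfold clampField
        rw [h2]
        refine mul_nonneg (by linarith) (div_nonneg ?_ (by positivity))
        linarith [(hc (u (i + 1) t)).1, (hc (u (i - 1) t)).1]
      linarith
  have hbd : ∀ i, ∀ t ∈ Icc 0 T, a ≤ u i t ∧ u i t ≤ b := by
    intro i t ht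
    by_cases hi : i ∈ Finset.Ioo (-N) N
    · have ht1 : 0 < 1 + t := by linarith [ht.1]
      constructor
      · refine le_of_forall_pos_le_add fun μ hμ => ?_
        have := hb2 (μ / (1 + t)) (by positivity) t ht i hi
        rw [div_mul_cancel₀ _ ht1.ne'] at this
        linarith
      · refine le_of_forall_pos_le_add fun μ hμ => ?_
        have := hb1 (μ / (1 + t)) (by positivity) t ht i hi
        rw [div_mul_cancel₀ _ ht1.ne'] at this
        linarith
    · rw [hu2 i hi]
      exact hgb i t ht
  refine ⟨u, fun i hi t ht => ?_, fun i hi t => hu2 i (by rwa [hmem, not_lt]) t, hu3, hbd⟩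
  have hcl : ∀ j, max a (min b (u j t)) = u j t := fun j => by
    rw [min_eq_right (hbd j t ht).2, max_eq_right (hbd j t ht).1]
  have := hu1 i ((hmem i).2 hi) t ht
  simpa only [clampField, hcl] using this

/-- Solutions whose parabolic boundary data differ by a positive constant are ordered. -/
lemma grid_comparison {T h a b η : ℝ} (hh : 0 < h) (ha : 0 < a) (hη : 0 < η)
    {N : ℤ} {v w : ℤ → ℝ → ℝ} (hv : ∀ i, |i| < N → SolvesAt T h v i)
    (hw : ∀ i, |i| < N → SolvesAt T h w i)
    (hbd : ∀ i, N ≤ |i| → ∀ t ∈ Icc 0 T, w i t = v i t + η) (h0 : ∀ i, w i 0 = v i 0 + η)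
    (hvb : ∀ i, ∀ t ∈ Icc 0 T, a ≤ v i t ∧ v i t ≤ b)
    (hwb : ∀ i, ∀ t ∈ Icc 0 T, a ≤ w i t ∧ w i t ≤ b) :
    ∀ i, ∀ t ∈ Icc 0 T, v i t ≤ w i t := by
  intro i t ht
  by_cases hi : |i| < N
  swap
  · rw [hbd i (not_lt.1 hi) t ht]
    linarith
  set L : ℝ := 2 * b / h ^ 2 + 1 with hL
  have hder : ∀ i, |i| < N → ∀ t ∈ Icc 0 T,
      HasDerivWithinAt (fun t => v i t - w i t + η / 2 * Real.exp (-L * t))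
        (1 / 2 * v i t * ((v (i + 1) t + v (i - 1) t - 2 * v i t) / h ^ 2)
          - 1 / 2 * w i t * ((w (i + 1) t + w (i - 1) t - 2 * w i t) / h ^ 2)
          - η / 2 * Real.exp (-L * t) * L) (Icc 0 T) t := by
    intro i hi t ht
    refine (((hv i hi t ht).sub (hw i hi t ht)).add
      (((((hasDerivWithinAt_id t _).const_mul (-L))).exp).const_mul (η / 2))).congr_deriv ?_
    simp
    ring
  have key := finite_max_principle (S := {i : ℤ | |i| < N})
    ((Set.finite_Ioo (-N) N).subset fun i hi => abs_lt.1 hi)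
    (fun i t => v i t - w i t + η / 2 * Real.exp (-L * t)) (a := 0) (b := T)
    (fun i hi t ht => (hder i hi t ht).continuousWithinAt) (fun i hi => ?_)
    (fun t ht i hi hneg hz => ⟨_, ?_, hder i hi t ⟨ht.1.le, ht.2⟩⟩) t ht i hi
  · have := Real.exp_pos (-L * t)
    have : 0 < η / 2 * Real.exp (-L * t) := by positivity
    linarith
  · simp only [mul_zero, Real.exp_zero, h0 i]
    linarith
  · have ht' : t ∈ Icc 0 T := ⟨ht.1.le, ht.2⟩
    have hE : Real.exp (-L * t) ≤ 1 := by
      rw [Real.exp_le_one_iff]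
      have : 0 ≤ L := by
        have : 0 < b := ha.trans_le ((hvb 0 t ht').1.trans (hvb 0 t ht').2)
        positivity
      nlinarith [ht.1]
    have hE0 := Real.exp_pos (-L * t)
    generalize Real.exp (-L * t) = e at *
    have hnb : ∀ j, v j t - w j t + η / 2 * e ≤ 0 := by
      intro j
      by_cases hj : |j| < N
      · exact hneg j hj
      · rw [hbd j (not_lt.1 hj) t ht']
        nlinarith
    have n1 := hnb (i + 1)
    have n2 := hnb (i - 1)
    have b1 := hvb i t ht'
    have b2 := hwb i t ht'
    have b3 := hwb (i + 1) t ht'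
    have b4 := hwb (i - 1) t ht'
    generalize v i t = p at *
    generalize v (i + 1) t = p1 at *
    generalize v (i - 1) t = p2 at *
    generalize w i t = q at *
    generalize w (i + 1) t = q1 at *
    generalize w (i - 1) t = q2 at *
    have hh2 : 0 < h ^ 2 := by positivity
    have e1 : 1 / 2 * p * ((p1 + p2 - 2 * p) / h ^ 2) - 1 / 2 * q * ((q1 + q2 - 2 * q) / h ^ 2)
        - η / 2 * e * L = (1 / 2 * p * (p1 + p2 - 2 * p) - 1 / 2 * q * (q1 + q2 - 2 * q)
          - η / 2 * e * (2 * b)) / h ^ 2 - η / 2 * e := by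
      rw [hL]
      field_simp
      ring
    rw [e1]
    have hp : p = q - η / 2 * e := by linarith
    have hδ : 0 < η / 2 * e := by positivity
    generalize η / 2 * e = δ at *
    have : 1 / 2 * p * (p1 + p2 - 2 * p) - 1 / 2 * q * (q1 + q2 - 2 * q) - δ * (2 * b) ≤ 0 := by
      have k1 : p * (p1 + p2 - 2 * p) ≤ p * (q1 + q2 - 2 * q) := by
        apply mul_le_mul_of_nonneg_left _ (by linarith)
        linarith
      have k2 : δ * (2 * q - q1 - q2) ≤ δ * (2 * b) := by
        apply mul_le_mul_of_nonneg_left _ hδ.le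
        linarith
      have k3 : p * (q1 + q2 - 2 * q) - q * (q1 + q2 - 2 * q) = δ * (2 * q - q1 - q2) := by
        rw [hp]
        ring
      have : 0 < δ * b := mul_pos hδ (by linarith)
      linarith
    have := div_nonpos_of_nonpos_of_nonneg this hh2.le
    linarith

lemma SolvesAt.continuousOn {T h : ℝ} {u : ℤ → ℝ → ℝ} {i : ℤ} (H : SolvesAt T h u i) :
    ContinuousOn (u i) (Icc 0 T) := fun t ht => (H t ht).continuousWithinAt

lemma SolvesAt.integral_eq {T h : ℝ} (hh : 0 < h) {u : ℤ → ℝ → ℝ} {i : ℤ} (H : SolvesAt T h u i)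
    (hc : ∀ i, ContinuousOn (u i) (Icc 0 T)) (hpos : ∀ t ∈ Icc 0 T, 0 < u i t) {t : ℝ}
    (ht : t ∈ Icc 0 T) :
    ∫ s in (0 : ℝ)..t, (u (i + 1) s + u (i - 1) s - 2 * u i s)
      = 2 * h ^ 2 * Real.log (u i t) - 2 * h ^ 2 * Real.log (u i 0) := by
  have hsub : Icc 0 t ⊆ Icc 0 T := Icc_subset_Icc_right ht.2
  refine intervalIntegral.integral_eq_sub_of_hasDerivAt_of_le
    (f := fun s => 2 * h ^ 2 * Real.log (u i s)) ht.1 ?_ (fun s hs => ?_) ?_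
  · exact continuousOn_const.mul (((hc i).mono hsub).log fun s hs => (hpos s (hsub hs)).ne')
  · have hs' : s ∈ Icc 0 T := ⟨hs.1.le, hs.2.le.trans ht.2⟩
    have h1 : HasDerivAt (u i) _ s :=
      (H s hs').hasDerivAt (Icc_mem_nhds hs.1 (hs.2.trans_le ht.2))
    refine ((h1.log (hpos s hs').ne').const_mul (2 * h ^ 2)).congr_deriv ?_
    have := (hpos s hs').ne'
    field_simp
  · refine ContinuousOn.intervalIntegrable ?_
    rw [uIcc_of_le ht.1]
    exact ((((hc _).add (hc _)).sub (continuousOn_const.mul (hc _)))).mono hsub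

lemma int_convex_le {N : ℤ} {f : ℤ → ℝ} {B : ℝ}
    (hf : ∀ i, |i| < N → 0 < f (i + 1) + f (i - 1) - 2 * f i)
    (hB : ∀ i, |i| = N → f i ≤ B) : ∀ i, |i| ≤ N → f i ≤ B := by
  intro i hi
  have hne : (Finset.Icc (-N) N).Nonempty := ⟨i, Finset.mem_Icc.2 (abs_le.1 hi)⟩
  obtain ⟨m, hm, hmax⟩ := Finset.exists_max_image _ f hne
  have hm' : |m| ≤ N := abs_le.2 (Finset.mem_Icc.1 hm)
  refine (hmax i (Finset.mem_Icc.2 (abs_le.1 hi))).trans ?_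
  rcases hm'.lt_or_eq with hlt | heq
  · rw [abs_lt] at hlt
    have h1 := hmax (m + 1) (Finset.mem_Icc.2 ⟨by omega, by omega⟩)
    have h2 := hmax (m - 1) (Finset.mem_Icc.2 ⟨by omega, by omega⟩)
    have h3 := hf m (abs_lt.2 hlt)
    linarith
  · exact hB m heq

/-- The time integral of the difference of two solutions is controlled by the difference of their
parabolic boundary data. -/
lemma grid_integral_estimate {T h a b η : ℝ} (hh : 0 < h) (ha : 0 < a) (hη : 0 < η)
    {N : ℤ} {v w : ℤ → ℝ → ℝ} (hv : ∀ i, |i| < N → SolvesAt T h v i)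
    (hw : ∀ i, |i| < N → SolvesAt T h w i)
    (hvc : ∀ i, ContinuousOn (v i) (Icc 0 T)) (hwc : ∀ i, ContinuousOn (w i) (Icc 0 T))
    (hbd : ∀ i, N ≤ |i| → ∀ t ∈ Icc 0 T, w i t = v i t + η) (h0 : ∀ i, w i 0 = v i 0 + η)
    (hvb : ∀ i, ∀ t ∈ Icc 0 T, a ≤ v i t ∧ v i t ≤ b)
    (hwb : ∀ i, ∀ t ∈ Icc 0 T, a ≤ w i t ∧ w i t ≤ b) :
    ∀ i, |i| ≤ N → ∀ t ∈ Icc 0 T,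
      ∫ s in (0 : ℝ)..t, (w i s - v i s) ≤ η * T + 2 * η / a * (N * h) ^ 2 := by
  intro i hi t ht
  have hcmp := grid_comparison hh ha hη hv hw hbd h0 hvb hwb
  have hsub : Icc 0 t ⊆ Icc 0 T := Icc_subset_Icc_right ht.2
  have hint : ∀ {f : ℝ → ℝ}, ContinuousOn f (Icc 0 T) →
      IntervalIntegrable f MeasureTheory.volume 0 t := by
    intro f hf
    refine ContinuousOn.intervalIntegrable ?_
    rw [uIcc_of_le ht.1]
    exact hf.mono hsub
  have hd : ∀ j, IntervalIntegrable (fun s => w j s - v j s) MeasureTheory.volume 0 t :=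
    fun j => hint ((hwc j).sub (hvc j))
  have key := int_convex_le (N := N) (B := η * T + 2 * η / a * (N * h) ^ 2)
    (f := fun i => (∫ s in (0 : ℝ)..t, (w i s - v i s)) + 2 * η / a * (i * h) ^ 2)
    (fun i hi => ?_) (fun i hi => ?_) i hi
  · have : 0 ≤ 2 * η / a * (i * h) ^ 2 := by positivity
    linarith
  · have ev := (hv i hi).integral_eq hh hvc (fun s hs => ha.trans_le (hvb i s hs).1) ht
    have ew := (hw i hi).integral_eq hh hwc (fun s hs => ha.trans_le (hwb i s hs).1) ht
    have hD2 : ∀ {u : ℤ → ℝ → ℝ}, (∀ i, ContinuousOn (u i) (Icc 0 T)) → IntervalIntegrable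
        (fun s => u (i + 1) s + u (i - 1) s - 2 * u i s) MeasureTheory.volume 0 t :=
      fun hu => hint (((hu _).add (hu _)).sub (continuousOn_const.mul (hu _)))
    have e1 : (∫ s in (0 : ℝ)..t, (w (i + 1) s - v (i + 1) s))
        + (∫ s in (0 : ℝ)..t, (w (i - 1) s - v (i - 1) s))
        - 2 * (∫ s in (0 : ℝ)..t, (w i s - v i s))
        = (∫ s in (0 : ℝ)..t, (w (i + 1) s + w (i - 1) s - 2 * w i s))
          - ∫ s in (0 : ℝ)..t, (v (i + 1) s + v (i - 1) s - 2 * v i s) := by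
      rw [← intervalIntegral.integral_add (hd _) (hd _), ← intervalIntegral.integral_const_mul,
        ← intervalIntegral.integral_sub ((hd _).add (hd _)) ((hd _).const_mul _),
        ← intervalIntegral.integral_sub (hD2 hwc) (hD2 hvc)]
      congr 1
      ext s
      ring
    have h0T : (0 : ℝ) ∈ Icc 0 T := ⟨le_rfl, ht.1.trans ht.2⟩
    have l1 : Real.log (v i t) ≤ Real.log (w i t) :=
      Real.log_le_log (ha.trans_le (hvb i t ht).1) (hcmp i t ht)
    have l2 : Real.log (w i 0) - Real.log (v i 0) ≤ η / a := by
      have hv0 := (hvb i 0 h0T).1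
      have hv0' := ha.trans_le hv0
      rw [← Real.log_div (ha.trans_le (hwb i 0 h0T).1).ne' hv0'.ne']
      refine (Real.log_le_sub_one_of_pos
        (div_pos (ha.trans_le (hwb i 0 h0T).1) hv0')).trans ?_
      rw [h0 i, add_div, div_self hv0'.ne', add_sub_cancel_left]
      gcongr
    have hh2 : 0 < h ^ 2 := by positivity
    have e2 : 2 * η / a * (((i + 1 : ℤ) : ℝ) * h) ^ 2 + 2 * η / a * (((i - 1 : ℤ) : ℝ) * h) ^ 2
        - 2 * (2 * η / a * ((i : ℝ) * h) ^ 2) = 4 * (η / a) * h ^ 2 := by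
      push_cast
      ring
    have hpos : 0 < η / a := by positivity
    have k1 := mul_le_mul_of_nonneg_left l1 hh2.le
    have k2 := mul_le_mul_of_nonneg_left l2 hh2.le
    have k3 := mul_pos hpos hh2
    linarith
  · have e1 : ∫ s in (0 : ℝ)..t, (w i s - v i s) = η * t := by
      have : ∫ s in (0 : ℝ)..t, (w i s - v i s) = ∫ s in (0 : ℝ)..t, η := by
        refine intervalIntegral.integral_congr fun s hs => ?_
        rw [uIcc_of_le ht.1] at hs
        simp only [hbd i hi.ge s (hsub hs)]
        ring
      rw [this]
      simp [mul_comm]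
    have e2 : ((i : ℝ) * h) ^ 2 = (N * h) ^ 2 := by
      rw [mul_pow, mul_pow, ← sq_abs (i : ℝ)]
      congr 2
      exact_mod_cast hi
    rw [e1, e2]
    have := ht.2
    gcongr

/-- Summation of increments that are all close to `c`. -/
lemma abs_sub_sub_mul_le {f : ℤ → ℝ} {c D : ℝ} {i j : ℤ}
    (H : ∀ l, min i j ≤ l → l < max i j → |f (l + 1) - f l - c| ≤ D) :
    |f j - f i - (j - i) * c| ≤ |(j : ℝ) - i| * D := by
  have main : ∀ i j : ℤ, i ≤ j → (∀ l, i ≤ l → l < j → |f (l + 1) - f l - c| ≤ D) →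
      |f j - f i - (j - i) * c| ≤ (j - i) * D := by
    intro i j hij
    induction j, hij using Int.leInduction with
    | base => intro _; simp
    | succ m hm ih =>
      intro H
      have h1 := ih fun l h1 h2 => H l h1 (by omega)
      have h2 := H m hm (by omega)
      push_cast
      rw [abs_le] at *
      constructor <;> linarith
  rcases le_total i j with hij | hij
  · rw [min_eq_left hij, max_eq_right hij] at H
    rw [abs_of_nonneg (sub_nonneg.2 (Int.cast_le.2 hij) : (0 : ℝ) ≤ j - i)]
    exact main i j hij H
  · rw [min_eq_right hij, max_eq_left hij] at H
    rw [abs_sub_comm (j : ℝ), abs_of_nonneg (sub_nonneg.2 (Int.cast_le.2 hij) : (0 : ℝ) ≤ i - j)]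
    have := main j i hij H
    rw [abs_le] at *
    constructor <;> linarith

lemma grid_between {i j l : ℤ} {h x₀ r : ℝ} (hh : 0 < h) (hi : |(i : ℝ) * h - x₀| ≤ r)
    (hj : |(j : ℝ) * h - x₀| ≤ r) (h1 : min i j ≤ l) (h2 : l ≤ max i j) :
    |(l : ℝ) * h - x₀| ≤ r ∧ |(l : ℝ) - i| ≤ |(j : ℝ) - i| := by
  rw [abs_le] at hi hj
  rcases le_total i j with hij | hij
  · rw [min_eq_left hij] at h1
    rw [max_eq_right hij] at h2
    have a1 : (i : ℝ) ≤ l := by exact_mod_cast h1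
    have a2 : (l : ℝ) ≤ j := by exact_mod_cast h2
    have b1 := mul_le_mul_of_nonneg_right a1 hh.le
    have b2 := mul_le_mul_of_nonneg_right a2 hh.le
    refine ⟨abs_le.2 ⟨by linarith, by linarith⟩, ?_⟩
    rw [abs_of_nonneg (by linarith), abs_of_nonneg (by linarith)]
    linarith
  · rw [min_eq_right hij] at h1
    rw [max_eq_left hij] at h2
    have a1 : (j : ℝ) ≤ l := by exact_mod_cast h1
    have a2 : (l : ℝ) ≤ i := by exact_mod_cast h2
    have b1 := mul_le_mul_of_nonneg_right a1 hh.le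
    have b2 := mul_le_mul_of_nonneg_right a2 hh.le
    refine ⟨abs_le.2 ⟨by linarith, by linarith⟩, ?_⟩
    rw [abs_of_nonpos (by linarith), abs_of_nonpos (by linarith)]
    linarith

/-- Taylor estimates, uniform in the mesh size, for semi-discrete solutions. -/
lemma grid_taylor {ε M R τ : ℝ} (hε : 0 < ε) (hM : 0 ≤ M) (hR : 0 < R) (hτ : 0 < τ) :
    ∃ C h₀ : ℝ, 0 ≤ C ∧ 0 < h₀ ∧ ∀ h : ℝ, 0 < h → h ≤ h₀ → ∀ (u : ℤ → ℝ → ℝ) (x₀ T : ℝ),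
    (∀ i : ℤ, |(i : ℝ) * h - x₀| ≤ R →
      SolvesAt T h u i ∧ ∀ t ∈ Icc 0 T, ε ≤ u i t ∧ u i t ≤ M) →
    ∀ i : ℤ, |(i : ℝ) * h - x₀| ≤ R / 4 → ∀ t ∈ Icc τ T,
      |gridD1 h u i t| ≤ C ∧ |gridD2 h u i t| ≤ C ∧ ∀ j : ℤ, |(j : ℝ) * h - x₀| ≤ R / 4 →
        |u j t - u i t| ≤ C * |j * h - i * h| ∧
        |u j t - u i t - gridD1 h u i t * (j * h - i * h)| ≤ C * (j * h - i * h) ^ 2 ∧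
        |gridD1 h u j t - gridD1 h u i t - gridD2 h u i t * (j * h - i * h)|
          ≤ C * (j * h - i * h) ^ 2 ∧
        |gridD1 h u j t - gridD1 h u i t| ≤ C * |j * h - i * h| ∧
        |gridD2 h u j t - gridD2 h u i t| ≤ C * |j * h - i * h| := by
  obtain ⟨C, h₀, hC, hh₀, H⟩ := discrete_regularity hε hM hR hτ
  refine ⟨C, h₀, hC, hh₀, fun h hh hhh u x₀ T Hu i hi t ht => ?_⟩
  have HC := fun i hi => H h hh hhh u x₀ T Hu i hi t ht
  refine ⟨(HC i hi).1, (HC i hi).2.1, fun j hj => ?_⟩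
  have hb := fun l h1 h2 => grid_between (l := l) hh hi hj h1 h2
  have e0 : |(j : ℝ) * h - i * h| = |(j : ℝ) - i| * h := by
    rw [← sub_mul, abs_mul, abs_of_pos hh]
  have e0' : ((j : ℝ) * h - i * h) ^ 2 = |(j : ℝ) - i| * h * (|(j : ℝ) - i| * h) := by
    rw [← e0, ← sq, sq_abs]
  have d1 : ∀ l, u (l + 1) t - u l t = h * gridD1 h u l t := fun l => by
    rw [gridD1]; field_simp
  have d2 : ∀ l, gridD1 h u (l + 1) t - gridD1 h u l t = h * gridD2 h u (l + 1) t := fun l => by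
    rw [gridD2, add_sub_cancel_right]; field_simp
  have q0 : ∀ j : ℤ, |(j : ℝ) * h - x₀| ≤ R / 4 →
      |gridD2 h u j t - gridD2 h u i t| ≤ C * (|(j : ℝ) - i| * h) := by
    intro j hj
    have := abs_sub_sub_mul_le (f := fun l => gridD2 h u l t) (c := 0) (D := C * h) (i := i)
      (j := j) fun l h1 h2 => by
        simpa using (HC l (grid_between hh hi hj h1 h2.le).1).2.2
    rw [mul_zero, sub_zero] at this
    linarith
  have p0 : ∀ j : ℤ, |(j : ℝ) * h - x₀| ≤ R / 4 →
      |gridD1 h u j t - gridD1 h u i t| ≤ C * (|(j : ℝ) - i| * h) := by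
    intro j hj
    have := abs_sub_sub_mul_le (f := fun l => gridD1 h u l t) (c := 0) (D := C * h) (i := i)
      (j := j) fun l h1 h2 => by
        have k := (HC (l + 1) (grid_between hh hi hj (by omega) (by omega)).1).2.1
        rw [d2, sub_zero, abs_mul, abs_of_pos hh, mul_comm]
        gcongr
    rw [mul_zero, sub_zero] at this
    linarith
  refine ⟨?_, ?_, ?_, by rw [e0]; exact p0 j hj, by rw [e0]; exact q0 j hj⟩
  · have := abs_sub_sub_mul_le (f := fun l => u l t) (c := 0) (D := C * h) (i := i)
      (j := j) fun l h1 h2 => by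
        have k := (HC l (hb l h1 h2.le).1).1
        rw [d1, sub_zero, abs_mul, abs_of_pos hh, mul_comm]
        gcongr
    rw [mul_zero, sub_zero] at this
    rw [e0]
    linarith
  · have := abs_sub_sub_mul_le (f := fun l => u l t) (c := h * gridD1 h u i t)
      (D := h * (C * (|(j : ℝ) - i| * h))) (i := i) (j := j) fun l h1 h2 => by
        have k := p0 l (hb l h1 h2.le).1
        have k' := (hb l h1 h2.le).2
        rw [d1, ← mul_sub, abs_mul, abs_of_pos hh]
        gcongr
        exact k.trans (by gcongr)
    rw [e0']
    calc _ = |u j t - u i t - (j - i) * (h * gridD1 h u i t)| := by congr 1; ring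
      _ ≤ _ := this
      _ = _ := by ring
  · have := abs_sub_sub_mul_le (f := fun l => gridD1 h u l t) (c := h * gridD2 h u i t)
      (D := h * (C * (|(j : ℝ) - i| * h))) (i := i) (j := j) fun l h1 h2 => by
        have k := q0 (l + 1) (hb (l + 1) (by omega) (by omega)).1
        have k' := (hb (l + 1) (by omega) (by omega)).2
        rw [d2, ← mul_sub, abs_mul, abs_of_pos hh]
        gcongr
        exact k.trans (by gcongr)
    rw [e0']
    calc _ = |gridD1 h u j t - gridD1 h u i t - (j - i) * (h * gridD2 h u i t)| := by
          congr 1; ring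
      _ ≤ _ := this
      _ = _ := by ring

lemma SolvesAt.exists_mean_value {T h : ℝ} {u : ℤ → ℝ → ℝ} {i : ℤ} (hh : 0 < h)
    (H : SolvesAt T h u i) {s t : ℝ} (hs : 0 ≤ s) (hst : s < t) (ht : t ≤ T) :
    ∃ ξ ∈ Ioo s t, u i t - u i s = (t - s) * (1 / 2 * u i ξ * gridD2 h u i ξ) := by
  have hsub : Icc s t ⊆ Icc 0 T := Icc_subset_Icc hs ht
  obtain ⟨ξ, hξ, e⟩ := exists_hasDerivAt_eq_slope (u i) _ hst (H.continuousOn.mono hsub)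
    fun ξ hξ => (H ξ (hsub (Ioo_subset_Icc_self hξ))).hasDerivAt
      (Icc_mem_nhds (hs.trans_lt hξ.1) (hξ.2.trans_le ht))
  refine ⟨ξ, hξ, ?_⟩
  rw [eq_div_iff (sub_pos.2 hst).ne'] at e
  rw [← e, gridD2, gridD1, gridD1, sub_add_cancel]
  field_simp
  ring

open Filter Topology

/-- The limit of a real sequence along an ultrafilter. -/
def ulim (𝒰 : Ultrafilter ℕ) (f : ℕ → ℝ) : ℝ := limUnder (𝒰 : Filter ℕ) f

lemma tendsto_ulim {𝒰 : Ultrafilter ℕ} {f : ℕ → ℝ} {C : ℝ} (H : ∀ᶠ k in 𝒰, |f k| ≤ C) :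
    Tendsto f 𝒰 (𝓝 (ulim 𝒰 f)) := by
  have h1 : ((𝒰.map f : Ultrafilter ℝ) : Filter ℝ) ≤ 𝓟 (Icc (-C) C) := by
    rw [le_principal_iff]
    exact H.mono fun k hk => abs_le.1 hk
  obtain ⟨x, -, hx⟩ := isCompact_Icc.ultrafilter_le_nhds _ h1
  exact tendsto_nhds_limUnder ⟨x, hx⟩

/-- The limit of a sequence of grid functions along an ultrafilter. -/
def gridLim (𝒰 : Ultrafilter ℕ) (h : ℕ → ℝ) (f : ℕ → ℤ → ℝ) (x : ℝ) : ℝ :=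
  ulim 𝒰 fun k => f k ⌊x / h k⌋

lemma abs_floor_mul_sub_le {h : ℝ} (hh : 0 < h) (x : ℝ) : |(⌊x / h⌋ : ℝ) * h - x| ≤ h := by
  have h1 := Int.floor_le (x / h)
  have h2 := Int.lt_floor_add_one (x / h)
  rw [le_div_iff₀ hh] at h1
  rw [div_lt_iff₀ hh] at h2
  rw [abs_le]
  constructor <;> linarith

lemma tendsto_floor_mul {F : Filter ℕ} {h : ℕ → ℝ} (hh : ∀ k, 0 < h k) (h0 : Tendsto h F (𝓝 0))
    (x : ℝ) : Tendsto (fun k => (⌊x / h k⌋ : ℝ) * h k) F (𝓝 x) := by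
  rw [tendsto_iff_dist_tendsto_zero]
  exact squeeze_zero (fun _ => dist_nonneg) (fun k => abs_floor_mul_sub_le (hh k) x) h0

lemma eventually_floor_mem {F : Filter ℕ} {h : ℕ → ℝ} (hh : ∀ k, 0 < h k)
    (h0 : Tendsto h F (𝓝 0)) {x x₀ ρ : ℝ} (hx : |x - x₀| < ρ) :
    ∀ᶠ k in F, |(⌊x / h k⌋ : ℝ) * h k - x₀| < ρ :=
  ((tendsto_floor_mul hh h0 x).sub_const x₀).abs.eventually_lt_const hx

lemma hasDerivAt_of_abs_sub_le_sq {F : ℝ → ℝ} {p C x x₀ ρ : ℝ} (hx : |x - x₀| < ρ)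
    (H : ∀ y, |y - x₀| < ρ → |F y - F x - p * (y - x)| ≤ C * (y - x) ^ 2) :
    HasDerivAt F p x := by
  rw [hasDerivAt_iff_isLittleO]
  refine Asymptotics.IsBigO.trans_isLittleO (g := fun y => ‖y - x‖ ^ 2) ?_
    (Asymptotics.isLittleO_pow_sub_sub x (by norm_num))
  refine Asymptotics.IsBigO.of_bound C ?_
  have : ∀ᶠ y in 𝓝 x, |y - x₀| < ρ :=
    ((continuous_id.sub continuous_const).abs.tendsto x).eventually_lt_const hx
  filter_upwards [this] with y hy
  have := H y hy
  simpa [mul_comm] using this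

/-- Uniform closeness, near a point, of a sequence of grid functions to a number. -/
def GridConvAt (F : Filter ℕ) (T : ℝ) (h : ℕ → ℝ) (u : ℕ → ℤ → ℝ → ℝ) (L t₀ x₀ : ℝ) : Prop :=
  ∀ e > 0, ∃ δ > 0, ∀ᶠ k in F, ∀ i : ℤ, |(i : ℝ) * h k - x₀| < δ → ∀ t ∈ Icc 0 T,
    |t - t₀| < δ → |u k i t - L| < e

lemma GridConvAt.tendsto {F : Filter ℕ} {T : ℝ} {h : ℕ → ℝ} {u : ℕ → ℤ → ℝ → ℝ} {L t₀ x₀ : ℝ}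
    (H : GridConvAt F T h u L t₀ x₀) {i : ℕ → ℤ} {θ : ℕ → ℝ}
    (hi : Tendsto (fun k => (i k : ℝ) * h k) F (𝓝 x₀)) (hθ : Tendsto θ F (𝓝 t₀))
    (hθT : ∀ᶠ k in F, θ k ∈ Icc 0 T) : Tendsto (fun k => u k (i k) (θ k)) F (𝓝 L) := by
  rw [Metric.tendsto_nhds] at *
  intro e he
  obtain ⟨δ, hδ, H⟩ := H e he
  filter_upwards [H, hi δ hδ, hθ δ hδ, hθT] with k h1 h2 h3 h4
  exact h1 _ h2 _ h4 h3

lemma gridConvAt_continuousOn {F : Filter ℕ} [F.NeBot] {T : ℝ} {h : ℕ → ℝ} (hh : ∀ k, 0 < h k)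
    (h0 : Tendsto h F (𝓝 0)) {u : ℕ → ℤ → ℝ → ℝ} {V : ℝ → ℝ → ℝ} {K : Set (ℝ × ℝ)}
    (hK : K ⊆ Icc 0 T ×ˢ univ) (H : ∀ p ∈ K, GridConvAt F T h u (V p.1 p.2) p.1 p.2) :
    ContinuousOn (Function.uncurry V) K := by
  intro p hp
  rw [ContinuousWithinAt, Metric.tendsto_nhds]
  intro e he
  obtain ⟨δ, hδ, h1⟩ := H p hp (e / 2) (by positivity)
  filter_upwards [self_mem_nhdsWithin, mem_nhdsWithin_of_mem_nhds (Metric.ball_mem_nhds p hδ)]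
    with q hq hqp
  rw [Metric.mem_ball, Prod.dist_eq, max_lt_iff, Real.dist_eq, Real.dist_eq] at hqp
  have h2 : Tendsto (fun k => u k ⌊q.2 / h k⌋ q.1) F (𝓝 (V q.1 q.2)) :=
    (H q hq).tendsto (tendsto_floor_mul hh h0 _) tendsto_const_nhds
      (Eventually.of_forall fun _ => (hK hq).1)
  have h3 : ∀ᶠ k in F, |u k ⌊q.2 / h k⌋ q.1 - V p.1 p.2| ≤ e / 2 := by
    filter_upwards [h1, eventually_floor_mem hh h0 hqp.2] with k hk1 hk2
    exact (hk1 _ hk2 _ (hK hq).1 hqp.1).le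
  have := le_of_tendsto ((h2.sub_const _).abs) h3
  rw [Real.dist_eq]
  exact this.trans_lt (by linarith)

lemma gridConvAt_uniform {F : Filter ℕ} [F.NeBot] {T : ℝ} {h : ℕ → ℝ} (hh : ∀ k, 0 < h k)
    (h0 : Tendsto h F (𝓝 0)) {u : ℕ → ℤ → ℝ → ℝ} {V : ℝ → ℝ → ℝ} {K : Set (ℝ × ℝ)}
    (hKc : IsCompact K)
    (hK : K ⊆ Icc 0 T ×ˢ univ) (H : ∀ p ∈ K, GridConvAt F T h u (V p.1 p.2) p.1 p.2) {e : ℝ}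
    (he : 0 < e) :
    ∀ᶠ k in F, ∀ i : ℤ, ∀ t, (t, (i : ℝ) * h k) ∈ K → |u k i t - V t (i * h k)| < e := by
  have hV := gridConvAt_continuousOn hh h0 hK H
  have hloc : ∀ p ∈ K, ∃ W ∈ 𝓝[K] p, ∀ᶠ k in F, ∀ i : ℤ, ∀ t, (t, (i : ℝ) * h k) ∈ W ∩ K →
      |u k i t - V t (i * h k)| < e := by
    intro p hp
    obtain ⟨δ, hδ, h1⟩ := H p hp (e / 2) (by positivity)
    have h2 := (Metric.tendsto_nhds.1 (hV p hp)) (e / 2) (by positivity)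
    refine ⟨_, inter_mem h2 (mem_nhdsWithin_of_mem_nhds (Metric.ball_mem_nhds p hδ)), ?_⟩
    filter_upwards [h1] with k hk i t hit
    obtain ⟨⟨a1, a2⟩, a3⟩ := hit
    rw [Metric.mem_ball, Prod.dist_eq, max_lt_iff, Real.dist_eq, Real.dist_eq] at a2
    have b1 := hk i a2.2 t (hK a3).1 a2.1
    have b2 : |V t (i * h k) - V p.1 p.2| < e / 2 := a1
    rw [abs_lt] at *
    constructor <;> linarith
  choose! W hW1 hW2 using hloc
  obtain ⟨s, hs, hcov⟩ := hKc.elim_nhdsWithin_subcover W hW1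
  have : ∀ᶠ k in F, ∀ p ∈ s, ∀ i : ℤ, ∀ t, (t, (i : ℝ) * h k) ∈ W p ∩ K →
      |u k i t - V t (i * h k)| < e :=
    (eventually_all_finset s).2 fun p hp => hW2 p (hs p hp)
  filter_upwards [this] with k hk i t hit
  obtain ⟨p, hp, hpW⟩ := mem_iUnion₂.1 (hcov hit)
  exact hk p hp i t ⟨hpW, hit⟩

/-- Eventual uniform bounds on a box around `x₀`, together with the semi-discrete equation. -/
def GridBdd (F : Filter ℕ) (T ε M R x₀ : ℝ) (h : ℕ → ℝ) (u : ℕ → ℤ → ℝ → ℝ) : Prop :=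
  ∀ᶠ k in F, ∀ i : ℤ, |(i : ℝ) * h k - x₀| ≤ R →
    SolvesAt T (h k) (u k) i ∧ ∀ t ∈ Icc 0 T, ε ≤ u k i t ∧ u k i t ≤ M

lemma gridLim_taylor {𝒰 : Ultrafilter ℕ} {T ε M R x₀ τ : ℝ} {h : ℕ → ℝ} {u : ℕ → ℤ → ℝ → ℝ}
    (hε : 0 < ε) (hM : 0 ≤ M) (hR : 0 < R) (hτ : 0 < τ) (hh : ∀ k, 0 < h k)
    (h0 : Tendsto h 𝒰 (𝓝 0)) (H : GridBdd 𝒰 T ε M R x₀ h u) :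
    ∃ C : ℝ, 0 ≤ C ∧ (∀ᶠ k in 𝒰, ∀ i : ℤ, |(i : ℝ) * h k - x₀| ≤ R / 4 → ∀ t ∈ Icc τ T,
      |gridD2 (h k) (u k) i t| ≤ C ∧ ∀ j : ℤ, |(j : ℝ) * h k - x₀| ≤ R / 4 →
        |u k j t - u k i t| ≤ C * |j * h k - i * h k|) ∧
    ∀ θ : ℕ → ℝ, (∀ᶠ k in 𝒰, θ k ∈ Icc τ T) → ∀ x, |x - x₀| < R / 4 →
      Tendsto (fun k => u k ⌊x / h k⌋ (θ k)) 𝒰 (𝓝 (gridLim 𝒰 h (fun k i => u k i (θ k)) x)) ∧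
      Tendsto (fun k => gridD2 (h k) (u k) ⌊x / h k⌋ (θ k)) 𝒰
        (𝓝 (gridLim 𝒰 h (fun k i => gridD2 (h k) (u k) i (θ k)) x)) ∧
      ∀ y, |y - x₀| < R / 4 →
        |gridLim 𝒰 h (fun k i => u k i (θ k)) y - gridLim 𝒰 h (fun k i => u k i (θ k)) x
          - gridLim 𝒰 h (fun k i => gridD1 (h k) (u k) i (θ k)) x * (y - x)|
          ≤ C * (y - x) ^ 2 ∧
        |gridLim 𝒰 h (fun k i => gridD1 (h k) (u k) i (θ k)) y
          - gridLim 𝒰 h (fun k i => gridD1 (h k) (u k) i (θ k)) x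
          - gridLim 𝒰 h (fun k i => gridD2 (h k) (u k) i (θ k)) x * (y - x)|
          ≤ C * (y - x) ^ 2 ∧
        |gridLim 𝒰 h (fun k i => gridD1 (h k) (u k) i (θ k)) y
          - gridLim 𝒰 h (fun k i => gridD1 (h k) (u k) i (θ k)) x| ≤ C * |y - x| ∧
        |gridLim 𝒰 h (fun k i => gridD2 (h k) (u k) i (θ k)) y
          - gridLim 𝒰 h (fun k i => gridD2 (h k) (u k) i (θ k)) x| ≤ C * |y - x| := by
  obtain ⟨C, h₀, hC, hh₀, HC⟩ := grid_taylor hε hM hR hτ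
  have hev : ∀ᶠ k in 𝒰, h k ≤ h₀ := h0.eventually_le_const hh₀
  have HC' := (H.and hev).mono fun k hk => HC (h k) (hh k) hk.2 (u k) x₀ T hk.1
  refine ⟨C, hC, ?_, fun θ hθ => ?_⟩
  · filter_upwards [HC'] with k hk i hi t ht
    exact ⟨(hk i hi t ht).2.1, fun j hj => ((hk i hi t ht).2.2 j hj).1⟩
  have hbox := fun x (hx : |x - x₀| < R / 4) => eventually_floor_mem hh h0 hx
  have tu : ∀ x, |x - x₀| < R / 4 → Tendsto (fun k => u k ⌊x / h k⌋ (θ k)) 𝒰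
      (𝓝 (gridLim 𝒰 h (fun k i => u k i (θ k)) x)) := by
    intro x hx
    refine tendsto_ulim (C := M) ?_
    filter_upwards [H, hbox x hx, hθ] with k h1 h2 h3
    obtain ⟨a1, a2⟩ := (h1 _ (h2.le.trans (by linarith))).2 (θ k) ⟨hτ.le.trans h3.1, h3.2⟩
    rwa [abs_of_pos (hε.trans_le a1)]
  have tp : ∀ x, |x - x₀| < R / 4 → Tendsto (fun k => gridD1 (h k) (u k) ⌊x / h k⌋ (θ k)) 𝒰
      (𝓝 (gridLim 𝒰 h (fun k i => gridD1 (h k) (u k) i (θ k)) x)) := by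
    intro x hx
    refine tendsto_ulim (C := C) ?_
    filter_upwards [HC', hbox x hx, hθ] with k h1 h2 h3
    exact (h1 _ h2.le _ h3).1
  have tq : ∀ x, |x - x₀| < R / 4 → Tendsto (fun k => gridD2 (h k) (u k) ⌊x / h k⌋ (θ k)) 𝒰
      (𝓝 (gridLim 𝒰 h (fun k i => gridD2 (h k) (u k) i (θ k)) x)) := by
    intro x hx
    refine tendsto_ulim (C := C) ?_
    filter_upwards [HC', hbox x hx, hθ] with k h1 h2 h3
    exact (h1 _ h2.le _ h3).2.1
  intro x hx
  refine ⟨tu x hx, tq x hx, fun y hy => ?_⟩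
  have td : Tendsto (fun k => (⌊y / h k⌋ : ℝ) * h k - ⌊x / h k⌋ * h k) 𝒰 (𝓝 (y - x)) :=
    (tendsto_floor_mul hh h0 y).sub (tendsto_floor_mul hh h0 x)
  have hall := (((HC'.and (hbox x hx)).and (hbox y hy)).and hθ).mono fun k hk =>
    (hk.1.1.1 _ hk.1.1.2.le _ hk.2).2.2 _ hk.1.2.le
  refine ⟨?_, ?_, ?_, ?_⟩
  · exact le_of_tendsto_of_tendsto (((tu y hy).sub (tu x hx)).sub ((tp x hx).mul td)).abs
      ((td.pow 2).const_mul C) (hall.mono fun k hk => hk.2.1)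
  · exact le_of_tendsto_of_tendsto (((tp y hy).sub (tp x hx)).sub ((tq x hx).mul td)).abs
      ((td.pow 2).const_mul C) (hall.mono fun k hk => hk.2.2.1)
  · exact le_of_tendsto_of_tendsto ((tp y hy).sub (tp x hx)).abs
      (td.abs.const_mul C) (hall.mono fun k hk => hk.2.2.2.1)
  · exact le_of_tendsto_of_tendsto ((tq y hy).sub (tq x hx)).abs
      (td.abs.const_mul C) (hall.mono fun k hk => hk.2.2.2.2)

lemma continuousOn_time_of_taylor {J : Set ℝ} {F D : ℝ → ℝ → ℝ} {C x₀ ρ : ℝ} (hC : 0 ≤ C)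
    (H : ∀ t ∈ J, ∀ x, |x - x₀| < ρ → ∀ y, |y - x₀| < ρ →
      |F t y - F t x - D t x * (y - x)| ≤ C * (y - x) ^ 2)
    (hF : ∀ x, |x - x₀| < ρ → ContinuousOn (fun t => F t x) J) {x : ℝ} (hx : |x - x₀| < ρ) :
    ContinuousOn (fun t => D t x) J := by
  intro t ht
  rw [ContinuousWithinAt, Metric.tendsto_nhds]
  intro e he
  obtain ⟨d, hd, hdρ, hde⟩ : ∃ d > 0, |x + d - x₀| < ρ ∧ 2 * C * d < e / 2 := by
    set d := min ((ρ - |x - x₀|) / 2) (e / (4 * (C + 1))) with hd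
    have h1 : 0 < d := lt_min (by linarith) (by positivity)
    refine ⟨d, h1, ?_, ?_⟩
    · have h2 : d ≤ (ρ - |x - x₀|) / 2 := min_le_left _ _
      have h3 : |x + d - x₀| ≤ |x - x₀| + d := by
        have := abs_add_le (x - x₀) d
        rw [abs_of_pos h1] at this
        rwa [add_sub_right_comm]
      linarith
    · have h2 : d ≤ e / (4 * (C + 1)) := min_le_right _ _
      rw [le_div_iff₀ (by positivity)] at h2
      nlinarith
  have c1 := (Metric.tendsto_nhds.1 (hF x hx t ht)) (d * e / 8) (by positivity)
  have c2 := (Metric.tendsto_nhds.1 (hF (x + d) hdρ t ht)) (d * e / 8) (by positivity)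
  filter_upwards [c1, c2, self_mem_nhdsWithin] with s h1 h2 hs
  have a1 := H t ht x hx (x + d) hdρ
  have a2 := H s hs x hx (x + d) hdρ
  rw [Real.dist_eq] at *
  rw [add_sub_cancel_left] at a1 a2
  have key : |D s x - D t x| * d < e * d := by
    rw [← abs_of_pos hd, ← abs_mul, abs_of_pos hd]
    have h3 : 2 * C * d * d < e / 2 * d := mul_lt_mul_of_pos_right hde hd
    have hed : 0 < e * d := by positivity
    rw [abs_le] at a1 a2
    rw [abs_lt] at h1 h2 ⊢
    constructor <;> nlinarith
  exact lt_of_mul_lt_mul_right key hd.le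

lemma hasDerivWithinAt_of_mean_value {F g : ℝ → ℝ} {τ T t : ℝ} (hτ : τ < t) (htT : t ≤ T)
    (hg : ContinuousWithinAt g (Icc τ T) t)
    (H : ∀ s s', τ ≤ s → s < s' → s' ≤ T → ∃ ξ ∈ Icc s s', F s' - F s = (s' - s) * g ξ) :
    HasDerivWithinAt F (g t) (Icc 0 T) t := by
  rw [hasDerivWithinAt_iff_isLittleO, Asymptotics.isLittleO_iff]
  intro e he
  obtain ⟨δ, hδ, hgδ⟩ := Metric.continuousWithinAt_iff.1 hg e he
  have h1 : ∀ᶠ s in 𝓝[Icc 0 T] t, dist s t < δ :=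
    mem_nhdsWithin_of_mem_nhds (Metric.ball_mem_nhds t hδ)
  have h2 : ∀ᶠ s in 𝓝[Icc 0 T] t, τ < s := mem_nhdsWithin_of_mem_nhds (Ioi_mem_nhds hτ)
  filter_upwards [h1, h2, self_mem_nhdsWithin] with s hs hs' hsT
  rw [Real.dist_eq, abs_lt] at hs
  simp only [Real.norm_eq_abs, smul_eq_mul]
  rcases lt_trichotomy s t with hst | rfl | hst
  · obtain ⟨ξ, hξ, e1⟩ := H s t hs'.le hst htT
    have h3 := hgδ ⟨hs'.le.trans hξ.1, hξ.2.trans htT⟩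
      (by rw [Real.dist_eq, abs_lt]; constructor <;> linarith [hξ.1, hξ.2])
    rw [Real.dist_eq] at h3
    have : F s - F t - (s - t) * g t = (s - t) * (g ξ - g t) := by linarith
    rw [this, abs_mul, mul_comm]
    gcongr
  · simp
  · obtain ⟨ξ, hξ, e1⟩ := H t s hτ.le hst hsT.2
    have h3 := hgδ ⟨hτ.le.trans hξ.1, hξ.2.trans hsT.2⟩
      (by rw [Real.dist_eq, abs_lt]; constructor <;> linarith [hξ.1, hξ.2])
    rw [Real.dist_eq] at h3
    have : F s - F t - (s - t) * g t = (s - t) * (g ξ - g t) := by linarith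
    rw [this, abs_mul, mul_comm]
    gcongr

section Limit

variable {𝒰 : Ultrafilter ℕ} {T ε M R x₀ : ℝ} {h : ℕ → ℝ} {u : ℕ → ℤ → ℝ → ℝ}

lemma GridBdd.time_lipschitz (hε : 0 < ε) (hM : 0 ≤ M) (hR : 0 < R) (hh : ∀ k, 0 < h k)
    (h0 : Tendsto h 𝒰 (𝓝 0)) (H : GridBdd 𝒰 T ε M R x₀ h u) {τ : ℝ} (hτ : 0 < τ) :
    ∃ C : ℝ, 0 ≤ C ∧ ∀ᶠ k in 𝒰, ∀ i : ℤ, |(i : ℝ) * h k - x₀| ≤ R / 4 → ∀ t ∈ Icc τ T,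
      ∀ s ∈ Icc τ T, |u k i t - u k i s| ≤ C * |t - s| := by
  obtain ⟨C, hC, HC, -⟩ := gridLim_taylor hε hM hR hτ hh h0 H
  refine ⟨1 / 2 * M * C, by positivity, ?_⟩
  have main : ∀ᶠ k in 𝒰, ∀ i : ℤ, |(i : ℝ) * h k - x₀| ≤ R / 4 → ∀ t ∈ Icc τ T,
      ∀ s ∈ Icc τ T, s < t → |u k i t - u k i s| ≤ 1 / 2 * M * C * |t - s| := by
    filter_upwards [HC, H] with k h1 h2 i hi t ht s hs hst
    obtain ⟨h3, h4⟩ := h2 i (hi.trans (by linarith))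
    obtain ⟨ξ, hξ, e⟩ := h3.exists_mean_value (hh k) (hτ.le.trans hs.1) hst ht.2
    have hξ' : ξ ∈ Icc τ T := ⟨hs.1.trans hξ.1.le, hξ.2.le.trans ht.2⟩
    obtain ⟨b1, b2⟩ := h4 ξ ⟨hτ.le.trans hξ'.1, hξ'.2⟩
    have b3 := (h1 i hi ξ hξ').1
    rw [e, abs_mul, mul_comm, abs_mul, abs_of_nonneg (by linarith : 0 ≤ 1 / 2 * u k i ξ)]
    gcongr
  filter_upwards [main] with k hk i hi t ht s hs
  rcases lt_trichotomy s t with hst | rfl | hst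
  · exact hk i hi t ht s hs hst
  · simp
  · rw [abs_sub_comm, abs_sub_comm t]
    exact hk i hi s hs t ht hst

lemma GridBdd.gridConvAt (hε : 0 < ε) (hM : 0 ≤ M) (hR : 0 < R) (hh : ∀ k, 0 < h k)
    (h0 : Tendsto h 𝒰 (𝓝 0)) (H : GridBdd 𝒰 T ε M R x₀ h u) {t x : ℝ} (ht : t ∈ Ioc 0 T)
    (hx : |x - x₀| < R / 4) :
    GridConvAt 𝒰 T h u (gridLim 𝒰 h (fun k i => u k i t) x) t x := by
  have hτ : 0 < t / 2 := half_pos ht.1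
  have htτ : t ∈ Icc (t / 2) T := ⟨by linarith, ht.2⟩
  obtain ⟨C, hC, HC, HL⟩ := gridLim_taylor hε hM hR hτ hh h0 H
  obtain ⟨D, hD, HD⟩ := H.time_lipschitz hε hM hR hh h0 hτ
  have hlim := (HL (fun _ => t) (Eventually.of_forall fun _ => htτ) x hx).1
  intro e he
  obtain ⟨δ, hδ, d1, d2, d3, d4⟩ : ∃ δ > 0, δ < t / 2 ∧ |x - x₀| + δ < R / 4 ∧
      C * (2 * δ) ≤ e / 4 ∧ D * δ ≤ e / 4 := by
    refine ⟨min (min (t / 4) ((R / 4 - |x - x₀|) / 2)) (min (e / (8 * (C + 1))) (e / (4 * (D + 1)))),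
      lt_min (lt_min (by linarith) (by linarith)) (lt_min (by positivity) (by positivity)), ?_⟩
    set δ := min (min (t / 4) ((R / 4 - |x - x₀|) / 2))
      (min (e / (8 * (C + 1))) (e / (4 * (D + 1))))
    have a1 : δ ≤ t / 4 := (min_le_left _ _).trans (min_le_left _ _)
    have a2 : δ ≤ (R / 4 - |x - x₀|) / 2 := (min_le_left _ _).trans (min_le_right _ _)
    have a3 : δ ≤ e / (8 * (C + 1)) := (min_le_right _ _).trans (min_le_left _ _)
    have a4 : δ ≤ e / (4 * (D + 1)) := (min_le_right _ _).trans (min_le_right _ _)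
    have hδ : 0 < δ :=
      lt_min (lt_min (by linarith) (by linarith)) (lt_min (by positivity) (by positivity))
    rw [le_div_iff₀ (by positivity)] at a3 a4
    refine ⟨by linarith, by linarith, by linarith, by linarith⟩
  refine ⟨δ, hδ, ?_⟩
  filter_upwards [HC, HD, eventually_floor_mem hh h0 hx, eventually_floor_mem hh h0
    (show |x - x| < δ by simpa using hδ), (Metric.tendsto_nhds.1 hlim) (e / 4) (by positivity)]
    with k k1 k2 k3 k4 k5 i hi s hs hst
  have hi' : |(i : ℝ) * h k - x₀| ≤ R / 4 := by
    have := abs_sub_le ((i : ℝ) * h k) x x₀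
    linarith
  have hs' : s ∈ Icc (t / 2) T := by
    rw [abs_lt] at hst
    exact ⟨by linarith, hs.2⟩
  have b1 := k2 i hi' s hs' t htτ
  have b2 := (k1 _ k3.le t htτ).2 i hi'
  have b3 : |(i : ℝ) * h k - ⌊x / h k⌋ * h k| ≤ 2 * δ := by
    rw [abs_lt] at *
    rw [abs_le]
    constructor <;> linarith
  have b4 : C * |(i : ℝ) * h k - ⌊x / h k⌋ * h k| ≤ C * (2 * δ) := by gcongr
  have b5 : D * |s - t| ≤ D * δ := by gcongr
  rw [Real.dist_eq] at k5
  have e1 := abs_sub_le (u k i s) (u k i t) (gridLim 𝒰 h (fun k i => u k i t) x)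
  have e2 := abs_sub_le (u k i t) (u k ⌊x / h k⌋ t) (gridLim 𝒰 h (fun k i => u k i t) x)
  linarith

/-- An ultrafilter limit of semi-discrete solutions is a classical solution. -/
lemma GridBdd.classical (hε : 0 < ε) (hM : 0 ≤ M) (hR : 0 < R) (hh : ∀ k, 0 < h k)
    (h0 : Tendsto h 𝒰 (𝓝 0)) (H : GridBdd 𝒰 T ε M R x₀ h u) :
    (∀ t ∈ Ioc 0 T, ∀ x, |x - x₀| < R / 4 →
      HasDerivAt (gridLim 𝒰 h fun k i => u k i t)
        (gridLim 𝒰 h (fun k i => gridD1 (h k) (u k) i t) x) x ∧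
      HasDerivAt (gridLim 𝒰 h fun k i => gridD1 (h k) (u k) i t)
        (gridLim 𝒰 h (fun k i => gridD2 (h k) (u k) i t) x) x ∧
      HasDerivWithinAt (fun s => gridLim 𝒰 h (fun k i => u k i s) x)
        (1 / 2 * gridLim 𝒰 h (fun k i => u k i t) x *
          gridLim 𝒰 h (fun k i => gridD2 (h k) (u k) i t) x) (Icc 0 T) t) ∧
    ContinuousOn (fun p : ℝ × ℝ => gridLim 𝒰 h (fun k i => gridD2 (h k) (u k) i p.1) p.2)
      (Ioc 0 T ×ˢ Metric.ball x₀ (R / 4)) := by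
  set U : ℝ → ℝ → ℝ := fun t x => gridLim 𝒰 h (fun k i => u k i t) x with hU
  set P : ℝ → ℝ → ℝ := fun t x => gridLim 𝒰 h (fun k i => gridD1 (h k) (u k) i t) x with hP
  set Q : ℝ → ℝ → ℝ := fun t x => gridLim 𝒰 h (fun k i => gridD2 (h k) (u k) i t) x with hQ
  have hconv : ∀ t ∈ Ioc 0 T, ∀ x, |x - x₀| < R / 4 → GridConvAt 𝒰 T h u (U t x) t x :=
    fun t ht x hx => H.gridConvAt hε hM hR hh h0 ht hx
  have hUc : ContinuousOn (Function.uncurry U) (Ioc 0 T ×ˢ Metric.ball x₀ (R / 4)) :=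
    gridConvAt_continuousOn hh h0
      (fun p hp => ⟨⟨hp.1.1.le, hp.1.2⟩, mem_univ _⟩) fun p hp => hconv _ hp.1 _ hp.2
  have hUt : ∀ x, |x - x₀| < R / 4 → ContinuousOn (fun t => U t x) (Ioc 0 T) := by
    intro x hx
    exact hUc.comp (f := fun t : ℝ => (t, x)) (by fun_prop) fun t ht => ⟨ht, hx⟩
  -- joint continuity of the second derivative away from the initial time
  have hQτ : ∀ τ, 0 < τ → ContinuousOn (Function.uncurry Q)
      (Icc τ T ×ˢ Metric.ball x₀ (R / 4)) := by
    intro τ hτ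
    obtain ⟨C, hC, -, HL⟩ := gridLim_taylor hε hM hR hτ hh h0 H
    have HL' := fun t (ht : t ∈ Icc τ T) => HL (fun _ => t) (Eventually.of_forall fun _ => ht)
    have hPt : ∀ x, |x - x₀| < R / 4 → ContinuousOn (fun t => P t x) (Icc τ T) := fun x hx =>
      continuousOn_time_of_taylor hC (fun t ht x hx y hy => ((HL' t ht x hx).2.2 y hy).1)
        (fun x hx => (hUt x hx).mono fun t ht => ⟨hτ.trans_le ht.1, ht.2⟩) hx
    have hQt : ∀ x, |x - x₀| < R / 4 → ContinuousOn (fun t => Q t x) (Icc τ T) := fun x hx =>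
      continuousOn_time_of_taylor hC (fun t ht x hx y hy => ((HL' t ht x hx).2.2 y hy).2.1)
        hPt hx
    refine continuousOn_prod_of_continuousOn_lipschitzOnWith' (Function.uncurry Q) ⟨C, hC⟩
      (fun t ht => LipschitzOnWith.of_dist_le_mul fun x hx y hy => ?_) fun x hx => hQt x hx
    exact ((HL' t ht y hy).2.2 x hx).2.2.2
  refine ⟨fun t ht x hx => ?_, ?_⟩
  · have hτ : 0 < t / 2 := half_pos ht.1
    have htτ : t / 2 < t := by linarith [ht.1]
    obtain ⟨C, hC, -, HL⟩ := gridLim_taylor hε hM hR hτ hh h0 H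
    have hd1 : ∀ θ : ℕ → ℝ, (∀ᶠ k in 𝒰, θ k ∈ Icc (t / 2) T) → ∀ x, |x - x₀| < R / 4 →
        HasDerivAt (gridLim 𝒰 h fun k i => u k i (θ k))
          (gridLim 𝒰 h (fun k i => gridD1 (h k) (u k) i (θ k)) x) x :=
      fun θ hθ x hx => hasDerivAt_of_abs_sub_le_sq hx fun y hy => ((HL θ hθ x hx).2.2 y hy).1
    have hd2 : ∀ θ : ℕ → ℝ, (∀ᶠ k in 𝒰, θ k ∈ Icc (t / 2) T) → ∀ x, |x - x₀| < R / 4 →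
        HasDerivAt (gridLim 𝒰 h fun k i => gridD1 (h k) (u k) i (θ k))
          (gridLim 𝒰 h (fun k i => gridD2 (h k) (u k) i (θ k)) x) x :=
      fun θ hθ x hx => hasDerivAt_of_abs_sub_le_sq hx fun y hy => ((HL θ hθ x hx).2.2 y hy).2.1
    have hconst : ∀ t' ∈ Icc (t / 2) T, ∀ᶠ k in (𝒰 : Filter ℕ), (fun _ : ℕ => t') k ∈ Icc (t / 2) T :=
      fun t' ht' => Eventually.of_forall fun _ => ht'
    have hopen : ∀ x, |x - x₀| < R / 4 → ∀ᶠ y in 𝓝 x, |y - x₀| < R / 4 := fun x hx =>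
      ((continuous_id.sub continuous_const).abs.tendsto x).eventually_lt_const hx
    refine ⟨hd1 _ (hconst t ⟨htτ.le, ht.2⟩) x hx, hd2 _ (hconst t ⟨htτ.le, ht.2⟩) x hx, ?_⟩
    -- limits along moving times
    have hmove : ∀ (θ : ℕ → ℝ) (t' : ℝ), (∀ᶠ k in 𝒰, θ k ∈ Icc (t / 2) T) → t' ∈ Icc (t / 2) T →
        Tendsto θ 𝒰 (𝓝 t') → ∀ x, |x - x₀| < R / 4 →
        gridLim 𝒰 h (fun k i => u k i (θ k)) x = U t' x ∧
        gridLim 𝒰 h (fun k i => gridD2 (h k) (u k) i (θ k)) x = Q t' x := by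
      intro θ t' hθ ht' hlim
      have e1 : ∀ x, |x - x₀| < R / 4 → gridLim 𝒰 h (fun k i => u k i (θ k)) x = U t' x :=
        fun x hx => tendsto_nhds_unique (HL θ hθ x hx).1
          ((hconv t' ⟨hτ.trans_le ht'.1, ht'.2⟩ x hx).tendsto (tendsto_floor_mul hh h0 x) hlim
            (hθ.mono fun k hk => ⟨hτ.le.trans hk.1, hk.2⟩))
      have e2 : ∀ x, |x - x₀| < R / 4 →
          gridLim 𝒰 h (fun k i => gridD1 (h k) (u k) i (θ k)) x = P t' x := fun x hx =>
        ((hd1 θ hθ x hx).congr_of_eventuallyEq ((hopen x hx).mono fun y hy => (e1 y hy).symm)).unique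
          (hd1 _ (hconst t' ht') x hx)
      have e3 : ∀ x, |x - x₀| < R / 4 →
          gridLim 𝒰 h (fun k i => gridD2 (h k) (u k) i (θ k)) x = Q t' x := fun x hx =>
        ((hd2 θ hθ x hx).congr_of_eventuallyEq ((hopen x hx).mono fun y hy => (e2 y hy).symm)).unique
          (hd2 _ (hconst t' ht') x hx)
      exact fun x hx => ⟨e1 x hx, e3 x hx⟩
    refine hasDerivWithinAt_of_mean_value (g := fun t => 1 / 2 * U t x * Q t x) htτ ht.2 ?_ ?_
    · have hmaps : MapsTo (fun t : ℝ => (t, x)) (Icc (t / 2) T)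
          (Icc (t / 2) T ×ˢ Metric.ball x₀ (R / 4)) := fun t ht => ⟨ht, hx⟩
      have c1 : ContinuousOn (fun t => Q t x) (Icc (t / 2) T) :=
        (hQτ _ hτ).comp (f := fun t : ℝ => (t, x)) (by fun_prop) hmaps
      have c2 : ContinuousOn (fun t => U t x) (Icc (t / 2) T) :=
        (hUt x hx).mono fun t ht => ⟨hτ.trans_le ht.1, ht.2⟩
      exact ((continuousOn_const.mul c2).mul c1) t ⟨htτ.le, ht.2⟩
    · intro s s' hs hss' hs'
      have hbox := eventually_floor_mem hh h0 hx
      have hex : ∀ᶠ k in (𝒰 : Filter ℕ), ∃ ξ ∈ Icc s s', u k ⌊x / h k⌋ s' - u k ⌊x / h k⌋ s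
          = (s' - s) * (1 / 2 * u k ⌊x / h k⌋ ξ * gridD2 (h k) (u k) ⌊x / h k⌋ ξ) := by
        filter_upwards [H, hbox] with k h1 h2
        obtain ⟨ξ, hξ, e⟩ := (h1 _ (h2.le.trans (by linarith))).1.exists_mean_value (hh k)
          (hτ.le.trans hs) hss' hs'
        exact ⟨ξ, Ioo_subset_Icc_self hξ, e⟩
      obtain ⟨θ, hθ⟩ := hex.choice
      have hθ1 : ∀ᶠ k in 𝒰, θ k ∈ Icc (t / 2) T :=
        hθ.mono fun k hk => ⟨hs.trans hk.1.1, hk.1.2.trans hs'⟩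
      obtain ⟨ξ, hξ, hlim⟩ := isCompact_Icc.ultrafilter_le_nhds (𝒰.map θ)
        (le_principal_iff.2 (hθ.mono fun k hk => hk.1))
      have hξ' : ξ ∈ Icc (t / 2) T := ⟨hs.trans hξ.1, hξ.2.trans hs'⟩
      obtain ⟨e1, e2⟩ := hmove θ ξ hθ1 hξ' hlim x hx
      obtain ⟨l1, l2, -⟩ := HL θ hθ1 x hx
      rw [e1] at l1
      rw [e2] at l2
      have l3 := (HL _ (hconst s' ⟨hs.trans hss'.le, hs'⟩) x hx).1
      have l4 := (HL _ (hconst s ⟨hs, hss'.le.trans hs'⟩) x hx).1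
      refine ⟨ξ, hξ, tendsto_nhds_unique (l3.sub l4)
        ((((l1.const_mul (1 / 2)).mul l2).const_mul (s' - s)).congr' ?_)⟩
      exact hθ.mono fun k hk => hk.2.symm
  · intro p hp
    have hτ : 0 < p.1 / 2 := half_pos hp.1.1
    refine (hQτ _ hτ p ⟨⟨by linarith [hp.1.1], hp.1.2⟩, hp.2⟩).mono_of_mem_nhdsWithin ?_
    have h1 : {q : ℝ × ℝ | p.1 / 2 < q.1} ∈ 𝓝[Ioc 0 T ×ˢ Metric.ball x₀ (R / 4)] p :=
      mem_nhdsWithin_of_mem_nhds ((isOpen_lt continuous_const continuous_fst).mem_nhds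
        (show p.1 / 2 < p.1 by linarith [hp.1.1]))
    filter_upwards [h1, self_mem_nhdsWithin] with q hq1 hq2
    exact ⟨⟨le_of_lt hq1, hq2.1.2⟩, hq2.2⟩

end Limit

lemma gridConvAt_initial {F : Filter ℕ} {T ε M R x₀ : ℝ} {h : ℕ → ℝ} {u : ℕ → ℤ → ℝ → ℝ}
    {g : ℝ → ℝ} (hε : 0 < ε) (hM : 0 ≤ M) (hR : 0 < R) (hh : ∀ k, 0 < h k)
    (h0 : Tendsto h F (𝓝 0)) (H : GridBdd F T ε M R x₀ h u) (hg : ContinuousAt g x₀)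
    (hu : ∀ᶠ k in F, ∀ i : ℤ, |(i : ℝ) * h k - x₀| ≤ R → u k i 0 = g (i * h k)) :
    GridConvAt F T h u (g x₀) 0 x₀ := by
  intro e he
  obtain ⟨ρ₀, hρ₀, hgρ⟩ := Metric.continuousAt_iff.1 hg (e / 4) (by positivity)
  obtain ⟨ρ, hρ, hρR, hρρ⟩ : ∃ ρ > 0, ρ ≤ R ∧ ρ < ρ₀ :=
    ⟨min R (ρ₀ / 2), lt_min hR (by positivity), min_le_left _ _,
      (min_le_right _ _).trans_lt (by linarith)⟩
  set Z := M + |g x₀| + e / 4 with hZ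
  have hZ0 : 0 < Z := by positivity
  set κ := 8 * Z / ρ ^ 2 with hκ
  have hκ0 : 0 < κ := by positivity
  set c := 2 * κ * (M / 2) + 1 with hc
  have hc0 : 0 < c := by positivity
  have hκρ : 8 * Z ≤ κ * ρ ^ 2 := by
    rw [hκ, div_mul_cancel₀ _ (by positivity)]
  obtain ⟨δ, hδ, d1, d2, d3⟩ : ∃ δ > 0, δ ≤ ρ ∧ κ * δ ^ 2 ≤ e / 4 ∧ c * δ ≤ e / 4 := by
    refine ⟨min (min ρ 1) (min (e / (4 * κ)) (e / (4 * c))),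
      lt_min (lt_min hρ one_pos) (lt_min (by positivity) (by positivity)), ?_⟩
    set δ := min (min ρ 1) (min (e / (4 * κ)) (e / (4 * c)))
    have hδ : 0 < δ := lt_min (lt_min hρ one_pos) (lt_min (by positivity) (by positivity))
    have a1 : δ ≤ ρ := (min_le_left _ _).trans (min_le_left _ _)
    have a2 : δ ≤ 1 := (min_le_left _ _).trans (min_le_right _ _)
    have a3 : δ ≤ e / (4 * κ) := (min_le_right _ _).trans (min_le_left _ _)
    have a4 : δ ≤ e / (4 * c) := (min_le_right _ _).trans (min_le_right _ _)
    rw [le_div_iff₀ (by positivity)] at a3 a4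
    have a5 : δ ^ 2 ≤ δ := by nlinarith
    have a6 : κ * δ ^ 2 ≤ κ * δ := by gcongr
    exact ⟨a1, by linarith, by linarith⟩
  refine ⟨δ, hδ, ?_⟩
  filter_upwards [H, h0.eventually_le_const (half_pos hρ), hu] with k hk hkρ hu i hi t ht htδ
  have hiρ : |(i : ℝ) * h k - x₀| ≤ ρ := hi.le.trans d1
  have hgi : ∀ i : ℤ, |(i : ℝ) * h k - x₀| ≤ ρ → |g (i * h k) - g x₀| < e / 4 := fun i hi =>
    hgρ (hi.trans_lt hρρ)
  have hbd : ∀ i : ℤ, |(i : ℝ) * h k - x₀| ≤ ρ → ∀ t ∈ Icc 0 T, |u k i t| ≤ Z ∧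
      0 ≤ 1 / 2 * u k i t ∧ 1 / 2 * u k i t ≤ M / 2 := by
    intro i hi t ht
    obtain ⟨b1, b2⟩ := (hk i (hi.trans hρR)).2 t ht
    refine ⟨?_, by linarith, by linarith⟩
    rw [abs_of_pos (hε.trans_le b1)]
    have := abs_nonneg (g x₀)
    linarith
  have hup := initial_barrier (T := T) (Λ := M / 2) (Z := Z) (ρ := ρ) (x₀ := x₀)
    (A := g x₀ + e / 4) (κ := κ) (c := c) (z := u k) (a := fun i t => 1 / 2 * u k i t)
    (hh k) hkρ
    (by
      refine (abs_add_le _ _).trans ?_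
      rw [abs_of_pos (by positivity : 0 < e / 4)]
      linarith) hκ0.le hκρ (by linarith)
    (fun i hi t ht => ⟨(hbd i hi t ht).1, (hbd i hi t ht).2.1, (hbd i hi t ht).2.2,
      (hk i (hi.trans hρR)).1 t ht⟩)
    (fun i hi => by
      have := (abs_lt.1 (hgi i hi)).2
      have : 0 ≤ κ * (i * h k - x₀) ^ 2 := by positivity
      rw [hu i (hi.trans hρR)]
      linarith) i hiρ t ht
  have hlo := initial_barrier (T := T) (Λ := M / 2) (Z := Z) (ρ := ρ) (x₀ := x₀)
    (A := -g x₀ + e / 4) (κ := κ) (c := c) (z := fun i t => -u k i t)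
    (a := fun i t => 1 / 2 * u k i t)
    (hh k) hkρ
    (by
      refine (abs_add_le _ _).trans ?_
      rw [abs_of_pos (by positivity : 0 < e / 4), abs_neg]
      linarith) hκ0.le hκρ (by linarith)
    (fun i hi t ht => ⟨by rw [abs_neg]; exact (hbd i hi t ht).1, (hbd i hi t ht).2.1,
      (hbd i hi t ht).2.2,
      ((hk i (hi.trans hρR)).1 t ht).neg.congr_deriv (by ring)⟩)
    (fun i hi => by
      have := (abs_lt.1 (hgi i hi)).1
      have : 0 ≤ κ * (i * h k - x₀) ^ 2 := by positivity
      rw [hu i (hi.trans hρR)]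
      linarith) i hiρ t ht
  have e1 : κ * (i * h k - x₀) ^ 2 ≤ κ * δ ^ 2 := by
    rw [← sq_abs]
    gcongr
  have e2 : c * t ≤ c * δ := by
    rw [sub_zero] at htδ
    gcongr
    exact (le_abs_self t).trans htδ.le
  rw [abs_lt]
  constructor <;> linarith

lemma exists_linear_modulus {f : ℝ → ℝ} {K : Set ℝ} (hK : IsCompact K) (hf : ContinuousOn f K)
    {e : ℝ} (he : 0 < e) :
    ∃ L ≥ 0, ∀ x ∈ K, ∀ y ∈ K, |f x - f y| ≤ e + L * |x - y| := by
  obtain ⟨δ, hδ, h1⟩ := Metric.uniformContinuousOn_iff.1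
    (hK.uniformContinuousOn_of_continuous hf) e he
  obtain ⟨B, hB⟩ := hK.exists_bound_of_continuousOn hf
  refine ⟨2 * |B| / δ, by positivity, fun x hx y hy => ?_⟩
  by_cases hxy : dist x y < δ
  · have h2 : |f x - f y| < e := h1 x hx y hy hxy
    have : 0 ≤ 2 * |B| / δ * |x - y| := by positivity
    linarith
  · rw [Real.dist_eq, not_lt] at hxy
    have h2 : |f x - f y| ≤ 2 * |B| := by
      have a1 := hB x hx
      have a2 := hB y hy
      rw [Real.norm_eq_abs] at a1 a2
      have := abs_sub (f x) (f y)
      have := le_abs_self B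
      linarith
    have h3 : 2 * |B| / δ * δ ≤ 2 * |B| / δ * |x - y| := by gcongr
    rw [div_mul_cancel₀ _ hδ.ne'] at h3
    linarith

lemma lateral_upper {l Z ρ T e : ℝ} (hl : 0 < l) (hZ : 0 ≤ Z) (hρ : 0 < ρ) (he : 0 < e)
    {γ φ : ℝ → ℝ} (hγ : ContinuousOn γ (Icc 0 T)) (hφ : ContinuousOn φ (Icc 0 ρ))
    (hγφ : γ 0 = φ 0) :
    ∃ K ≥ 0, ∀ (h : ℝ) (z a : ℤ → ℝ → ℝ), 0 < h → h ≤ ρ / 2 →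
      (∀ j : ℤ, ContinuousOn (z j) (Icc 0 T) ∧ ∀ t ∈ Icc 0 T, |z j t| ≤ Z) →
      (∀ j : ℤ, 0 < j → j * h < ρ → ∀ t ∈ Icc 0 T, l ≤ a j t ∧ HasDerivWithinAt (z j)
        (a j t * ((z (j + 1) t + z (j - 1) t - 2 * z j t) / h ^ 2)) (Icc 0 T) t) →
      (∀ t ∈ Icc 0 T, z 0 t = γ t) → (∀ j : ℤ, 0 ≤ j → j * h ≤ ρ → z j 0 = φ (j * h)) →
      ∀ j : ℤ, 0 ≤ j → j * h ≤ ρ → ∀ t ∈ Icc 0 T, z j t ≤ γ t + e + K * (j * h) := by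
  obtain ⟨L₁, hL₁, h1⟩ := exists_linear_modulus isCompact_Icc hγ (half_pos he)
  obtain ⟨L₂, hL₂, h2⟩ := exists_linear_modulus isCompact_Icc hφ (half_pos he)
  obtain ⟨K, hK, HK⟩ := lateral_barrier (L := max L₁ L₂) hl (le_max_of_le_left hL₁) hZ hρ
  refine ⟨K, hK, fun h z a hh hhρ hz1 hz2 hz3 hz4 j hj hjρ t ht => ?_⟩
  have hsub : Icc 0 t ⊆ Icc 0 T := Icc_subset_Icc_right ht.2
  have h0T : (0 : ℝ) ∈ Icc 0 T := ⟨le_rfl, ht.1.trans ht.2⟩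
  refine HK h t (γ t + e) z a hh hhρ ht.1
    (fun j _ _ => ⟨(hz1 j).1.mono hsub, fun s hs => (hz1 j).2 s (hsub hs)⟩)
    (fun j hj hjρ s hs => ⟨(hz2 j hj hjρ s (hsub hs)).1, (hz2 j hj hjρ s (hsub hs)).2.mono hsub⟩)
    (fun s hs => ?_) (fun j hj hjρ => ?_) j hj hjρ
  · rw [hz3 s (hsub hs)]
    have a1 := h1 s (hsub hs) t ht
    rw [abs_of_nonpos (by linarith [hs.2] : s - t ≤ 0)] at a1
    have a2 : L₁ * (t - s) ≤ max L₁ L₂ * (t - s) :=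
      mul_le_mul_of_nonneg_right (le_max_left _ _) (by linarith [hs.2])
    have := le_abs_self (γ s - γ t)
    linarith
  · rw [hz4 j hj hjρ]
    have hjh : 0 ≤ (j : ℝ) * h := mul_nonneg (by exact_mod_cast hj) hh.le
    have a1 := h2 (j * h) ⟨hjh, hjρ⟩ 0 ⟨le_rfl, hρ.le⟩
    have a2 := h1 0 h0T t ht
    rw [sub_zero, abs_of_nonneg hjh] at a1
    rw [zero_sub, abs_neg, abs_of_nonneg ht.1] at a2
    have a3 : L₁ * t ≤ max L₁ L₂ * t := mul_le_mul_of_nonneg_right (le_max_left _ _) ht.1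
    have a4 : L₂ * (j * h) ≤ max L₁ L₂ * (j * h) :=
      mul_le_mul_of_nonneg_right (le_max_right _ _) hjh
    have a5 := le_abs_self (φ (j * h) - φ 0)
    have a6 := le_abs_self (γ 0 - γ t)
    linarith

/-- Solutions of the semi-discrete equation on the grid `{i h : |i| < N}` with initial and
lateral data prescribed by `g`. -/
structure DirichletGrid (T a b : ℝ) (g : ℝ → ℝ → ℝ) (h : ℝ) (N : ℤ) (u : ℤ → ℝ → ℝ) : Prop where
  solves : ∀ i, |i| < N → SolvesAt T h u i
  bdry : ∀ i, N ≤ |i| → ∀ t ∈ Icc 0 T, u i t = g t (i * h)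
  initial : ∀ i : ℤ, u i 0 = g 0 (i * h)
  bound : ∀ i, ∀ t ∈ Icc 0 T, a ≤ u i t ∧ u i t ≤ b
  cont : ∀ i, ContinuousOn (u i) (Icc 0 T)

lemma exists_dirichletGrid {T a b h : ℝ} (hT : 0 < T) (hh : 0 < h) (ha : 0 < a) (hab : a ≤ b)
    (N : ℤ) {g : ℝ → ℝ → ℝ} (hg : ContinuousOn (Function.uncurry g) (Icc 0 T ×ˢ univ))
    (hgb : ∀ t ∈ Icc 0 T, ∀ x, a ≤ g t x ∧ g t x ≤ b) : ∃ u, DirichletGrid T a b g h N u := by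
  have hgc : ∀ x, ContinuousOn (fun t => g t x) (Icc 0 T) := fun x =>
    hg.comp (f := fun t => (t, x)) (by fun_prop) fun t ht => ⟨ht, mem_univ _⟩
  obtain ⟨u, h1, h2, h3, h4⟩ := exists_grid_solution hT hh ha hab N
    (g := fun i t => g t (i * h)) (fun i => hgc _) fun i t ht => hgb t ht _
  refine ⟨u, h1, fun i hi t _ => h2 i hi t, h3, h4, fun i => ?_⟩
  by_cases hi : |i| < N
  · exact (h1 i hi).continuousOn
  · exact (hgc (i * h)).congr fun t _ => h2 i (not_lt.1 hi) t

lemma DirichletGrid.reflect {T a b h : ℝ} {N : ℤ} {g : ℝ → ℝ → ℝ} {u : ℤ → ℝ → ℝ}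
    (H : DirichletGrid T a b g h N u) :
    DirichletGrid T a b (fun t x => g t (-x)) h N (fun i => u (-i)) where
  solves i hi t ht := by
    refine (H.solves (-i) (by rwa [abs_neg]) t ht).congr_deriv ?_
    simp only [show -(i + 1) = -i - 1 by ring, show -(i - 1) = -i + 1 by ring]
    ring
  bdry i hi t ht := by rw [H.bdry (-i) (by rwa [abs_neg]) t ht]; push_cast; rw [neg_mul]
  initial i := by rw [H.initial (-i)]; push_cast; rw [neg_mul]
  bound i := H.bound (-i)
  cont i := H.cont (-i)

lemma GridConvAt.gridLim_eq {𝒰 : Ultrafilter ℕ} {T : ℝ} {h : ℕ → ℝ} {u : ℕ → ℤ → ℝ → ℝ}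
    {L t x : ℝ} (hh : ∀ k, 0 < h k) (h0 : Tendsto h 𝒰 (𝓝 0)) (ht : t ∈ Icc 0 T)
    (H : GridConvAt 𝒰 T h u L t x) : gridLim 𝒰 h (fun k i => u k i t) x = L :=
  (H.tendsto (tendsto_floor_mul hh h0 x) tendsto_const_nhds
    (Eventually.of_forall fun _ => ht)).limUnder_eq

lemma dirichletGrid_gridConvAt_right {F : Filter ℕ} {T a b n : ℝ} (ha : 0 < a) (hn : 0 < n)
    {h : ℕ → ℝ} {N : ℕ → ℤ} {u : ℕ → ℤ → ℝ → ℝ} {g : ℝ → ℝ → ℝ} (hh : ∀ k, 0 < h k)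
    (h0 : Tendsto h F (𝓝 0)) (hN : ∀ k, N k * h k = n)
    (hg : ContinuousOn (Function.uncurry g) (Icc 0 T ×ˢ univ))
    (H : ∀ k, DirichletGrid T a b g (h k) (N k) (u k)) {t₀ : ℝ} (ht₀ : t₀ ∈ Icc 0 T) :
    GridConvAt F T h u (g t₀ n) t₀ n := by
  intro e he
  have h0T : (0 : ℝ) ∈ Icc 0 T := ⟨le_rfl, ht₀.1.trans ht₀.2⟩
  have hγ : ContinuousOn (fun t => g t n) (Icc 0 T) :=
    hg.comp (f := fun t => (t, n)) (by fun_prop) fun t ht => ⟨ht, mem_univ _⟩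
  have hφ : ContinuousOn (fun y => g 0 (n - y)) (Icc 0 n) :=
    hg.comp (f := fun y => ((0 : ℝ), n - y)) (by fun_prop) fun t ht => ⟨h0T, mem_univ _⟩
  have he4 : 0 < e / 4 := by positivity
  have hb : ∀ k i, ∀ t ∈ Icc 0 T, |u k i t| ≤ |b| := fun k i t ht => by
    obtain ⟨b1, b2⟩ := (H k).bound i t ht
    rw [abs_of_pos (ha.trans_le b1)]
    exact b2.trans (le_abs_self b)
  obtain ⟨K₁, hK₁, H₁⟩ := lateral_upper (l := a / 2) (half_pos ha) (abs_nonneg b) hn he4 hγ hφ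
    (by simp)
  obtain ⟨K₂, hK₂, H₂⟩ := lateral_upper (l := a / 2) (half_pos ha) (abs_nonneg b) hn he4 hγ.neg
    hφ.neg (by simp)
  obtain ⟨δ₀, hδ₀, hgδ⟩ := Metric.continuousWithinAt_iff.1 (hg (t₀, n) ⟨ht₀, mem_univ _⟩) _ he4
  obtain ⟨δ, hδ, d1, d2, d3, d4⟩ : ∃ δ > 0, δ ≤ n ∧ δ ≤ δ₀ ∧ K₁ * δ ≤ e / 4 ∧ K₂ * δ ≤ e / 4 := by
    refine ⟨min (min n δ₀) (min (e / 4 / (K₁ + 1)) (e / 4 / (K₂ + 1))), by positivity,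
      (min_le_left _ _).trans (min_le_left _ _), (min_le_left _ _).trans (min_le_right _ _), ?_, ?_⟩
    · have := (le_div_iff₀ (by positivity)).1
        ((min_le_right (min n δ₀) _).trans (min_le_left (e / 4 / (K₁ + 1)) (e / 4 / (K₂ + 1))))
      have : 0 < min (min n δ₀) (min (e / 4 / (K₁ + 1)) (e / 4 / (K₂ + 1))) := by positivity
      linarith
    · have := (le_div_iff₀ (by positivity)).1
        ((min_le_right (min n δ₀) _).trans (min_le_right (e / 4 / (K₁ + 1)) (e / 4 / (K₂ + 1))))
      have : 0 < min (min n δ₀) (min (e / 4 / (K₁ + 1)) (e / 4 / (K₂ + 1))) := by positivity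
      linarith
  refine ⟨δ, hδ, ?_⟩
  filter_upwards [h0.eventually_le_const (half_pos hn)] with k hk i hi t ht htδ
  have hgc : ∀ x, |x - n| < δ → |g t x - g t₀ n| < e / 4 := fun x hx =>
    hgδ (x := (t, x)) ⟨ht, mem_univ _⟩ (by
      rw [Prod.dist_eq, max_lt_iff, Real.dist_eq, Real.dist_eq]
      exact ⟨htδ.trans_le d2, hx.trans_le d2⟩)
  by_cases hiN : N k ≤ i
  · rw [(H k).bdry i (hiN.trans (le_abs_self i)) t ht]
    exact (hgc _ hi).trans (by linarith)
  have hNk := hN k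
  have hcast : ∀ j : ℤ, ((N k - j : ℤ) : ℝ) * h k = n - j * h k := fun j => by
    push_cast
    rw [sub_mul, hNk]
  have hinside : ∀ j : ℤ, 0 < j → j * h k < n → |N k - j| < N k := by
    intro j hj hjn
    rw [← hNk] at hjn
    have : j < N k := by exact_mod_cast lt_of_mul_lt_mul_right hjn (hh k).le
    rw [abs_lt]
    constructor <;> linarith
  have hsolve : ∀ j : ℤ, 0 < j → j * h k < n → ∀ t ∈ Icc 0 T, a / 2 ≤ 1 / 2 * u k (N k - j) t ∧
      HasDerivWithinAt (u k (N k - j)) (1 / 2 * u k (N k - j) t *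
        ((u k (N k - (j + 1)) t + u k (N k - (j - 1)) t - 2 * u k (N k - j) t) / h k ^ 2))
        (Icc 0 T) t := by
    intro j hj hjn t ht
    refine ⟨by linarith [((H k).bound (N k - j) t ht).1], ?_⟩
    refine ((H k).solves _ (hinside j hj hjn) t ht).congr_deriv ?_
    rw [show N k - (j + 1) = N k - j - 1 by ring, show N k - (j - 1) = N k - j + 1 by ring]
    ring
  have hjn : |((N k - i : ℤ) : ℝ) * h k| < δ := by
    rw [hcast, abs_sub_comm]
    exact hi
  have hj0 : 0 ≤ N k - i := by linarith
  have hu := H₁ (h k) (fun j => u k (N k - j)) (fun j t => 1 / 2 * u k (N k - j) t) (hh k) hk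
    (fun j => ⟨(H k).cont _, hb k _⟩) hsolve
    (fun t ht => by
      simp only [sub_zero]
      rw [(H k).bdry _ (le_abs_self _) t ht, hNk])
    (fun j _ _ => by simp only [(H k).initial, hcast]) (N k - i) hj0
    ((le_abs_self _).trans (hjn.le.trans d1)) t ht
  have hl := H₂ (h k) (fun j t => -u k (N k - j) t) (fun j t => 1 / 2 * u k (N k - j) t) (hh k) hk
    (fun j => ⟨((H k).cont _).neg, fun t ht => by rw [abs_neg]; exact hb k _ t ht⟩)
    (fun j hj hjn t ht => ⟨(hsolve j hj hjn t ht).1,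
      (hsolve j hj hjn t ht).2.neg.congr_deriv (by ring)⟩)
    (fun t ht => by
      simp only [sub_zero]
      rw [(H k).bdry _ (le_abs_self _) t ht, hNk]
      rfl)
    (fun j _ _ => by simp only [(H k).initial, hcast]; rfl) (N k - i) hj0
    ((le_abs_self _).trans (hjn.le.trans d1)) t ht
  simp only [sub_sub_cancel, Pi.neg_apply] at hu hl
  have hgn := abs_lt.1 (hgc n (by simpa using hδ))
  have e1 : K₁ * (((N k - i : ℤ) : ℝ) * h k) ≤ K₁ * δ := by
    gcongr
    exact (le_abs_self _).trans hjn.le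
  have e2 : K₂ * (((N k - i : ℤ) : ℝ) * h k) ≤ K₂ * δ := by
    gcongr
    exact (le_abs_self _).trans hjn.le
  rw [abs_lt]
  constructor <;> linarith [hgn.1, hgn.2]

lemma dirichletGrid_gridConvAt_left {F : Filter ℕ} {T a b n : ℝ} (ha : 0 < a) (hn : 0 < n)
    {h : ℕ → ℝ} {N : ℕ → ℤ} {u : ℕ → ℤ → ℝ → ℝ} {g : ℝ → ℝ → ℝ} (hh : ∀ k, 0 < h k)
    (h0 : Tendsto h F (𝓝 0)) (hN : ∀ k, N k * h k = n)
    (hg : ContinuousOn (Function.uncurry g) (Icc 0 T ×ˢ univ))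
    (H : ∀ k, DirichletGrid T a b g (h k) (N k) (u k)) {t₀ : ℝ} (ht₀ : t₀ ∈ Icc 0 T) :
    GridConvAt F T h u (g t₀ (-n)) t₀ (-n) := by
  have hg' : ContinuousOn (Function.uncurry fun t x => g t (-x)) (Icc 0 T ×ˢ univ) :=
    hg.comp (f := fun p : ℝ × ℝ => (p.1, -p.2)) (by fun_prop) fun p hp => ⟨hp.1, mem_univ _⟩
  intro e he
  obtain ⟨δ, hδ, h1⟩ :=
    dirichletGrid_gridConvAt_right ha hn hh h0 hN hg' (fun k => (H k).reflect) ht₀ e he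
  refine ⟨δ, hδ, h1.mono fun k hk i hi t ht htδ => ?_⟩
  have := hk (-i) (by
    push_cast
    rw [← abs_neg]
    convert hi using 2
    ring) t ht htδ
  simpa only [neg_neg] using this

lemma dirichletGrid_gridBdd {F : Filter ℕ} {T a b n x₀ : ℝ} (hx₀ : |x₀| < n)
    {h : ℕ → ℝ} {N : ℕ → ℤ} {u : ℕ → ℤ → ℝ → ℝ} {g : ℝ → ℝ → ℝ} (hh : ∀ k, 0 < h k)
    (hN : ∀ k, N k * h k = n) (H : ∀ k, DirichletGrid T a b g (h k) (N k) (u k)) :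
    GridBdd F T a b ((n - |x₀|) / 2) x₀ h u := by
  refine Eventually.of_forall fun k i hi => ⟨(H k).solves i ?_, (H k).bound i⟩
  have h1 : |(i : ℝ) * h k| < N k * h k := by
    rw [hN]
    have := abs_add_le ((i : ℝ) * h k - x₀) x₀
    rw [sub_add_cancel] at this
    linarith
  rw [abs_mul, abs_of_pos (hh k)] at h1
  exact_mod_cast lt_of_mul_lt_mul_right h1 (hh k).le

lemma dirichletGrid_gridConvAt {𝒰 : Ultrafilter ℕ} {T a b n : ℝ} (ha : 0 < a) (hb : 0 ≤ b)
    (hn : 0 < n) {h : ℕ → ℝ} {N : ℕ → ℤ} {u : ℕ → ℤ → ℝ → ℝ} {g : ℝ → ℝ → ℝ} (hh : ∀ k, 0 < h k)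
    (h0 : Tendsto h 𝒰 (𝓝 0)) (hN : ∀ k, N k * h k = n)
    (hg : ContinuousOn (Function.uncurry g) (Icc 0 T ×ˢ univ))
    (H : ∀ k, DirichletGrid T a b g (h k) (N k) (u k)) :
    (∀ p ∈ Icc 0 T ×ˢ Icc (-n) n,
      GridConvAt 𝒰 T h u (gridLim 𝒰 h (fun k i => u k i p.1) p.2) p.1 p.2) ∧
    ∀ t ∈ Icc 0 T, ∀ x ∈ Icc (-n) n, (t = 0 ∨ x = -n ∨ x = n) →
      gridLim 𝒰 h (fun k i => u k i t) x = g t x := by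
  have hbd : ∀ t ∈ Icc 0 T, ∀ x ∈ Icc (-n) n, (t = 0 ∨ x = -n ∨ x = n) →
      GridConvAt 𝒰 T h u (g t x) t x := by
    intro t ht x hx hp
    by_cases hx1 : x = -n
    · rw [hx1]
      exact dirichletGrid_gridConvAt_left ha hn hh h0 hN hg H ht
    by_cases hx2 : x = n
    · rw [hx2]
      exact dirichletGrid_gridConvAt_right ha hn hh h0 hN hg H ht
    obtain rfl : t = 0 := by tauto
    have hxn : |x| < n := abs_lt.2 ⟨lt_of_le_of_ne hx.1 (Ne.symm hx1), lt_of_le_of_ne hx.2 hx2⟩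
    refine gridConvAt_initial (g := fun y => g 0 y) ha hb (by linarith) hh h0
      (dirichletGrid_gridBdd hxn hh hN H) ?_ (Eventually.of_forall fun k i _ => (H k).initial i)
    exact (hg.comp_continuous (f := fun y => ((0 : ℝ), y)) (by fun_prop)
      fun y => ⟨ht, mem_univ _⟩).continuousAt
  refine ⟨fun p hp => ?_, fun t ht x hx hp => (hbd t ht x hx hp).gridLim_eq hh h0 ht⟩
  by_cases hpb : p.1 = 0 ∨ p.2 = -n ∨ p.2 = n
  · have h1 := hbd p.1 hp.1 p.2 hp.2 hpb
    rwa [h1.gridLim_eq hh h0 hp.1]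
  · push Not at hpb
    have hxn : |p.2| < n := abs_lt.2
      ⟨lt_of_le_of_ne hp.2.1 (Ne.symm hpb.2.1), lt_of_le_of_ne hp.2.2 hpb.2.2⟩
    refine (dirichletGrid_gridBdd hxn hh hN H).gridConvAt ha hb (by linarith) hh h0
      ⟨lt_of_le_of_ne hp.1.1 (Ne.symm hpb.1), hp.1.2⟩ ?_
    rw [sub_self, abs_zero]
    linarith

lemma HasDerivWithinAt.nonneg_of_isMaxOn {f : ℝ → ℝ} {D T t : ℝ} (ht : t ∈ Ioc 0 T)
    (hf : HasDerivWithinAt f D (Icc 0 T) t) (hmax : IsMaxOn f (Icc 0 T) t) : 0 ≤ D := by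
  have h1 : (-t : ℝ) ∈ posTangentConeAt (Icc 0 T) t := by
    refine mem_posTangentConeAt_of_segment_subset ?_
    rw [add_neg_cancel, segment_symm, segment_eq_Icc ht.1.le]
    exact Icc_subset_Icc_right ht.2
  have h2 := hmax.localize.hasFDerivWithinAt_nonpos hf.hasFDerivWithinAt h1
  simp only [ContinuousLinearMap.toSpanSingleton_apply, smul_eq_mul] at h2
  have := ht.1
  nlinarith

lemma second_deriv_nonpos_of_isLocalMax {f p : ℝ → ℝ} {q x : ℝ}
    (hf : ∀ᶠ y in 𝓝 x, HasDerivAt f (p y) y) (hp : HasDerivAt p q x) (hmax : IsLocalMax f x) :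
    q ≤ 0 := by
  by_contra! hq
  have h1 : deriv f =ᶠ[𝓝 x] p := hf.mono fun y hy => hy.deriv
  have h2 : deriv (deriv f) x = q := by rw [h1.deriv_eq, hp.deriv]
  have hmin : IsLocalMin f x := isLocalMin_of_deriv_deriv_pos (by rwa [h2]) hmax.deriv_eq_zero
    hf.self_of_nhds.continuousAt
  have h3 : f =ᶠ[𝓝 x] fun _ => f x := by
    filter_upwards [hmax, hmin] with y h4 h5 using le_antisymm h4 h5
  have h4 : deriv f =ᶠ[𝓝 x] fun _ => 0 := by
    filter_upwards [h3.eventuallyEq_nhds] with y hy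
    rw [hy.deriv_eq, deriv_const]
  rw [h4.deriv_eq, deriv_const] at h2
  exact hq.ne h2

/-- A maximum principle on the rectangle `[0,T] × [-n,n]`. -/
lemma parabolic_max_principle {T n B : ℝ} {w : ℝ → ℝ → ℝ}
    (hw : ContinuousOn (Function.uncurry w) (Icc 0 T ×ˢ Icc (-n) n))
    (hbd : ∀ t ∈ Icc 0 T, ∀ x ∈ Icc (-n) n, (t = 0 ∨ x = -n ∨ x = n) → w t x ≤ 0)
    (H : ∀ t ∈ Ioc 0 T, ∀ x ∈ Ioo (-n) n, 0 < w t x → ∃ D a q : ℝ, ∃ p : ℝ → ℝ,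
      HasDerivWithinAt (fun s => w s x) D (Icc 0 T) t ∧
      (∀ᶠ y in 𝓝 x, HasDerivAt (w t) (p y) y) ∧ HasDerivAt p q x ∧ 0 ≤ a ∧
      D ≤ a * q + B * w t x) :
    ∀ t ∈ Icc 0 T, ∀ x ∈ Icc (-n) n, w t x ≤ 0 := by
  intro t₁ ht₁ x₁ hx₁
  by_contra! hpos
  set m : ℝ × ℝ → ℝ := fun p => Real.exp (-(B + 1) * p.1) * w p.1 p.2 with hm
  have hmc : ContinuousOn m (Icc 0 T ×ˢ Icc (-n) n) :=
    (Continuous.continuousOn (by fun_prop)).mul hw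
  obtain ⟨⟨t, x⟩, ⟨ht, hx⟩, hmax⟩ :=
    (isCompact_Icc.prod isCompact_Icc).exists_isMaxOn ⟨(t₁, x₁), ht₁, hx₁⟩ hmc
  simp only at ht hx
  have hwpos : 0 < w t x := by
    have h1 : m (t₁, x₁) ≤ m (t, x) := hmax (a := (t₁, x₁)) ⟨ht₁, hx₁⟩
    have h2 : 0 < m (t₁, x₁) := mul_pos (Real.exp_pos _) hpos
    exact pos_of_mul_pos_right (h2.trans_le h1) (Real.exp_pos _).le
  have hint : ¬(t = 0 ∨ x = -n ∨ x = n) := fun h => (hbd t ht x hx h).not_gt hwpos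
  push Not at hint
  have ht' : t ∈ Ioc 0 T := ⟨lt_of_le_of_ne ht.1 (Ne.symm hint.1), ht.2⟩
  have hx' : x ∈ Ioo (-n) n :=
    ⟨lt_of_le_of_ne hx.1 (Ne.symm hint.2.1), lt_of_le_of_ne hx.2 hint.2.2⟩
  obtain ⟨D, a, q, p, h1, h2, h3, ha, h4⟩ := H t ht' x hx' hwpos
  have hq : q ≤ 0 := by
    refine second_deriv_nonpos_of_isLocalMax h2 h3 ?_
    filter_upwards [Ioo_mem_nhds hx'.1 hx'.2] with y hy
    have : m (t, y) ≤ m (t, x) := hmax (a := (t, y)) ⟨ht, Ioo_subset_Icc_self hy⟩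
    exact le_of_mul_le_mul_left this (Real.exp_pos _)
  have h5 : HasDerivWithinAt (fun s => m (s, x))
      (Real.exp (-(B + 1) * t) * (D - (B + 1) * w t x)) (Icc 0 T) t := by
    refine (((hasDerivWithinAt_id t _).const_mul (-(B + 1))).exp.mul h1).congr_deriv ?_
    simp
    ring
  have h6 := h5.nonneg_of_isMaxOn ht' fun s hs => hmax (a := (s, x)) ⟨hs, hx⟩
  have h7 := nonneg_of_mul_nonneg_right h6 (Real.exp_pos _)
  nlinarith [mul_nonneg ha (neg_nonneg.2 hq)]

lemma eq_zero_of_integral_nonpos {f : ℝ → ℝ} {T : ℝ} (hT : 0 < T) (hf : ContinuousOn f (Icc 0 T))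
    (hnn : ∀ t ∈ Icc 0 T, 0 ≤ f t) (hint : ∫ t in (0 : ℝ)..T, f t ≤ 0) :
    ∀ t ∈ Icc 0 T, f t ≤ 0 := by
  by_contra! h
  obtain ⟨t, ht, hft⟩ := h
  exact hint.not_gt (intervalIntegral.integral_pos hT hf
    (fun s hs => hnn s (Ioc_subset_Icc_self hs)) ⟨t, ht, hft⟩)

lemma dirichletGrid_classical {𝒰 : Ultrafilter ℕ} {T a b n : ℝ} (ha : 0 < a) (hb : 0 ≤ b)
    {h : ℕ → ℝ} {N : ℕ → ℤ} {u : ℕ → ℤ → ℝ → ℝ} {g : ℝ → ℝ → ℝ} (hh : ∀ k, 0 < h k)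
    (h0 : Tendsto h 𝒰 (𝓝 0)) (hN : ∀ k, N k * h k = n)
    (H : ∀ k, DirichletGrid T a b g (h k) (N k) (u k)) :
    ∃ P Q : ℝ → ℝ → ℝ, (∀ t ∈ Ioc 0 T, ∀ x ∈ Ioo (-n) n,
      HasDerivAt (gridLim 𝒰 h fun k i => u k i t) (P t x) x ∧ HasDerivAt (P t) (Q t x) x ∧
      HasDerivWithinAt (fun s => gridLim 𝒰 h (fun k i => u k i s) x)
        (1 / 2 * gridLim 𝒰 h (fun k i => u k i t) x * Q t x) (Icc 0 T) t) ∧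
    ContinuousOn (Function.uncurry Q) (Ioc 0 T ×ˢ Ioo (-n) n) := by
  have key := fun x (hx : x ∈ Ioo (-n) n) =>
    (dirichletGrid_gridBdd (abs_lt.2 hx) hh hN H).classical (𝒰 := 𝒰) ha hb
      (by linarith [abs_lt.2 hx]) hh h0
  refine ⟨fun t => gridLim 𝒰 h fun k i => gridD1 (h k) (u k) i t,
    fun t => gridLim 𝒰 h fun k i => gridD2 (h k) (u k) i t, fun t ht x hx =>
    (key x hx).1 t ht x (by rw [sub_self, abs_zero]; linarith [abs_lt.2 hx]), ?_⟩
  rintro ⟨t, x⟩ ⟨ht, hx⟩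
  simp only at ht hx
  have hr : 0 < (n - |x|) / 2 / 4 := by linarith [abs_lt.2 hx]
  refine ((key x hx).2 (t, x) ⟨ht, Metric.mem_ball_self hr⟩).mono_of_mem_nhdsWithin ?_
  filter_upwards [self_mem_nhdsWithin, mem_nhdsWithin_of_mem_nhds
    (continuous_snd.tendsto (t, x) (Metric.ball_mem_nhds x hr))] with p hp1 hp2
  exact ⟨hp1.1, hp2⟩

lemma comparison_of_strict {σ T n : ℝ} {c U P Q : ℝ → ℝ → ℝ}
    (hcc : ContinuousOn (Function.uncurry c) (Icc 0 T ×ˢ univ))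
    (hcd : ∀ t ∈ Icc (0 : ℝ) T, ∀ x : ℝ,
      DifferentiableWithinAt ℝ (fun s => c s x) (Icc 0 T) t ∧
      DifferentiableAt ℝ (c t) x ∧ DifferentiableAt ℝ (deriv (c t)) x)
    (hc : ∀ t ∈ Icc (0 : ℝ) T, ∀ x : ℝ, σ * (1 / 2 * c t x * deriv (deriv (c t)) x) ≤
      σ * derivWithin (fun s => c s x) (Icc 0 T) t)
    (hc0 : ∀ t ∈ Icc (0 : ℝ) T, ∀ x : ℝ, 0 ≤ c t x)
    (hUc : ContinuousOn (Function.uncurry U) (Icc 0 T ×ˢ Icc (-n) n))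
    (hU : ∀ t ∈ Ioc 0 T, ∀ x ∈ Ioo (-n) n, HasDerivAt (U t) (P t x) x ∧
      HasDerivAt (P t) (Q t x) x ∧
      HasDerivWithinAt (fun s => U s x) (1 / 2 * U t x * Q t x) (Icc 0 T) t)
    (hQ : ContinuousOn (Function.uncurry Q) (Ioc 0 T ×ˢ Ioo (-n) n))
    (hbd : ∀ t ∈ Icc 0 T, ∀ x ∈ Icc (-n) n, (t = 0 ∨ x = -n ∨ x = n) → σ * (U t x - c t x) < 0) :
    ∀ t ∈ Icc 0 T, ∀ x ∈ Icc (-n) n, σ * (U t x - c t x) ≤ 0 := by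
  have hw : ContinuousOn (Function.uncurry fun t x => σ * (U t x - c t x))
      (Icc 0 T ×ˢ Icc (-n) n) :=
    continuousOn_const.mul (hUc.sub (hcc.mono (prod_mono_right (subset_univ _))))
  set S := (Icc 0 T ×ˢ Icc (-n) n) ∩
    (Function.uncurry fun t x => σ * (U t x - c t x)) ⁻¹' (Ici 0) with hS
  have hSc : IsCompact S := (isCompact_Icc.prod isCompact_Icc).of_isClosed_subset
    (hw.preimage_isClosed_of_isClosed (isClosed_Icc.prod isClosed_Icc) isClosed_Ici)
    inter_subset_left
  have hSsub : S ⊆ Ioc 0 T ×ˢ Ioo (-n) n := by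
    rintro ⟨t, x⟩ ⟨⟨ht, hx⟩, hp⟩
    simp only at ht hx
    have hp' : 0 ≤ σ * (U t x - c t x) := hp
    have hint : ¬(t = 0 ∨ x = -n ∨ x = n) := fun h => hp'.not_gt (hbd t ht x hx h)
    push Not at hint
    exact ⟨⟨lt_of_le_of_ne ht.1 (Ne.symm hint.1), ht.2⟩,
      ⟨lt_of_le_of_ne hx.1 (Ne.symm hint.2.1), lt_of_le_of_ne hx.2 hint.2.2⟩⟩
  obtain ⟨B, hB⟩ := hSc.exists_bound_of_continuousOn (hQ.mono hSsub)
  refine parabolic_max_principle (B := B / 2) hw (fun t ht x hx hp => (hbd t ht x hx hp).le)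
    fun t ht x hx hpos => ?_
  have ht' := Ioc_subset_Icc_self ht
  obtain ⟨d1, d2, d3⟩ := hcd t ht' x
  refine ⟨σ * (1 / 2 * U t x * Q t x - derivWithin (fun s => c s x) (Icc 0 T) t),
    1 / 2 * c t x, σ * (Q t x - deriv (deriv (c t)) x), fun y => σ * (P t y - deriv (c t) y),
    ((hU t ht x hx).2.2.sub d1.hasDerivWithinAt).const_mul σ, ?_,
    ((hU t ht x hx).2.1.sub d3.hasDerivAt).const_mul σ, by linarith [hc0 t ht' x], ?_⟩
  · filter_upwards [Ioo_mem_nhds hx.1 hx.2] with y hy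
    exact ((hU t ht y hy).1.sub (hcd t ht' y).2.1.hasDerivAt).const_mul σ
  · have h1 : |Q t x| ≤ B := hB (t, x) ⟨⟨ht', Ioo_subset_Icc_self hx⟩, hpos.le⟩
    have h2 := (le_abs_self _).trans h1
    have h3 := hc t ht' x
    have h4 : σ * (U t x - c t x) * Q t x ≤ σ * (U t x - c t x) * B := by gcongr
    linarith

lemma GridConvAt.uniform_floor {F : Filter ℕ} [F.NeBot] {T : ℝ} {h : ℕ → ℝ}
    {u : ℕ → ℤ → ℝ → ℝ} {f : ℝ → ℝ} {x : ℝ} (hh : ∀ k, 0 < h k) (h0 : Tendsto h F (𝓝 0))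
    (H : ∀ t ∈ Icc 0 T, GridConvAt F T h u (f t) t x) {e : ℝ} (he : 0 < e) :
    ∀ᶠ k in F, ∀ t ∈ Icc 0 T, |u k ⌊x / h k⌋ t - f t| < e := by
  have h1 := gridConvAt_uniform hh h0 (u := fun k _ t => u k ⌊x / h k⌋ t) (V := fun t _ => f t)
    (K := Icc 0 T ×ˢ {0}) (isCompact_Icc.prod isCompact_singleton)
    (prod_mono_right (subset_univ _)) (fun p hp e he => by
      obtain ⟨δ, hδ, h2⟩ := H p.1 hp.1 e he
      refine ⟨δ, hδ, ?_⟩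
      filter_upwards [h2, eventually_floor_mem hh h0 (x := x) (x₀ := x) (ρ := δ) (by simpa)]
        with k h3 h4 i _ t ht htδ
      exact h3 _ h4 t ht htδ) he
  filter_upwards [h1] with k hk t ht
  exact hk 0 t ⟨ht, by simp⟩

lemma grid_limit_integral_estimate {F : Filter ℕ} [F.NeBot] {T a b n η : ℝ} (hT : 0 ≤ T)
    (ha : 0 < a) (hη : 0 < η) {h : ℕ → ℝ} {N : ℕ → ℤ} {v w : ℕ → ℤ → ℝ → ℝ} {gv gw : ℝ → ℝ → ℝ}
    (hh : ∀ k, 0 < h k) (h0 : Tendsto h F (𝓝 0)) (hN : ∀ k, N k * h k = n)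
    (hg : ∀ t x, gw t x = gv t x + η)
    (hv : ∀ k, DirichletGrid T a b gv (h k) (N k) (v k))
    (hw : ∀ k, DirichletGrid T a b gw (h k) (N k) (w k)) {x : ℝ} (hx : x ∈ Icc (-n) n)
    {V W : ℝ → ℝ} (hV : ∀ t ∈ Icc 0 T, GridConvAt F T h v (V t) t x)
    (hW : ∀ t ∈ Icc 0 T, GridConvAt F T h w (W t) t x) :
    (∀ t ∈ Icc 0 T, V t ≤ W t) ∧ ∀ f, ContinuousOn f (Icc 0 T) →
      (∀ t ∈ Icc 0 T, f t ≤ W t - V t) →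
      ∫ t in (0 : ℝ)..T, f t ≤ η * (3 * T + 2 / a * n ^ 2) := by
  have hbd : ∀ k i, N k ≤ |i| → ∀ t ∈ Icc 0 T, w k i t = v k i t + η := fun k i hi t ht => by
    rw [(hv k).bdry i hi t ht, (hw k).bdry i hi t ht, hg]
  have hin : ∀ k i, w k i 0 = v k i 0 + η := fun k i => by
    rw [(hv k).initial i, (hw k).initial i, hg]
  constructor
  · intro t ht
    exact le_of_tendsto_of_tendsto' ((hV t ht).tendsto (tendsto_floor_mul hh h0 x)
      tendsto_const_nhds (Eventually.of_forall fun _ => ht))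
      ((hW t ht).tendsto (tendsto_floor_mul hh h0 x) tendsto_const_nhds
        (Eventually.of_forall fun _ => ht)) fun k =>
      grid_comparison (hh k) ha hη (hv k).solves (hw k).solves (hbd k) (hin k) (hv k).bound
        (hw k).bound _ t ht
  · intro f hf hfle
    obtain ⟨k, k1, k2⟩ := ((GridConvAt.uniform_floor hh h0 hV hη).and
      (GridConvAt.uniform_floor hh h0 hW hη)).exists
    set i := ⌊x / h k⌋ with hi
    have hiN : |i| ≤ N k := by
      rw [abs_le]
      constructor
      · rw [hi, Int.le_floor, le_div_iff₀ (hh k)]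
        push_cast
        rw [neg_mul, hN]
        exact hx.1
      · have h1 : (i : ℝ) ≤ N k :=
          (Int.floor_le _).trans ((div_le_iff₀ (hh k)).2 ((hN k).symm ▸ hx.2))
        exact_mod_cast h1
    have h1 := grid_integral_estimate (hh k) ha hη (hv k).solves (hw k).solves (hv k).cont
      (hw k).cont (hbd k) (hin k) (hv k).bound (hw k).bound i hiN T ⟨hT, le_rfl⟩
    rw [hN] at h1
    have hd : IntervalIntegrable (fun s => w k i s - v k i s) MeasureTheory.volume 0 T := by
      refine ContinuousOn.intervalIntegrable ?_
      rw [uIcc_of_le hT]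
      exact ((hw k).cont i).sub ((hv k).cont i)
    have h2 : ∫ t in (0 : ℝ)..T, f t ≤ ∫ t in (0 : ℝ)..T, ((w k i t - v k i t) + 2 * η) := by
      refine intervalIntegral.integral_mono_on hT ?_
        (hd.add (intervalIntegrable_const (c := 2 * η))) fun t ht => ?_
      · refine ContinuousOn.intervalIntegrable ?_
        rwa [uIcc_of_le hT]
      · have a1 := abs_lt.1 (k1 t ht)
        have a2 := abs_lt.1 (k2 t ht)
        have a3 := hfle t ht
        linarith [a1.2, a2.1]
    rw [intervalIntegral.integral_add hd intervalIntegrable_const,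
      intervalIntegral.integral_const, sub_zero, smul_eq_mul] at h2
    refine (h2.trans (add_le_add_left h1 _)).trans_eq ?_
    ring

lemma dirichletGrid_one_sided {𝒰 : Ultrafilter ℕ} {σ T a b n η₀ : ℝ} (hσ : σ = 1 ∨ σ = -1)
    (hT : 0 < T) (ha : 0 < a) (hn : 0 < n) (hη₀ : 0 < η₀) (hab : a ≤ b) {h : ℕ → ℝ} {N : ℕ → ℤ}
    {u : ℕ → ℤ → ℝ → ℝ} {g c : ℝ → ℝ → ℝ} (hh : ∀ k, 0 < h k) (h0 : Tendsto h 𝒰 (𝓝 0))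
    (hN : ∀ k, N k * h k = n) (hg : ContinuousOn (Function.uncurry g) (Icc 0 T ×ˢ univ))
    (hgb : ∀ t ∈ Icc 0 T, ∀ x, a + η₀ ≤ g t x ∧ g t x ≤ b - η₀)
    (H : ∀ k, DirichletGrid T a b g (h k) (N k) (u k))
    (hcc : ContinuousOn (Function.uncurry c) (Icc 0 T ×ˢ univ))
    (hcd : ∀ t ∈ Icc (0 : ℝ) T, ∀ x : ℝ,
      DifferentiableWithinAt ℝ (fun s => c s x) (Icc 0 T) t ∧
      DifferentiableAt ℝ (c t) x ∧ DifferentiableAt ℝ (deriv (c t)) x)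
    (hc : ∀ t ∈ Icc (0 : ℝ) T, ∀ x : ℝ, σ * (1 / 2 * c t x * deriv (deriv (c t)) x) ≤
      σ * derivWithin (fun s => c s x) (Icc 0 T) t)
    (hc0 : ∀ t ∈ Icc (0 : ℝ) T, ∀ x : ℝ, 0 ≤ c t x)
    (hgc : ∀ t ∈ Icc 0 T, ∀ x ∈ Icc (-n) n, (t = 0 ∨ x = -n ∨ x = n) → σ * (g t x - c t x) ≤ 0) :
    ∀ t ∈ Icc 0 T, ∀ x ∈ Icc (-n) n, σ * (gridLim 𝒰 h (fun k i => u k i t) x - c t x) ≤ 0 := by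
  have hb : 0 ≤ b := ha.le.trans hab
  have hσσ : σ * σ = 1 := by rcases hσ with rfl | rfl <;> norm_num
  obtain ⟨hU, -⟩ := dirichletGrid_gridConvAt ha hb hn hh h0 hN hg H
  have hK : Icc 0 T ×ˢ Icc (-n) n ⊆ Icc 0 T ×ˢ univ := prod_mono_right (subset_univ _)
  have hUc := gridConvAt_continuousOn (V := fun t x => gridLim 𝒰 h (fun k i => u k i t) x) hh h0 hK hU
  intro t ht x hx
  set U : ℝ → ℝ := fun t => gridLim 𝒰 h (fun k i => u k i t) x with hUdef
  have hfc : ContinuousOn (fun s => max (σ * (U s - c s x)) 0) (Icc 0 T) := by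
    refine ContinuousOn.sup (continuousOn_const.mul (ContinuousOn.sub ?_ ?_)) continuousOn_const
    · exact hUc.comp (f := fun t => (t, x)) (by fun_prop) fun t ht => ⟨ht, hx⟩
    · exact hcc.comp (f := fun t => (t, x)) (by fun_prop) fun t ht => ⟨ht, mem_univ _⟩
  refine (le_max_left _ 0).trans (eq_zero_of_integral_nonpos hT hfc
    (fun s _ => le_max_right _ _) ?_ t ht)
  have hlim : Tendsto (fun η : ℝ => η * (3 * T + 2 / a * n ^ 2)) (𝓝[>] 0) (𝓝 0) := by
    have : Tendsto (fun η : ℝ => η * (3 * T + 2 / a * n ^ 2)) (𝓝 0)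
        (𝓝 (0 * (3 * T + 2 / a * n ^ 2))) := tendsto_id.mul_const _
    rw [zero_mul] at this
    exact this.mono_left nhdsWithin_le_nhds
  refine ge_of_tendsto hlim ?_
  filter_upwards [Ioc_mem_nhdsGT hη₀] with η hη
  have hg' : ContinuousOn (Function.uncurry fun t x => g t x - σ * η) (Icc 0 T ×ˢ univ) :=
    hg.sub continuousOn_const
  have hgb' : ∀ t ∈ Icc 0 T, ∀ x, a ≤ g t x - σ * η ∧ g t x - σ * η ≤ b := by
    intro t ht x
    obtain ⟨b1, b2⟩ := hgb t ht x
    rcases hσ with rfl | rfl <;> constructor <;> linarith [hη.1, hη.2]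
  choose v hv using fun k => exists_dirichletGrid hT (hh k) ha hab (N k) hg' hgb'
  obtain ⟨hV, hVb⟩ := dirichletGrid_gridConvAt ha hb hn hh h0 hN hg' hv
  obtain ⟨P, Q, hPQ, hQ⟩ := dirichletGrid_classical ha hb hh h0 hN hv
  have hcmp := comparison_of_strict (n := n)
    (U := fun t x => gridLim 𝒰 h (fun k i => v k i t) x) hcc hcd hc hc0
    (gridConvAt_continuousOn hh h0 hK hV) hPQ hQ (fun t ht x hx hp => by
      rw [hVb t ht x hx hp]
      have := hgc t ht x hx hp
      nlinarith [hη.1])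
  have hmain : (∀ s ∈ Icc 0 T, 0 ≤ σ * (U s - gridLim 𝒰 h (fun k i => v k i s) x)) ∧
      ∀ f, ContinuousOn f (Icc 0 T) →
      (∀ s ∈ Icc 0 T, f s ≤ σ * (U s - gridLim 𝒰 h (fun k i => v k i s) x)) →
      ∫ s in (0 : ℝ)..T, f s ≤ η * (3 * T + 2 / a * n ^ 2) := by
    rcases hσ with rfl | rfl
    · have := grid_limit_integral_estimate hT.le ha hη.1 hh h0 hN (fun t x => by ring) hv H hx
        (V := fun s => gridLim 𝒰 h (fun k i => v k i s) x) (W := U)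
        (fun s hs => hV (s, x) ⟨hs, hx⟩) (fun s hs => hU (s, x) ⟨hs, hx⟩)
      simpa only [one_mul, sub_nonneg] using this
    · have := grid_limit_integral_estimate hT.le ha hη.1 hh h0 hN (fun t x => by ring) H hv hx
        (V := U) (W := fun s => gridLim 𝒰 h (fun k i => v k i s) x)
        (fun s hs => hU (s, x) ⟨hs, hx⟩) (fun s hs => hV (s, x) ⟨hs, hx⟩)
      simpa only [neg_one_mul, neg_sub, sub_nonneg] using this
  refine hmain.2 _ hfc fun s hs => max_le ?_ (hmain.1 s hs)
  have := hcmp s hs x hx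
  linarith

/-- Between a sub- and a supersolution there are approximately sandwiched grid solutions on
arbitrarily large intervals. -/
lemma exists_sandwiched_grid {T ε : ℝ} (hT : 0 < T) (hε : 0 < ε) {lb ub : ℝ → ℝ → ℝ}
    (hle : ∀ t ∈ Icc (0 : ℝ) T, ∀ x : ℝ, lb t x ≤ ub t x)
    (hlbc : ContinuousOn (Function.uncurry lb) (Icc 0 T ×ˢ (univ : Set ℝ)))
    (hubc : ContinuousOn (Function.uncurry ub) (Icc 0 T ×ˢ (univ : Set ℝ)))
    (hlbd : ∀ t ∈ Icc (0 : ℝ) T, ∀ x : ℝ,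
      DifferentiableWithinAt ℝ (fun s => lb s x) (Icc 0 T) t ∧
      DifferentiableAt ℝ (lb t) x ∧ DifferentiableAt ℝ (deriv (lb t)) x)
    (hubd : ∀ t ∈ Icc (0 : ℝ) T, ∀ x : ℝ,
      DifferentiableWithinAt ℝ (fun s => ub s x) (Icc 0 T) t ∧
      DifferentiableAt ℝ (ub t) x ∧ DifferentiableAt ℝ (deriv (ub t)) x)
    (hsub : ∀ t ∈ Icc (0 : ℝ) T, ∀ x : ℝ,
      derivWithin (fun s => lb s x) (Icc 0 T) t ≤ (1 / 2) * lb t x * deriv (deriv (lb t)) x)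
    (hsup : ∀ t ∈ Icc (0 : ℝ) T, ∀ x : ℝ,
      (1 / 2) * ub t x * deriv (deriv (ub t)) x ≤ derivWithin (fun s => ub s x) (Icc 0 T) t)
    (hlbpos : ∀ t ∈ Icc (0 : ℝ) T, ∀ x : ℝ, ε ≤ lb t x) {u₀ : ℝ → ℝ} (hu₀ : Continuous u₀)
    (h0 : ∀ x : ℝ, lb 0 x ≤ u₀ x ∧ u₀ x ≤ ub 0 x) {n e : ℝ} (hn : 0 < n) (he : 0 < e) :
    ∃ (h : ℝ) (u : ℤ → ℝ → ℝ), 0 < h ∧ h < e ∧ ∀ i : ℤ, |(i : ℝ) * h| < n →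
      SolvesAt T h u i ∧ u i 0 = u₀ (i * h) ∧
      ∀ t ∈ Icc 0 T, ε / 2 ≤ u i t ∧ lb t (i * h) - e ≤ u i t ∧ u i t ≤ ub t (i * h) + e := by
  have h0T : (0 : ℝ) ∈ Icc 0 T := ⟨le_rfl, hT.le⟩
  set y : ℝ → ℝ := fun x => max (-n) (min n x) with hy
  have hyc : Continuous y := by fun_prop
  have hymem : ∀ x, y x ∈ Icc (-n) n := fun x =>
    ⟨le_max_left _ _, max_le (by linarith) (min_le_left _ _)⟩
  have hyid : ∀ x ∈ Icc (-n) n, y x = x := fun x hx => by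
    rw [hy]
    simp only
    rw [min_eq_right hx.2, max_eq_right hx.1]
  set g : ℝ → ℝ → ℝ := fun t x => max (lb t (y x)) (min (ub t (y x)) (u₀ (y x))) with hg
  have hycomp : ∀ {f : ℝ → ℝ → ℝ}, ContinuousOn (Function.uncurry f) (Icc 0 T ×ˢ univ) →
      ContinuousOn (fun p : ℝ × ℝ => f p.1 (y p.2)) (Icc 0 T ×ˢ univ) := fun hf =>
    hf.comp (f := fun p : ℝ × ℝ => (p.1, y p.2)) (by fun_prop) fun p hp => ⟨hp.1, mem_univ _⟩
  have hgc : ContinuousOn (Function.uncurry g) (Icc 0 T ×ˢ univ) :=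
    (hycomp hlbc).sup ((hycomp hubc).inf (Continuous.continuousOn (by fun_prop)))
  obtain ⟨M, hM⟩ := (isCompact_Icc.prod isCompact_Icc).exists_bound_of_continuousOn
    (hubc.mono (prod_mono_right (subset_univ (Icc (-n) n))))
  have hgl : ∀ t x, lb t (y x) ≤ g t x := fun t x => le_max_left _ _
  have hgu : ∀ t ∈ Icc 0 T, ∀ x, g t x ≤ ub t (y x) := fun t ht x =>
    max_le (hle t ht _) (min_le_left _ _)
  have hgM : ∀ t ∈ Icc 0 T, ∀ x, ε ≤ g t x ∧ g t x ≤ M := fun t ht x =>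
    ⟨(hlbpos t ht _).trans (hgl t x),
      (hgu t ht x).trans ((le_abs_self _).trans (hM (t, y x) ⟨ht, hymem x⟩))⟩
  have hg0 : ∀ x ∈ Icc (-n) n, g 0 x = u₀ x := fun x hx => by
    simp only [hg, hyid x hx]
    rw [min_eq_right (h0 x).2, max_eq_right (h0 x).1]
  have hεM : ε ≤ M := (hgM 0 h0T 0).1.trans (hgM 0 h0T 0).2
  set h : ℕ → ℝ := fun k => n / (k + 1) with hh
  have hhpos : ∀ k, 0 < h k := fun k => by positivity
  have hh0 : Tendsto h (hyperfilter ℕ) (𝓝 0) := by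
    have h1 := (tendsto_const_div_atTop_nhds_zero_nat n).comp (tendsto_add_atTop_nat 1)
    refine Tendsto.mono_left ?_ Nat.hyperfilter_le_atTop
    refine h1.congr fun k => ?_
    simp [hh]
  have hN : ∀ k : ℕ, ((k + 1 : ℤ) : ℝ) * h k = n := fun k => by
    simp only [hh]
    push_cast
    field_simp
  have hha : 0 < ε / 2 := half_pos hε
  have hgab : ∀ t ∈ Icc 0 T, ∀ x, ε / 2 + ε / 2 ≤ g t x ∧ g t x ≤ (M + ε / 2) - ε / 2 :=
    fun t ht x => ⟨by linarith [(hgM t ht x).1], by linarith [(hgM t ht x).2]⟩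
  choose u hu using fun k : ℕ => exists_dirichletGrid (a := ε / 2) (b := M + ε / 2) hT (hhpos k)
    hha (by linarith) (k + 1 : ℤ) hgc fun t ht x =>
      ⟨by linarith [(hgM t ht x).1], by linarith [(hgM t ht x).2]⟩
  have hU := (dirichletGrid_gridConvAt hha (by linarith) hn hhpos hh0 hN hgc hu).1
  have hupper := dirichletGrid_one_sided (σ := 1) (Or.inl rfl) hT hha hn hha (by linarith) hhpos
    hh0 hN hgc hgab hu hubc hubd (by simpa only [one_mul] using hsup)
    (fun t ht x => (hε.le.trans (hlbpos t ht x)).trans (hle t ht x)) (fun t ht x hx _ => by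
      have := hgu t ht x
      rw [hyid x hx] at this
      linarith)
  have hlower := dirichletGrid_one_sided (σ := -1) (Or.inr rfl) hT hha hn hha (by linarith) hhpos
    hh0 hN hgc hgab hu hlbc hlbd (by simpa only [neg_one_mul, neg_le_neg_iff] using hsub)
    (fun t ht x => hε.le.trans (hlbpos t ht x)) (fun t ht x hx _ => by
      have := hgl t x
      rw [hyid x hx] at this
      linarith)
  obtain ⟨k, hk1, hk2⟩ := ((gridConvAt_uniform
    (V := fun t x => gridLim (hyperfilter ℕ) h (fun k i => u k i t) x) hhpos hh0
    (isCompact_Icc.prod isCompact_Icc) (prod_mono_right (subset_univ _)) hU he).and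
    (hh0.eventually_lt_const he)).exists
  refine ⟨h k, u k, hhpos k, hk2, fun i hi => ?_⟩
  have hmem : (i : ℝ) * h k ∈ Icc (-n) n := abs_le.1 hi.le
  have hiN : |i| < (k + 1 : ℤ) := by
    rw [← hN k, abs_mul, abs_of_pos (hhpos k)] at hi
    exact_mod_cast lt_of_mul_lt_mul_right hi (hhpos k).le
  refine ⟨(hu k).solves i hiN, ?_, fun t ht => ⟨((hu k).bound i t ht).1, ?_, ?_⟩⟩
  · rw [(hu k).initial, hg0 _ hmem]
  · have a1 := (abs_lt.1 (hk1 i t ⟨ht, hmem⟩)).1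
    have a2 := hlower t ht _ hmem
    linarith
  · have a1 := (abs_lt.1 (hk1 i t ⟨ht, hmem⟩)).2
    have a2 := hupper t ht _ hmem
    linarith

/-- The limit of locally bounded grid solutions on exhausting intervals is a classical solution. -/
lemma gridLim_classical_solution {𝒰 : Ultrafilter ℕ} {T ε : ℝ} (hT : 0 < T) (hε : 0 < ε)
    {h : ℕ → ℝ} {u : ℕ → ℤ → ℝ → ℝ} {u₀ : ℝ → ℝ} {U : ℝ → ℝ → ℝ} (hh : ∀ k, 0 < h k)
    (hh0 : Tendsto h 𝒰 (𝓝 0)) (hu₀ : Continuous u₀)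
    (hbdd : ∀ x₀ : ℝ, ∃ M ≥ 0, GridBdd 𝒰 T ε M 4 x₀ h u)
    (hin : ∀ x₀ : ℝ, ∀ᶠ k in 𝒰, ∀ i : ℤ, |(i : ℝ) * h k - x₀| ≤ 4 → u k i 0 = u₀ (i * h k))
    (hU : U = fun t => gridLim 𝒰 h fun k i => u k i t) :
    (∀ p ∈ Icc 0 T ×ˢ (univ : Set ℝ), GridConvAt 𝒰 T h u (U p.1 p.2) p.1 p.2) ∧
    ContinuousOn (Function.uncurry U) (Icc 0 T ×ˢ (univ : Set ℝ)) ∧ (∀ x : ℝ, U 0 x = u₀ x) ∧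
    (∀ t ∈ Ioc (0:ℝ) T, ∀ x : ℝ,
      DifferentiableWithinAt ℝ (fun s => U s x) (Icc 0 T) t ∧
      DifferentiableAt ℝ (U t) x ∧ DifferentiableAt ℝ (deriv (U t)) x ∧
      derivWithin (fun s => U s x) (Icc 0 T) t = (1/2) * U t x * deriv (deriv (U t)) x) ∧
    ContinuousOn (fun p : ℝ × ℝ => derivWithin (fun s => U s p.2) (Icc 0 T) p.1)
      (Ioc (0:ℝ) T ×ˢ (univ : Set ℝ)) ∧
    ContinuousOn (fun p : ℝ × ℝ => deriv (deriv (U p.1)) p.2)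
      (Ioc (0:ℝ) T ×ˢ (univ : Set ℝ)) := by
  set P : ℝ → ℝ → ℝ := fun t => gridLim 𝒰 h fun k i => gridD1 (h k) (u k) i t with hP
  set Q : ℝ → ℝ → ℝ := fun t => gridLim 𝒰 h fun k i => gridD2 (h k) (u k) i t with hQ
  have h0T : (0 : ℝ) ∈ Icc 0 T := ⟨le_rfl, hT.le⟩
  have hinit : ∀ x, GridConvAt 𝒰 T h u (u₀ x) 0 x := fun x => by
    obtain ⟨M, hM, H⟩ := hbdd x
    refine gridConvAt_initial hε hM (by norm_num) hh hh0 H hu₀.continuousAt ?_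
    exact hin x
  have hU0 : ∀ x, U 0 x = u₀ x := fun x => by
    rw [hU]
    exact (hinit x).gridLim_eq hh hh0 h0T
  have hconv : ∀ p ∈ Icc 0 T ×ˢ (univ : Set ℝ),
      GridConvAt 𝒰 T h u (U p.1 p.2) p.1 p.2 := by
    rintro ⟨t, x⟩ ⟨ht, -⟩
    simp only at ht ⊢
    rcases ht.1.eq_or_lt with rfl | ht0
    · rw [hU0]
      exact hinit x
    · obtain ⟨M, hM, H⟩ := hbdd x
      rw [hU]
      exact H.gridConvAt hε hM (by norm_num) hh hh0 ⟨ht0, ht.2⟩ (by simp)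
  have hclass : ∀ t ∈ Ioc 0 T, ∀ x, HasDerivAt (U t) (P t x) x ∧ HasDerivAt (P t) (Q t x) x ∧
      HasDerivWithinAt (fun s => U s x) (1 / 2 * U t x * Q t x) (Icc 0 T) t := fun t ht x => by
    obtain ⟨M, hM, H⟩ := hbdd x
    rw [hU]
    exact (H.classical hε hM (by norm_num) hh hh0).1 t ht x (by simp)
  have hQc : ContinuousOn (fun p : ℝ × ℝ => Q p.1 p.2) (Ioc 0 T ×ˢ univ) := by
    rintro ⟨t, x⟩ ⟨ht, -⟩
    obtain ⟨M, hM, H⟩ := hbdd x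
    refine ((H.classical hε hM (by norm_num) hh hh0).2 (t, x)
      ⟨ht, Metric.mem_ball_self (by norm_num)⟩).mono_of_mem_nhdsWithin ?_
    filter_upwards [self_mem_nhdsWithin, mem_nhdsWithin_of_mem_nhds
      (continuous_snd.tendsto (t, x) (Metric.ball_mem_nhds x (by norm_num : (0 : ℝ) < 4 / 4)))]
      with p hp1 hp2
    exact ⟨hp1.1, hp2⟩
  have hUc : ContinuousOn (Function.uncurry U) (Icc 0 T ×ˢ univ) :=
    gridConvAt_continuousOn hh hh0 Subset.rfl hconv
  have hdU : ∀ t ∈ Ioc 0 T, deriv (U t) = P t := fun t ht => funext fun x => (hclass t ht x).1.deriv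
  have hddU : ∀ t ∈ Ioc 0 T, ∀ x, deriv (deriv (U t)) x = Q t x := fun t ht x => by
    rw [hdU t ht, (hclass t ht x).2.1.deriv]
  have hdt : ∀ t ∈ Ioc 0 T, ∀ x, derivWithin (fun s => U s x) (Icc 0 T) t
      = 1 / 2 * U t x * Q t x := fun t ht x =>
    (hclass t ht x).2.2.derivWithin (uniqueDiffOn_Icc hT t (Ioc_subset_Icc_self ht))
  refine ⟨hconv, hUc, hU0, fun t ht x => ⟨(hclass t ht x).2.2.differentiableWithinAt,
    (hclass t ht x).1.differentiableAt, ?_, ?_⟩, ?_, ?_⟩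
  · rw [hdU t ht]
    exact (hclass t ht x).2.1.differentiableAt
  · rw [hdt t ht, hddU t ht]
  · refine ContinuousOn.congr (f := fun p => 1 / 2 * U p.1 p.2 * Q p.1 p.2) ?_
      fun p hp => hdt p.1 hp.1 p.2
    exact (continuousOn_const.mul (hUc.mono (prod_mono_left Ioc_subset_Icc_self))).mul hQc
  · exact hQc.congr fun p hp => hddU p.1 hp.1 p.2

/-- Sandwich existence: given ordered classical sub- and
supersolutions `lb ≤ ub` of `∂ₜ u = (1/2) u ∂ₓ² u` on `[0,T] × ℝ` with
`inf lb > 0`, and a `C¹` initial datum `u₀` with `lb(0,·) ≤ u₀ ≤ ub(0,·)`, there is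
a classical solution `u` on `[0,T] × ℝ` with `u(0,·) = u₀` and `lb ≤ u ≤ ub`. -/
theorem sandwich_existence
    (T : ℝ) (hT : 0 < T) (lb ub : ℝ → ℝ → ℝ)
    (hle : ∀ t ∈ Icc (0:ℝ) T, ∀ x : ℝ, lb t x ≤ ub t x)
    (hlbc : ContinuousOn (Function.uncurry lb) (Icc 0 T ×ˢ (univ : Set ℝ)))
    (hubc : ContinuousOn (Function.uncurry ub) (Icc 0 T ×ˢ (univ : Set ℝ)))
    (hlbd : ∀ t ∈ Icc (0:ℝ) T, ∀ x : ℝ,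
      DifferentiableWithinAt ℝ (fun s => lb s x) (Icc 0 T) t ∧
      DifferentiableAt ℝ (lb t) x ∧ DifferentiableAt ℝ (deriv (lb t)) x)
    (hubd : ∀ t ∈ Icc (0:ℝ) T, ∀ x : ℝ,
      DifferentiableWithinAt ℝ (fun s => ub s x) (Icc 0 T) t ∧
      DifferentiableAt ℝ (ub t) x ∧ DifferentiableAt ℝ (deriv (ub t)) x)
    (hsub : ∀ t ∈ Icc (0:ℝ) T, ∀ x : ℝ,
      derivWithin (fun s => lb s x) (Icc 0 T) t ≤ (1/2) * lb t x * deriv (deriv (lb t)) x)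
    (hsup : ∀ t ∈ Icc (0:ℝ) T, ∀ x : ℝ,
      (1/2) * ub t x * deriv (deriv (ub t)) x ≤ derivWithin (fun s => ub s x) (Icc 0 T) t)
    (ε : ℝ) (hε : 0 < ε) (hlbpos : ∀ t ∈ Icc (0:ℝ) T, ∀ x : ℝ, ε ≤ lb t x)
    (u₀ : ℝ → ℝ) (hu₀ : ContDiff ℝ 1 u₀)
    (h0 : ∀ x : ℝ, lb 0 x ≤ u₀ x ∧ u₀ x ≤ ub 0 x) :
    ∃ u : ℝ → ℝ → ℝ,
      ContinuousOn (Function.uncurry u) (Icc 0 T ×ˢ (univ : Set ℝ)) ∧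
      (∀ x : ℝ, u 0 x = u₀ x) ∧
      (∀ t ∈ Ioc (0:ℝ) T, ∀ x : ℝ,
        DifferentiableWithinAt ℝ (fun s => u s x) (Icc 0 T) t ∧
        DifferentiableAt ℝ (u t) x ∧ DifferentiableAt ℝ (deriv (u t)) x ∧
        derivWithin (fun s => u s x) (Icc 0 T) t
          = (1/2) * u t x * deriv (deriv (u t)) x) ∧
      ContinuousOn (fun p : ℝ × ℝ => derivWithin (fun s => u s p.2) (Icc 0 T) p.1)
        (Ioc (0:ℝ) T ×ˢ (univ : Set ℝ)) ∧
      ContinuousOn (fun p : ℝ × ℝ => deriv (deriv (u p.1)) p.2)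
        (Ioc (0:ℝ) T ×ˢ (univ : Set ℝ)) ∧
      (∀ t ∈ Icc (0:ℝ) T, ∀ x : ℝ, lb t x ≤ u t x ∧ u t x ≤ ub t x) := by
  choose h u hh hhk hu using fun k : ℕ => exists_sandwiched_grid hT hε hle hlbc hubc hlbd hubd hsub
    hsup hlbpos hu₀.continuous h0 (n := (k : ℝ) + 1) (e := 1 / ((k : ℝ) + 1)) (by positivity)
    (by positivity)
  have he0 : Tendsto (fun k : ℕ => 1 / ((k : ℝ) + 1)) (hyperfilter ℕ) (𝓝 0) :=
    tendsto_one_div_add_atTop_nhds_zero_nat.mono_left Nat.hyperfilter_le_atTop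
  have hh0 : Tendsto h (hyperfilter ℕ) (𝓝 0) :=
    squeeze_zero (fun k => (hh k).le) (fun k => (hhk k).le) he0
  have hlarge : ∀ C : ℝ, ∀ᶠ k : ℕ in (hyperfilter ℕ : Filter ℕ), C < (k : ℝ) + 1 := fun C =>
    ((tendsto_natCast_atTop_atTop (R := ℝ)).eventually_gt_atTop C).filter_mono
      Nat.hyperfilter_le_atTop |>.mono fun k hk => hk.trans (lt_add_one _)
  have hbox : ∀ x₀ : ℝ, ∀ᶠ k : ℕ in (hyperfilter ℕ : Filter ℕ), ∀ i : ℤ,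
      |(i : ℝ) * h k - x₀| ≤ 4 → |(i : ℝ) * h k| < (k : ℝ) + 1 := fun x₀ => by
    filter_upwards [hlarge (|x₀| + 4)] with k hk i hi
    have := abs_add_le ((i : ℝ) * h k - x₀) x₀
    rw [sub_add_cancel] at this
    linarith
  have hbdd : ∀ x₀ : ℝ, ∃ M ≥ 0, GridBdd (hyperfilter ℕ) T (ε / 2) M 4 x₀ h u := fun x₀ => by
    obtain ⟨M, hM⟩ := (isCompact_Icc.prod isCompact_Icc).exists_bound_of_continuousOn
      (hubc.mono (prod_mono_right (subset_univ (Icc (x₀ - 4) (x₀ + 4)))))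
    refine ⟨|M| + 1, by positivity, ?_⟩
    filter_upwards [hbox x₀, he0.eventually_le_const one_pos] with k hk hk1 i hi
    obtain ⟨a1, -, a2⟩ := hu k i (hk i hi)
    refine ⟨a1, fun t ht => ⟨(a2 t ht).1, (a2 t ht).2.2.trans ?_⟩⟩
    have hi' := abs_le.1 hi
    have a3 := hM (t, (i : ℝ) * h k) ⟨ht, by linarith [hi'.1], by linarith [hi'.2]⟩
    have a4 := (le_abs_self _).trans a3
    have a5 : ub t (i * h k) ≤ M := a4
    linarith [le_abs_self M]
  obtain ⟨hconv, hUc, hU0, hpde, hcont⟩ := gridLim_classical_solution hT (half_pos hε) hh hh0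
    hu₀.continuous hbdd (fun x => (hbox x).mono fun k hk i hi => (hu k i (hk i hi)).2.1) rfl
  refine ⟨_, hUc, hU0, hpde, hcont.1, hcont.2, fun t ht x => ?_⟩
  have hx := tendsto_floor_mul hh hh0 x
  have hlim := (hconv (t, x) ⟨ht, mem_univ _⟩).tendsto hx tendsto_const_nhds
    (Eventually.of_forall fun _ => ht)
  have hev : ∀ᶠ k : ℕ in (hyperfilter ℕ : Filter ℕ), |(⌊x / h k⌋ : ℝ) * h k| < (k : ℝ) + 1 := by
    filter_upwards [hbox x, eventually_floor_mem hh hh0 (x := x) (x₀ := x) (ρ := 4) (by simp)]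
      with k k1 k2
    exact k1 _ k2.le
  have hslice : ∀ {f : ℝ → ℝ → ℝ}, ContinuousOn (Function.uncurry f) (Icc 0 T ×ˢ univ) →
      Tendsto (fun k => f t (⌊x / h k⌋ * h k)) (hyperfilter ℕ) (𝓝 (f t x)) := fun {f} hf =>
    ((hf.comp_continuous (f := fun y => (t, y)) (by fun_prop)
      fun y => ⟨ht, mem_univ _⟩).tendsto x).comp hx
  constructor
  · have := (hslice hlbc).sub he0
    rw [sub_zero] at this
    exact le_of_tendsto_of_tendsto this hlim (hev.mono fun k hk => ((hu k _ hk).2.2 t ht).2.1)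
  · have := (hslice hubc).add he0
    rw [add_zero] at this
    exact le_of_tendsto_of_tendsto hlim this (hev.mono fun k hk => ((hu k _ hk).2.2 t ht).2.2)
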